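/- Let 𝕂 be a number field and assume the Generalized Riemann Hypothesis for ζ_𝕂. Then for every ε > 0, the summatory function M_𝕂(x) = ∑_{m ≤ x} b_m satisfies M_𝕂(x) = O_ε(x^{1/2+ε}) as x → ∞. -/

import Mathlib

namespace LatticeSum

open MeasureTheory Real FourierTransform

theorem norm_integral_le_of_vanishing {f : ℝ → ℂ} {R M : ℝ} (hR : 0 ≤ R)
    (hsupp : ∀ x, f x ≠ 0 → |x| ≤ R) (hM : ∀ x, ‖f x‖ ≤ M) :
    ∫ x, ‖f x‖ ≤ M * (2 * R) := by
  have h1 : ∫ x, ‖f x‖ = ∫ x in Set.Icc (-R) R, ‖f x‖ := by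
    refine (setIntegral_eq_integral_of_forall_compl_eq_zero fun x hx => ?_).symm
    by_contra h
    exact hx (abs_le.mp (hsupp x (by simpa using h)))
  rw [h1]
  have := norm_setIntegral_le_of_norm_le_const (μ := volume) (s := Set.Icc (-R) R)
    (f := fun x => ‖f x‖) (C := M) (by simp) (fun x _ => by simpa using hM x)
  rw [Real.norm_eq_abs] at this
  refine (le_abs_self _).trans (this.trans (le_of_eq ?_))
  simp [Measure.real, Real.volume_Icc]
  left
  rw [ENNReal.toReal_ofReal (by linarith)]
  ring

theorem eq_zero_outside_iteratedDeriv {f : ℝ → ℂ} {R : ℝ} (hsupp : ∀ x, f x ≠ 0 → |x| ≤ R)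
    (r : ℕ) (x : ℝ) (h : iteratedDeriv r f x ≠ 0) : |x| ≤ R := by
  by_contra hx
  apply h
  have : f =ᶠ[nhds x] fun _ => 0 := by
    have ho : IsOpen {y : ℝ | R < |y|} := isOpen_lt continuous_const continuous_abs
    filter_upwards [ho.mem_nhds (not_le.mp hx)] with y hy
    by_contra h'
    exact absurd (hsupp y h') (not_le.mpr hy)
  rw [Filter.EventuallyEq.iteratedDeriv_eq r this]
  simp [iteratedDeriv_fun_const_zero]

/-- One-dimensional comparison of the sum over integers with the integral. -/
theorem norm_tsum_int_sub_integral_le {r : ℕ} (hr : 2 ≤ r) :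
    ∃ C : ℝ, 0 ≤ C ∧ ∀ f : ℝ → ℂ, ContDiff ℝ (⊤ : ℕ∞) f → ∀ R M : ℝ, 0 ≤ R →
      (∀ x, f x ≠ 0 → |x| ≤ R) → (∀ x, ‖iteratedDeriv r f x‖ ≤ M) →
      ‖(∑' a : ℤ, f a) - ∫ x, f x‖ ≤ C * M * R := by
  have hsum : Summable fun k : ℤ => 1 / |(k : ℝ) ^ r| := by
    have := (Real.summable_one_div_int_pow (p := r)).mpr (by omega)
    simpa using this.norm
  refine ⟨2 * ∑' k : ℤ, 1 / |(k : ℝ) ^ r|, by positivity, fun f hf R M hR hsupp hM => ?_⟩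
  have hcs : HasCompactSupport f := by
    refine HasCompactSupport.intro (K := Set.Icc (-R) R) isCompact_Icc fun x hx => ?_
    by_contra h
    exact hx (abs_le.mp (hsupp x h))
  set F := hcs.toSchwartzMap hf
  have hF : ∀ x, F x = f x := fun x => rfl
  have hP := F.tsum_eq_tsum_fourier 0
  simp only [zero_add, hF] at hP
  have hM0 : 0 ≤ M := (norm_nonneg _).trans (hM 0)
  have hfour : ∀ k : ℝ, (𝓕 F) k = 𝓕 f k := fun k => by
    rw [SchwartzMap.fourier_coe]; rfl
  have hderiv : ∀ k : ℝ, 𝓕 (iteratedDeriv r f) k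
      = (2 * (Real.pi : ℂ) * Complex.I * k) ^ r • 𝓕 f k := by
    intro k
    rw [Real.fourier_iteratedDeriv (N := ⊤) hf ?_ (by simp)]
    intro n _
    have hc : Continuous (iteratedDeriv n f) := hf.continuous_iteratedDeriv n (mod_cast le_top)
    refine hc.integrable_of_hasCompactSupport ?_
    refine HasCompactSupport.intro (K := Set.Icc (-R) R) isCompact_Icc fun x hx => ?_
    by_contra h
    exact hx (abs_le.mp (eq_zero_outside_iteratedDeriv hsupp n x h))
  have hbound : ∀ k : ℤ, k ≠ 0 → ‖𝓕 f (k : ℝ)‖ ≤ M * (2 * R) * (1 / |(k : ℝ) ^ r|) := by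
    intro k hk
    have h1 : ‖𝓕 (iteratedDeriv r f) (k : ℝ)‖ ≤ M * (2 * R) := by
      refine (VectorFourier.norm_fourierIntegral_le_integral_norm _ _ _ _ _).trans ?_
      exact norm_integral_le_of_vanishing hR (eq_zero_outside_iteratedDeriv hsupp r) hM
    rw [hderiv, norm_smul] at h1
    have hk' : 0 < |(k : ℝ) ^ r| := by positivity
    have h2 : |(k : ℝ) ^ r| ≤ ‖(2 * (Real.pi : ℂ) * Complex.I * (k : ℝ)) ^ r‖ := by
      rw [norm_pow, abs_pow]
      gcongr
      simp only [norm_mul, Complex.norm_real, Complex.norm_I, mul_one, Real.norm_eq_abs,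
        Complex.norm_ofNat, abs_of_pos Real.pi_pos]
      nlinarith [Real.pi_gt_three, abs_nonneg (k : ℝ)]
    rw [mul_one_div, le_div_iff₀ hk', mul_comm]
    exact (mul_le_mul_of_nonneg_right h2 (norm_nonneg _)).trans h1
  have hsumm : Summable fun k : ℤ => 𝓕 f (k : ℝ) := by
    refine Summable.of_norm_bounded_eventually (hsum.mul_left (M * (2 * R))) ?_
    filter_upwards [(Set.finite_singleton (0 : ℤ)).compl_mem_cofinite] with k hk
    exact hbound k hk
  have h0 : ∫ x, f x = 𝓕 f ((0 : ℤ) : ℝ) := by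
    simp [Real.fourier_eq]
  have hP' : ∑' a : ℤ, f a = ∑' k : ℤ, 𝓕 f (k : ℝ) := by
    rw [hP]
    refine tsum_congr fun k => ?_
    rw [hfour]
    simp
  rw [hP', hsumm.tsum_eq_add_tsum_ite 0, h0, add_sub_cancel_left]
  refine (tsum_of_norm_bounded (hsum.mul_left (M * (2 * R))).hasSum fun k => ?_).trans
    (le_of_eq ?_)
  · split_ifs with hk
    · rw [norm_zero]; positivity
    · exact hbound k hk
  · rw [tsum_mul_left]; ring

/-- Comparison of the sum over the integer lattice with the integral, for a smooth function of
bounded support with control on the pure partial derivatives of order `r`. -/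
theorem norm_tsum_pi_int_sub_integral_le {r : ℕ} (hr : 2 ≤ r) (n : ℕ) :
    ∃ C : ℝ, 0 ≤ C ∧ ∀ φ : (Fin n → ℝ) → ℂ, ContDiff ℝ (⊤ : ℕ∞) φ → ∀ R M : ℝ, 1 ≤ R → 0 ≤ M →
      (∀ x, φ x ≠ 0 → ‖x‖ ≤ R) →
      (∀ x i t, ‖iteratedDeriv r (fun u => φ (Function.update x i u)) t‖ ≤ M) →
      ‖(∑' a : Fin n → ℤ, φ (fun i => a i)) - ∫ x, φ x‖ ≤ C * M * R ^ n := by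
  obtain ⟨C₁, hC₁, h1⟩ := norm_tsum_int_sub_integral_le hr
  induction n with
  | zero =>
    refine ⟨0, le_rfl, fun φ hφ R M _ _ _ _ => ?_⟩
    have hc : ∀ x, φ x = φ 0 := fun x => by rw [Subsingleton.elim x 0]
    simp [hc, Measure.real, volume_pi]
  | succ n ih =>
    obtain ⟨C, hC, ih⟩ := ih
    refine ⟨3 * C + C₁ * 2 ^ n, by positivity, fun φ hφ R M hR hM hsupp hder => ?_⟩
    set ψ : ℝ → (Fin n → ℝ) → ℂ := fun x₀ x' => φ (Fin.cons x₀ x') with hψ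
    have hcons : ∀ (x₀ : ℝ) (x' : Fin n → ℝ), ψ x₀ x' ≠ 0 → |x₀| ≤ R ∧ ‖x'‖ ≤ R := by
      intro x₀ x' h
      have := (pi_norm_le_iff_of_nonneg (by linarith)).mp (hsupp _ h)
      refine ⟨by simpa using this 0, (pi_norm_le_iff_of_nonneg (by linarith)).mpr fun i => ?_⟩
      simpa using this i.succ
    have hconsmooth : ContDiff ℝ (⊤ : ℕ∞) (fun p : ℝ × (Fin n → ℝ) =>
        (Fin.cons p.1 p.2 : Fin (n + 1) → ℝ)) := by
      rw [contDiff_pi]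
      intro i
      refine Fin.cases ?_ (fun j => ?_) i
      · simpa using contDiff_fst
      · simp only [Fin.cons_succ]
        fun_prop
    have hsm : ContDiff ℝ (⊤ : ℕ∞) (fun p : ℝ × (Fin n → ℝ) => ψ p.1 p.2) := hφ.comp hconsmooth
    have hcs : HasCompactSupport (fun p : ℝ × (Fin n → ℝ) => ψ p.1 p.2) := by
      refine HasCompactSupport.intro (K := Metric.closedBall 0 R)
        (isCompact_closedBall _ _) fun p hp => ?_
      by_contra h
      obtain ⟨ha, hb⟩ := hcons _ _ h
      exact hp (by simpa [Prod.norm_def] using ⟨ha, hb⟩)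
    have hintg : Integrable (fun p : ℝ × (Fin n → ℝ) => ψ p.1 p.2)
        ((volume : Measure ℝ).prod volume) := hsm.continuous.integrable_of_hasCompactSupport hcs
    have hslice : ∀ x₀, ContDiff ℝ (⊤ : ℕ∞) (ψ x₀) := fun x₀ =>
      hsm.comp (contDiff_const.prodMk contDiff_id)
    have hslice' : ∀ x', ContDiff ℝ (⊤ : ℕ∞) (fun x₀ => ψ x₀ x') := fun x' =>
      hsm.comp (contDiff_id.prodMk contDiff_const)
    -- the integral over the whole space, as an iterated integral
    have hI : ∫ x, φ x = ∫ x' : Fin n → ℝ, ∫ x₀ : ℝ, ψ x₀ x' := by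
      rw [← integral_prod_symm _ hintg]
      have hmp := (volume_preserving_piFinSuccAbove (fun _ : Fin (n + 1) => ℝ) 0).symm
      rw [← hmp.integral_comp' (g := φ)]
      refine integral_congr_ae (Filter.Eventually.of_forall fun p => ?_)
      change φ (Fin.insertNth 0 p.1 p.2) = φ (Fin.cons p.1 p.2)
      rw [Fin.insertNth_zero']
    have hS : (∑' a : Fin (n + 1) → ℤ, φ (fun i => a i))
        = ∑' a₀ : ℤ, ∑' a' : Fin n → ℤ, ψ a₀ (fun i => a' i) := by
      rw [← (Fin.consEquiv fun _ => ℤ).tsum_eq, Summable.tsum_prod]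
      · refine tsum_congr fun a₀ => tsum_congr fun a' => ?_
        rw [hψ]
        congr 1
        ext i
        refine Fin.cases ?_ (fun j => ?_) i <;> simp [Fin.consEquiv]
      · refine summable_of_hasFiniteSupport ?_
        refine Set.Finite.subset (s := Set.Icc (-⌈R⌉) ⌈R⌉ ×ˢ
          Set.Icc (fun _ => -⌈R⌉) (fun _ => ⌈R⌉)) (Set.toFinite _) fun p hp => ?_
        have hb := (pi_norm_le_iff_of_nonneg (by linarith)).mp (hsupp _ hp)
        have hb' : ∀ i, -⌈R⌉ ≤ (Fin.consEquiv fun _ => ℤ) p i ∧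
            (Fin.consEquiv fun _ => ℤ) p i ≤ ⌈R⌉ := by
          intro i
          have := abs_le.mp (hb i)
          have hc := Int.le_ceil R
          constructor
          · have : ((-⌈R⌉ : ℤ) : ℝ) ≤ ((Fin.consEquiv fun _ => ℤ) p i : ℤ) := by
              push_cast; linarith
            exact_mod_cast this
          · have : (((Fin.consEquiv fun _ => ℤ) p i : ℤ) : ℝ) ≤ (⌈R⌉ : ℤ) := by linarith
            exact_mod_cast this
        refine ⟨by simpa [Fin.consEquiv] using hb' 0, ?_, ?_⟩
        · intro i; simpa [Fin.consEquiv] using (hb' i.succ).1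
        · intro i; simpa [Fin.consEquiv] using (hb' i.succ).2
    set K : Finset ℤ := Finset.Icc (-⌊R⌋) ⌊R⌋ with hK
    have hKmem : ∀ a : ℤ, a ∉ K → ∀ x', ψ a x' = 0 := by
      intro a ha x'
      by_contra h
      have := abs_le.mp (hcons _ _ h).1
      refine ha (Finset.mem_Icc.mpr ⟨?_, Int.le_floor.mpr this.2⟩)
      rw [neg_le, Int.le_floor]
      push_cast
      linarith
    have hKcard : (K.card : ℝ) ≤ 3 * R := by
      rw [hK, Int.card_Icc]
      have h0 : 0 ≤ ⌊R⌋ := Int.floor_nonneg.mpr (by linarith)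
      have h2 : ((⌊R⌋ + 1 - -⌊R⌋).toNat : ℝ) = 2 * (⌊R⌋ : ℝ) + 1 := by
        have : ((⌊R⌋ + 1 - -⌊R⌋).toNat : ℤ) = 2 * ⌊R⌋ + 1 := by omega
        exact_mod_cast this
      rw [h2]
      linarith [Int.floor_le R]
    have hT : ∀ x', ∑' a : ℤ, ψ a x' = ∑ a ∈ K, ψ a x' := fun x' =>
      tsum_eq_sum fun a ha => hKmem a ha x'
    have hinner : ∀ a₀ : ℤ, ‖(∑' a' : Fin n → ℤ, ψ a₀ (fun i => a' i)) - ∫ x', ψ a₀ x'‖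
        ≤ C * M * R ^ n := by
      intro a₀
      refine ih (ψ a₀) (hslice _) R M hR hM (fun x h => (hcons _ _ h).2) fun x i t => ?_
      have := hder (Fin.cons (a₀ : ℝ) x) i.succ t
      simpa only [hψ, Fin.cons_update] using this
    have hslint : ∀ a₀ : ℝ, Integrable (ψ a₀) := fun a₀ => by
      refine (hslice a₀).continuous.integrable_of_hasCompactSupport ?_
      refine HasCompactSupport.intro (K := Metric.closedBall 0 R)
        (isCompact_closedBall _ _) fun x hx => ?_
      by_contra h
      exact hx (by simpa using (hcons _ _ h).2)
    have houter : ‖∫ x', ((∑' a₀ : ℤ, ψ a₀ x') - ∫ x₀, ψ x₀ x')‖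
        ≤ C₁ * M * R * (2 * R) ^ n := by
      have hz : ∀ x', x' ∉ Metric.closedBall (0 : Fin n → ℝ) R →
          (∑' a₀ : ℤ, ψ a₀ x') - ∫ x₀, ψ x₀ x' = 0 := by
        intro x' hx'
        have : ∀ x₀, ψ x₀ x' = 0 := fun x₀ => by
          by_contra h
          exact hx' (by simpa using (hcons _ _ h).2)
        simp [this]
      rw [← setIntegral_eq_integral_of_forall_compl_eq_zero hz]
      refine (norm_setIntegral_le_of_norm_le_const (C := C₁ * M * R) ?_ fun x' _ => ?_).trans
        (le_of_eq ?_)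
      · exact measure_closedBall_lt_top
      · refine h1 _ (hslice' x') R M (by linarith) (fun x h => (hcons _ _ h).1) fun t => ?_
        have := hder (Fin.cons 0 x') 0 t
        simpa only [hψ, Fin.update_cons_zero] using this
      · rw [Measure.real, Real.volume_pi_closedBall _ (by linarith), ENNReal.toReal_ofReal
          (by positivity)]
        simp
    have hsplit : (∑' a : Fin (n + 1) → ℤ, φ (fun i => a i)) - ∫ x, φ x =
        (∑ a₀ ∈ K, ((∑' a' : Fin n → ℤ, ψ a₀ (fun i => a' i)) - ∫ x', ψ a₀ x'))
          + ∫ x', ((∑' a₀ : ℤ, ψ a₀ x') - ∫ x₀, ψ x₀ x') := by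
      have e1 : ∑' a₀ : ℤ, ∑' a' : Fin n → ℤ, ψ a₀ (fun i => a' i)
          = ∑ a₀ ∈ K, ∑' a' : Fin n → ℤ, ψ a₀ (fun i => a' i) :=
        tsum_eq_sum fun a ha => by simp [hKmem a ha]
      simp only [hT]
      have e2 : Integrable fun x' => ∫ x₀, ψ x₀ x' := hintg.integral_prod_right
      have e3 : Integrable fun x' => ∑ a ∈ K, ψ (a : ℝ) x' :=
        integrable_finsetSum _ fun a _ => hslint a
      rw [integral_sub e3 e2, integral_finsetSum _ (fun (a : ℤ) _ => hslint a), hS, hI, e1,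
        Finset.sum_sub_distrib]
      ring
    rw [hsplit]
    refine (norm_add_le _ _).trans ?_
    have hs1 : ‖∑ a₀ ∈ K, ((∑' a' : Fin n → ℤ, ψ a₀ (fun i => a' i)) - ∫ x', ψ a₀ x')‖
        ≤ 3 * R * (C * M * R ^ n) := by
      refine (norm_sum_le_of_le K fun a _ => hinner a).trans ?_
      rw [Finset.sum_const, nsmul_eq_mul]
      gcongr
    refine (add_le_add hs1 houter).trans (le_of_eq ?_)
    rw [mul_pow]
    ring

end LatticeSum

namespace LatticeSum

open MeasureTheory Real FourierTransform

theorem update_eq_add_single {n : ℕ} (x : Fin n → ℝ) (i : Fin n) (u : ℝ) :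
    Function.update x i u = Function.update x i 0 + u • (Pi.single i 1 : Fin n → ℝ) := by
  ext j
  by_cases h : j = i
  · subst h; simp
  · simp [h]

theorem hasDerivAt_comp_update {n : ℕ} {F : Type*} [NormedAddCommGroup F] [NormedSpace ℝ F]
    {g : (Fin n → ℝ) → F} (hg : ContDiff ℝ (⊤ : ℕ∞) g) (x : Fin n → ℝ) (i : Fin n) (t : ℝ) :
    HasDerivAt (fun u => g (Function.update x i u))
      (fderiv ℝ g (Function.update x i t) (Pi.single i 1)) t := by
  have h1 : HasDerivAt (fun u : ℝ => Function.update x i u) (Pi.single i 1 : Fin n → ℝ) t := by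
    exact hasDerivAt_update x i t
  exact ((hg.differentiable (by simp)).differentiableAt.hasFDerivAt).comp_hasDerivAt t h1

theorem contDiff_update {n : ℕ} (x : Fin n → ℝ) (i : Fin n) :
    ContDiff ℝ (⊤ : ℕ∞) (fun u : ℝ => Function.update x i u) := by
  rw [funext fun u => update_eq_add_single x i u]
  fun_prop

theorem norm_iteratedDeriv_exp_mul_le {n : ℕ} {f : (Fin n → ℝ) → ℝ} (hf : ContDiff ℝ (⊤ : ℕ∞) f)
    (i : Fin n) (r : ℕ) {χ : (Fin n → ℝ) → ℂ} (hχ : ContDiff ℝ (⊤ : ℕ∞) χ)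
    (hcs : HasCompactSupport χ) :
    ∃ C : ℝ, 0 ≤ C ∧ ∀ (τ : ℝ) (x : Fin n → ℝ) (t : ℝ),
      ‖iteratedDeriv r (fun u => Complex.exp (Complex.I * (τ * f (Function.update x i u) : ℝ))
        * χ (Function.update x i u)) t‖ ≤ C * (1 + |τ|) ^ r := by
  induction r generalizing χ with
  | zero =>
    obtain ⟨C, hC⟩ := hcs.exists_bound_of_continuous hχ.continuous
    refine ⟨max C 0, le_max_right _ _, fun τ x t => ?_⟩
    rw [iteratedDeriv_zero, norm_mul, mul_comm Complex.I, Complex.norm_exp_ofReal_mul_I, one_mul,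
      pow_zero, mul_one]
    exact (hC _).trans (le_max_left _ _)
  | succ r ih =>
    have hd1 : ContDiff ℝ (⊤ : ℕ∞) (fun y => fderiv ℝ χ y (Pi.single i 1)) :=
      (hχ.fderiv_right (m := (⊤ : ℕ∞)) (by simp)).clm_apply contDiff_const
    have hd2 : ContDiff ℝ (⊤ : ℕ∞) (fun y => ((fderiv ℝ f y (Pi.single i 1) : ℝ) : ℂ) * χ y) :=
      (Complex.ofRealCLM.contDiff.comp
        ((hf.fderiv_right (m := (⊤ : ℕ∞)) (by simp)).clm_apply contDiff_const)).mul hχ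
    obtain ⟨C₁, hC₁, h1⟩ := ih hd1 (hcs.fderiv_apply (𝕜 := ℝ) _)
    obtain ⟨C₂, hC₂, h2⟩ := ih hd2 hcs.mul_left
    refine ⟨C₁ + C₂, by positivity, fun τ x t => ?_⟩
    have hexp : ContDiff ℝ (⊤ : ℕ∞)
        (fun u => Complex.exp (Complex.I * (τ * f (Function.update x i u) : ℝ))) := by
      refine Complex.contDiff_exp.comp (contDiff_const.mul (Complex.ofRealCLM.contDiff.comp ?_))
      exact contDiff_const.mul (hf.comp (contDiff_update x i))
    have hder : deriv (fun u => Complex.exp (Complex.I * (τ * f (Function.update x i u) : ℝ))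
        * χ (Function.update x i u)) = fun u =>
        Complex.exp (Complex.I * (τ * f (Function.update x i u) : ℝ))
          * fderiv ℝ χ (Function.update x i u) (Pi.single i 1)
        + (Complex.I * τ) * (Complex.exp (Complex.I * (τ * f (Function.update x i u) : ℝ))
          * (((fderiv ℝ f (Function.update x i u) (Pi.single i 1) : ℝ) : ℂ)
            * χ (Function.update x i u))) := by
      ext u
      have a1 := hasDerivAt_comp_update hχ x i u
      have a2 := ((hasDerivAt_comp_update hf x i u).const_mul τ).ofReal_comp
      have a3 := ((a2.const_mul Complex.I).cexp.mul a1).deriv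
      refine a3.trans ?_
      push_cast
      ring
    rw [iteratedDeriv_succ', hder]
    have c1 : ContDiff ℝ (⊤ : ℕ∞) (fun u => Complex.exp (Complex.I *
        (τ * f (Function.update x i u) : ℝ)) * fderiv ℝ χ (Function.update x i u) (Pi.single i 1)) :=
      hexp.mul (hd1.comp (contDiff_update x i))
    have c2 : ContDiff ℝ (⊤ : ℕ∞) (fun u => Complex.exp (Complex.I *
        (τ * f (Function.update x i u) : ℝ)) *
          (((fderiv ℝ f (Function.update x i u) (Pi.single i 1) : ℝ) : ℂ)
            * χ (Function.update x i u))) :=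
      hexp.mul (hd2.comp (contDiff_update x i))
    have hr : ((r : ℕ∞) : WithTop ℕ∞) ≤ ((⊤ : ℕ∞) : WithTop ℕ∞) := by exact_mod_cast le_top
    rw [iteratedDeriv_fun_add ((c1.of_le hr).contDiffAt)
      (((contDiff_const.mul c2).of_le hr).contDiffAt), iteratedDeriv_const_mul_field]
    refine (norm_add_le _ _).trans ?_
    rw [norm_mul]
    have e : ‖Complex.I * (τ : ℂ)‖ = |τ| := by simp
    rw [e]
    calc _ ≤ C₁ * (1 + |τ|) ^ r + |τ| * (C₂ * (1 + |τ|) ^ r) := by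
          gcongr
          · exact h1 τ x t
          · exact h2 τ x t
      _ ≤ (C₁ + C₂) * (1 + |τ|) ^ (r + 1) := by
          rw [pow_succ]
          have hp : 0 ≤ (1 + |τ|) ^ r := by positivity
          have : 0 ≤ |τ| := abs_nonneg τ
          nlinarith [mul_nonneg hC₁ (mul_nonneg hp this), mul_nonneg hC₂ hp]

/-- Riemann sums over the scaled integer lattice of a compactly supported smooth function with
oscillation `exp (I τ f)`: the error is arbitrarily small in the mesh and polynomial in `τ`. -/
theorem norm_tsum_exp_mul_scaled_sub_integral_le {n : ℕ} {f : (Fin n → ℝ) → ℝ}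
    (hf : ContDiff ℝ (⊤ : ℕ∞) f) {r : ℕ} (hr : 2 ≤ r) {χ : (Fin n → ℝ) → ℂ}
    (hχ : ContDiff ℝ (⊤ : ℕ∞) χ) (hcs : HasCompactSupport χ) :
    ∃ C : ℝ, 0 ≤ C ∧ ∀ (τ T : ℝ), 1 ≤ T →
      ‖(∑' a : Fin n → ℤ, Complex.exp (Complex.I * (τ * f (T⁻¹ • fun i => (a i : ℝ)) : ℝ))
          * χ (T⁻¹ • fun i => (a i : ℝ)))
        - T ^ n * ∫ x, Complex.exp (Complex.I * (τ * f x : ℝ)) * χ x‖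
        ≤ C * (1 + |τ|) ^ r * (T ^ n / T ^ r) := by
  obtain ⟨C, hC, h⟩ := norm_tsum_pi_int_sub_integral_le hr n
  choose D hD hDb using fun i => norm_iteratedDeriv_exp_mul_le hf i r hχ hcs
  have hD0 : 0 ≤ ∑ i, D i := Finset.sum_nonneg fun i _ => hD i
  obtain ⟨R, hR⟩ := hcs.isCompact.isBounded.subset_closedBall 0
  set R' := max R 1
  refine ⟨C * (∑ i, D i) * R' ^ n, by positivity,
    fun τ T hT => ?_⟩
  have hT0 : 0 < T := by linarith
  set φ : (Fin n → ℝ) → ℂ := fun x => Complex.exp (Complex.I * (τ * f x : ℝ)) * χ x with hφ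
  have hφs : ContDiff ℝ (⊤ : ℕ∞) φ := by
    refine (Complex.contDiff_exp.comp (contDiff_const.mul
      (Complex.ofRealCLM.contDiff.comp ?_))).mul hχ
    exact contDiff_const.mul hf
  have := h (fun x => φ (T⁻¹ • x)) (hφs.comp (contDiff_const_smul _)) (R' * T)
    ((∑ i, D i) * (1 + |τ|) ^ r / T ^ r) (by nlinarith [le_max_right R 1])
    (by positivity) ?_ ?_
  · rw [Measure.integral_comp_inv_smul] at this
    simp only [Module.finrank_fintype_fun_eq_card, Fintype.card_fin, abs_of_pos (pow_pos hT0 n),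
      Complex.real_smul, Complex.ofReal_pow] at this
    refine this.trans (le_of_eq ?_)
    rw [mul_pow]
    ring
  · intro x hx
    have h1 : χ (T⁻¹ • x) ≠ 0 := right_ne_zero_of_mul hx
    have h2 := hR (subset_tsupport _ h1)
    rw [mem_closedBall_zero_iff, norm_smul, norm_inv, Real.norm_eq_abs, abs_of_pos hT0,
      inv_mul_le_iff₀ hT0] at h2
    rw [mul_comm]
    exact h2.trans (by gcongr; exact le_max_left _ _)
  · intro x i t
    have e : (fun u => φ (T⁻¹ • Function.update x i u))
        = fun u => (fun v => φ (Function.update (T⁻¹ • x) i v)) (T⁻¹ * u) := by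
      ext u
      simp only
      congr 1
      ext j
      by_cases hj : j = i
      · subst hj; simp
      · simp [hj]
    have hs : ContDiff ℝ r (fun v => φ (Function.update (T⁻¹ • x) i v)) :=
      (hφs.comp (contDiff_update _ i)).of_le (by exact_mod_cast le_top)
    rw [e, iteratedDeriv_comp_const_smul hs]
    simp only [norm_smul, norm_pow, norm_inv, Real.norm_eq_abs, abs_of_pos hT0]
    have h3 : D i ≤ ∑ i, D i := Finset.single_le_sum (fun i _ => hD i) (Finset.mem_univ i)
    calc _ ≤ (T⁻¹) ^ r * (D i * (1 + |τ|) ^ r) := by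
          gcongr
          exact hDb i τ _ _
      _ ≤ (T⁻¹) ^ r * ((∑ i, D i) * (1 + |τ|) ^ r) := by gcongr
      _ = _ := by rw [inv_pow]; ring

end LatticeSum

namespace IdealSum

open NumberField NumberField.mixedEmbedding NumberField.Units NumberField.InfinitePlace
open NumberField.Units.dirichletUnitTheorem

/-- A smooth bump on `ℝ`, supported in `[-1, 1]`, whose integer translates sum to `1`. -/
noncomputable def step (x : ℝ) : ℝ := Real.smoothTransition (x + 1) - Real.smoothTransition x

theorem contDiff_step {n : ℕ∞} : ContDiff ℝ n step :=
  (Real.smoothTransition.contDiff.comp (contDiff_id.add contDiff_const)).sub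
    Real.smoothTransition.contDiff

theorem step_eq_zero_of_le {x : ℝ} (h : x ≤ -1) : step x = 0 := by
  rw [step, Real.smoothTransition.zero_of_nonpos (by linarith),
    Real.smoothTransition.zero_of_nonpos (by linarith), sub_zero]

theorem step_eq_zero_of_ge {x : ℝ} (h : 1 ≤ x) : step x = 0 := by
  rw [step, Real.smoothTransition.one_of_one_le (by linarith),
    Real.smoothTransition.one_of_one_le (by linarith), sub_self]

theorem abs_le_one_of_step_ne_zero {x : ℝ} (h : step x ≠ 0) : |x| ≤ 1 := by
  rw [abs_le]
  constructor
  · by_contra! h'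
    exact h (step_eq_zero_of_le h'.le)
  · by_contra! h'
    exact h (step_eq_zero_of_ge h'.le)

theorem hasSum_prod_step {ι : Type*} [Fintype ι] (c : ι → ℝ) :
    HasSum (fun k : ι → ℤ => ∏ i, step (c i + k i)) 1 := by
  classical
  set s : ι → Finset ℤ := fun i => {-⌊c i⌋ - 1, -⌊c i⌋}
  have hs : ∑ k ∈ Fintype.piFinset s, ∏ i, step (c i + k i) = 1 := by
    rw [← Finset.prod_univ_sum s (fun i (k : ℤ) => step (c i + k))]
    refine Finset.prod_eq_one fun i _ => ?_
    have h1 := Int.fract_lt_one (c i)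
    have h0 := Int.fract_nonneg (c i)
    rw [Int.fract] at h1 h0
    rw [Finset.sum_pair (by simp)]
    push_cast
    simp only [step]
    rw [Real.smoothTransition.zero_of_nonpos (x := c i + (-(⌊c i⌋ : ℝ) - 1)) (by linarith),
      Real.smoothTransition.one_of_one_le (x := c i + -(⌊c i⌋ : ℝ) + 1) (by linarith)]
    ring_nf
  rw [← hs]
  refine hasSum_sum_of_ne_finset_zero fun k hk => ?_
  rw [Fintype.mem_piFinset] at hk
  push Not at hk
  obtain ⟨i, hi⟩ := hk
  refine Finset.prod_eq_zero (Finset.mem_univ i) ?_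
  by_contra h
  have h1 := Int.fract_lt_one (c i)
  have h0 := Int.fract_nonneg (c i)
  rw [Int.fract] at h1 h0
  have h2 : -1 < c i + k i := by
    by_contra! h'
    exact h (step_eq_zero_of_le h')
  have h3 : c i + k i < 1 := by
    by_contra! h'
    exact h (step_eq_zero_of_ge h')
  have h4 : -⌊c i⌋ - 2 < k i := by
    have : (-⌊c i⌋ - 2 : ℝ) < k i := by linarith
    exact_mod_cast this
  have h5 : k i < -⌊c i⌋ + 1 := by
    have : (k i : ℝ) < -⌊c i⌋ + 1 := by linarith
    exact_mod_cast this
  apply hi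
  simp only [s, Finset.mem_insert, Finset.mem_singleton]
  omega

theorem hasSum_comp_snd_of_finite (F : Type*) [Finite F] {ι : Type*} {g : ι → ℝ} {a : ℝ}
    (h : HasSum g a) : HasSum (fun p : F × ι => g p.2) (Nat.card F * a) := by
  have := Fintype.ofFinite F
  have h2 : HasSum (fun _ : F => (1 : ℝ)) (Nat.card F) := by
    simpa using hasSum_fintype (fun _ : F => (1 : ℝ))
  have h3 := HasSum.mul h2 h (summable_mul_of_summable_norm (f := fun _ : F => (1 : ℝ)) (g := g)
    (summable_norm_iff.mpr h2.summable) (summable_norm_iff.mpr h.summable))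
  simpa using h3

variable (K : Type*) [Field K] [NumberField K]

open scoped Classical in
/-- The coordinates on the logarithmic space given by the fundamental system of units. -/
noncomputable def logBasis : Module.Basis (Fin (rank K)) ℝ (logSpace K) :=
  (basisUnitLattice K).ofZLatticeBasis ℝ (unitLattice K)

/-- A smooth function of the logarithmic embedding whose sum over the units is constant. -/
noncomputable def unitWeight (x : mixedSpace K) : ℝ :=
  ∏ i, step ((logBasis K).repr (logMap x) i)

/-- Units are parametrized by torsion units and integer exponents. -/
noncomputable def unitsEquiv : torsion K × (Fin (rank K) → ℤ) ≃ (𝓞 K)ˣ :=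
  Equiv.ofBijective (fun p => (p.1 : (𝓞 K)ˣ) * ∏ i, fundSystem K i ^ p.2 i) <| by
    rw [Function.bijective_iff_existsUnique]
    intro u
    obtain ⟨p, hp, hu⟩ := exist_unique_eq_mul_prod K u
    exact ⟨p, hp.symm, fun q hq => hu q hq.symm⟩

theorem logBasis_repr_unitsEquiv (p : torsion K × (Fin (rank K) → ℤ)) (i : Fin (rank K)) :
    (logBasis K).repr (logEmbedding K (Additive.ofMul (unitsEquiv K p))) i = p.2 i := by
  have h1 : logEmbedding K (Additive.ofMul (unitsEquiv K p)) = ∑ j, (p.2 j : ℝ) • logBasis K j := by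
    have h0 : logEmbedding K (Additive.ofMul (p.1 : (𝓞 K)ˣ)) = 0 :=
      (logEmbedding_eq_zero_iff).mpr p.1.2
    simp only [unitsEquiv, Equiv.ofBijective_apply, ofMul_mul, ofMul_prod, map_add, map_sum, h0,
      zero_add, ofMul_zpow, map_zsmul, logEmbedding_fundSystem]
    refine Finset.sum_congr rfl fun j _ => ?_
    rw [logBasis, Module.Basis.ofZLatticeBasis_apply, Int.cast_smul_eq_zsmul]
  rw [h1, Module.Basis.repr_sum_self]

theorem unitWeight_unitsEquiv_smul {x : mixedSpace K} (hx : mixedEmbedding.norm x ≠ 0)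
    (p : torsion K × (Fin (rank K) → ℤ)) :
    unitWeight K (unitsEquiv K p • x) =
      ∏ i, step ((logBasis K).repr (logMap x) i + p.2 i) := by
  simp only [unitWeight, logMap_unit_smul _ hx, map_add, Finsupp.add_apply,
    logBasis_repr_unitsEquiv, add_comm]

theorem hasSum_unitWeight {x : mixedSpace K} (hx : mixedEmbedding.norm x ≠ 0) :
    HasSum (fun u : (𝓞 K)ˣ => unitWeight K (u • x)) (torsionOrder K) := by
  rw [← (unitsEquiv K).hasSum_iff, ← mul_one (torsionOrder K : ℝ)]
  exact (hasSum_comp_snd_of_finite (torsion K) (hasSum_prod_step fun i =>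
    (logBasis K).repr (logMap x) i)).congr_fun (unitWeight_unitsEquiv_smul K hx)

end IdealSum

namespace IdealSum

open NumberField NumberField.mixedEmbedding NumberField.Units NumberField.InfinitePlace
open NumberField.Units.dirichletUnitTheorem Filter Topology
open scoped Classical

variable (K : Type*) [Field K] [NumberField K]

variable {K} in
theorem contDiffAt_normAtPlace {n : ℕ∞} (w : InfinitePlace K) {x : mixedSpace K}
    (hx : normAtPlace w x ≠ 0) : ContDiffAt ℝ n (normAtPlace w) x := by
  by_cases hw : IsReal w
  · have e : (normAtPlace w : mixedSpace K → ℝ) = fun y => ‖y.1 ⟨w, hw⟩‖ :=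
      funext fun y => normAtPlace_apply_of_isReal hw y
    rw [e] at hx ⊢
    have h : ContDiff ℝ n fun y : mixedSpace K => y.1 ⟨w, hw⟩ := by fun_prop
    exact h.contDiffAt.norm ℝ (norm_ne_zero_iff.mp hx)
  · rw [not_isReal_iff_isComplex] at hw
    have e : (normAtPlace w : mixedSpace K → ℝ) = fun y => ‖y.2 ⟨w, hw⟩‖ :=
      funext fun y => normAtPlace_apply_of_isComplex hw y
    rw [e] at hx ⊢
    have h : ContDiff ℝ n fun y : mixedSpace K => y.2 ⟨w, hw⟩ := by fun_prop
    exact h.contDiffAt.norm ℝ (norm_ne_zero_iff.mp hx)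

variable {K} in
theorem contDiffAt_mixedEmbedding_norm {n : ℕ∞} {x : mixedSpace K}
    (hx : mixedEmbedding.norm x ≠ 0) : ContDiffAt ℝ n (mixedEmbedding.norm : mixedSpace K → ℝ) x := by
  have e : (mixedEmbedding.norm : mixedSpace K → ℝ) =
      fun y => ∏ w, normAtPlace w y ^ mult w := funext fun y => mixedEmbedding.norm_apply y
  rw [e]
  exact contDiffAt_prod fun w _ =>
    (contDiffAt_normAtPlace w (mixedEmbedding.norm_ne_zero_iff.mp hx w)).pow _

theorem contDiffAt_unitWeight {n : ℕ∞} {x : mixedSpace K}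
    (hx : mixedEmbedding.norm x ≠ 0) : ContDiffAt ℝ n (unitWeight K) x := by
  refine contDiffAt_prod fun i _ => contDiff_step.contDiffAt.comp x ?_
  have h : ContDiffAt ℝ n (logMap : mixedSpace K → logSpace K) x := by
    rw [contDiffAt_pi]
    intro w
    refine contDiffAt_const.mul (ContDiffAt.sub ?_ (ContDiffAt.mul ?_ contDiffAt_const))
    · exact (contDiffAt_normAtPlace w.1 (mixedEmbedding.norm_ne_zero_iff.mp hx w)).log
        (mixedEmbedding.norm_ne_zero_iff.mp hx w)
    · exact (contDiffAt_mixedEmbedding_norm hx).log hx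
  exact ((logBasis K).coord i).toContinuousLinearMap.contDiff.contDiffAt.comp x h

/-- A smooth bump function on `ℝ`, supported in `[1, 2]`. -/
noncomputable def bump (y : ℝ) : ℝ :=
  Real.smoothTransition (4 * (y - 1)) * Real.smoothTransition (4 * (2 - y))

theorem contDiff_bump {n : ℕ∞} : ContDiff ℝ n bump :=
  (Real.smoothTransition.contDiff.comp (by fun_prop)).mul
    (Real.smoothTransition.contDiff.comp (by fun_prop))

theorem bump_nonneg (y : ℝ) : 0 ≤ bump y :=
  mul_nonneg (Real.smoothTransition.nonneg _) (Real.smoothTransition.nonneg _)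

theorem bump_le_one (y : ℝ) : bump y ≤ 1 :=
  mul_le_one₀ (Real.smoothTransition.le_one _) (Real.smoothTransition.nonneg _)
    (Real.smoothTransition.le_one _)

theorem bump_eq_zero_of_le {y : ℝ} (h : y ≤ 1) : bump y = 0 := by
  rw [bump, Real.smoothTransition.zero_of_nonpos (by linarith), zero_mul]

theorem bump_eq_zero_of_ge {y : ℝ} (h : 2 ≤ y) : bump y = 0 := by
  rw [bump, Real.smoothTransition.zero_of_nonpos (x := 4 * (2 - y)) (by linarith), mul_zero]

theorem bump_eq_one {y : ℝ} (h : 5 / 4 ≤ y) (h' : y ≤ 7 / 4) : bump y = 1 := by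
  rw [bump, Real.smoothTransition.one_of_one_le (by linarith),
    Real.smoothTransition.one_of_one_le (by linarith), one_mul]

/-- A smooth function on `ℝ` that agrees with the logarithm on `[1, ∞)`. -/
noncomputable def smoothLog (y : ℝ) : ℝ := Real.smoothTransition (4 * y - 2) * Real.log y

theorem smoothLog_eq_zero {y : ℝ} (h : y ≤ 1 / 2) : smoothLog y = 0 := by
  rw [smoothLog, Real.smoothTransition.zero_of_nonpos (by linarith), zero_mul]

theorem smoothLog_eq_log {y : ℝ} (h : 1 ≤ y) : smoothLog y = Real.log y := by
  rw [smoothLog, Real.smoothTransition.one_of_one_le (by linarith), one_mul]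

theorem contDiff_smoothLog {n : ℕ∞} : ContDiff ℝ n smoothLog := by
  rw [contDiff_iff_contDiffAt]
  intro y
  rcases lt_or_ge y (1 / 2) with h | h
  · refine (contDiffAt_const (c := 0)).congr_of_eventuallyEq ?_
    filter_upwards [Iio_mem_nhds h] with z hz using smoothLog_eq_zero (le_of_lt hz)
  · exact (Real.smoothTransition.contDiff.comp (by fun_prop)).contDiffAt.mul
      (contDiffAt_id.log (by simp only [id]; linarith))

variable {K} in
theorem contDiff_comp_norm_mul {n : ℕ∞} {g : ℝ → ℝ} (hg : ContDiff ℝ n g)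
    (hg0 : ∀ t ≤ 1 / 2, g t = 0) {h : mixedSpace K → ℝ}
    (hh : ∀ x, mixedEmbedding.norm x ≠ 0 → ContDiffAt ℝ n h x) :
    ContDiff ℝ n fun x => g (mixedEmbedding.norm x) * h x := by
  rw [contDiff_iff_contDiffAt]
  intro x
  by_cases hx : mixedEmbedding.norm x = 0
  · refine (contDiffAt_const (c := 0)).congr_of_eventuallyEq ?_
    have : ∀ᶠ y in 𝓝 x, mixedEmbedding.norm y < 1 / 2 :=
      (mixedEmbedding.continuous_norm K).continuousAt.eventually_lt continuousAt_const
        (by rw [hx]; norm_num)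
    filter_upwards [this] with y hy
    rw [hg0 _ hy.le, zero_mul]
  · exact (hg.contDiffAt.comp x (contDiffAt_mixedEmbedding_norm hx)).mul (hh x hx)

/-- The phase function on the mixed space. -/
noncomputable def phase (x : mixedSpace K) : ℝ := smoothLog (mixedEmbedding.norm x)

/-- The amplitude function on the mixed space. -/
noncomputable def amplitude (x : mixedSpace K) : ℝ :=
  bump (mixedEmbedding.norm x) * unitWeight K x

theorem contDiff_phase {n : ℕ∞} : ContDiff ℝ n (phase K) := by
  simpa only [mul_one] using! contDiff_comp_norm_mul contDiff_smoothLog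
    (fun _ => smoothLog_eq_zero) (h := fun _ : mixedSpace K => 1) fun _ _ => contDiffAt_const

theorem contDiff_amplitude {n : ℕ∞} : ContDiff ℝ n (amplitude K) :=
  contDiff_comp_norm_mul contDiff_bump (fun _ h => bump_eq_zero_of_le (by linarith))
    fun _ hx => contDiffAt_unitWeight K hx

theorem exists_norm_le_of_amplitude_ne_zero :
    ∃ R : ℝ, ∀ x : mixedSpace K, amplitude K x ≠ 0 → ‖x‖ ≤ R := by
  obtain ⟨B, hB0, hB⟩ : ∃ B : ℝ, 0 ≤ B ∧ ∀ c : logSpace K,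
      (∀ i, |(logBasis K).repr c i| ≤ 1) → ∀ w, |c w| ≤ B := by
    refine ⟨∑ i, ‖logBasis K i‖, by positivity, fun c hc w => ?_⟩
    have h1 : ‖c‖ ≤ ∑ i, ‖logBasis K i‖ := by
      rw [← (logBasis K).sum_repr c]
      refine (norm_sum_le _ _).trans (Finset.sum_le_sum fun i _ => ?_)
      rw [_root_.norm_smul]
      exact mul_le_of_le_one_left (norm_nonneg _) (hc i)
    exact (norm_le_pi_norm c w).trans h1
  set N : ℝ := (Fintype.card (InfinitePlace K) : ℝ)
  refine ⟨Real.exp (1 + N * (B + 2)), fun x hx => ?_⟩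
  have hb : bump (mixedEmbedding.norm x) ≠ 0 := left_ne_zero_of_mul hx
  have hw : unitWeight K x ≠ 0 := right_ne_zero_of_mul hx
  have h1 : 1 < mixedEmbedding.norm x := by
    by_contra! h
    exact hb (bump_eq_zero_of_le h)
  have h2 : mixedEmbedding.norm x < 2 := by
    by_contra! h
    exact hb (bump_eq_zero_of_ge h)
  have hn0 : mixedEmbedding.norm x ≠ 0 := by linarith
  have hp : ∀ w, 0 < normAtPlace w x := fun w =>
    lt_of_le_of_ne (normAtPlace_nonneg w x) (mixedEmbedding.norm_ne_zero_iff.mp hn0 w).symm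
  have hl0 : 0 ≤ Real.log (mixedEmbedding.norm x) := Real.log_nonneg h1.le
  have hl1 : Real.log (mixedEmbedding.norm x) ≤ 1 := by
    have := Real.log_le_sub_one_of_pos (by linarith : 0 < mixedEmbedding.norm x)
    linarith
  have hd : (Module.finrank ℚ K : ℝ)⁻¹ ≤ 1 := by
    refine inv_le_one_of_one_le₀ ?_
    exact_mod_cast Module.finrank_pos (R := ℚ) (M := K)
  have hd0 : 0 ≤ (Module.finrank ℚ K : ℝ)⁻¹ := by positivity
  have hrep : ∀ w, |logMap x w| ≤ B := hB _ fun i =>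
    abs_le_one_of_step_ne_zero (Finset.prod_ne_zero_iff.mp hw i (Finset.mem_univ i))
  have hml : ∀ w, w ≠ w₀ → |mult w * Real.log (normAtPlace w x)| ≤ B + 2 := by
    intro w hw'
    have := hrep ⟨w, hw'⟩
    rw [logMap_apply] at this
    have hm : (mult w : ℝ) ≤ 2 := by
      rw [mult]; split_ifs <;> norm_num
    have hm0 : (0 : ℝ) ≤ mult w := by positivity
    have e : mult w * Real.log (normAtPlace w x) =
        mult w * (Real.log (normAtPlace w x) -
          Real.log (mixedEmbedding.norm x) * (Module.finrank ℚ K : ℝ)⁻¹) +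
        mult w * (Real.log (mixedEmbedding.norm x) * (Module.finrank ℚ K : ℝ)⁻¹) := by ring
    rw [e]
    refine (abs_add_le _ _).trans (add_le_add this ?_)
    rw [abs_of_nonneg (by positivity)]
    have h3 : Real.log (mixedEmbedding.norm x) * (Module.finrank ℚ K : ℝ)⁻¹ ≤ 1 :=
      mul_le_one₀ hl1 hd0 hd
    have h4 : 0 ≤ Real.log (mixedEmbedding.norm x) * (Module.finrank ℚ K : ℝ)⁻¹ := by positivity
    nlinarith
  have hsum : Real.log (mixedEmbedding.norm x) = ∑ w, mult w * Real.log (normAtPlace w x) := by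
    rw [mixedEmbedding.norm_apply, Real.log_prod (fun w _ => (pow_pos (hp w) _).ne')]
    simp [Real.log_pow]
  have hml' : ∀ w, mult w * Real.log (normAtPlace w x) ≤ 1 + N * (B + 2) := by
    intro w
    have hN : 1 ≤ N := by
      simp only [N]
      exact_mod_cast Fintype.card_pos
    by_cases hw' : w = w₀
    · subst hw'
      rw [← Finset.add_sum_erase _ _ (Finset.mem_univ (w₀ : InfinitePlace K))] at hsum
      have h3 : |∑ w ∈ Finset.univ.erase (w₀ : InfinitePlace K),
          mult w * Real.log (normAtPlace w x)| ≤ N * (B + 2) := by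
        refine (Finset.abs_sum_le_sum_abs _ _).trans ?_
        refine (Finset.sum_le_card_nsmul _ _ (B + 2) fun w hw => ?_).trans ?_
        · exact hml w (Finset.ne_of_mem_erase hw)
        · rw [nsmul_eq_mul]
          gcongr
          exact Nat.cast_le.mpr (Finset.card_le_univ _)
      have := (abs_le.mp h3).1
      linarith
    · have := (abs_le.mp (hml w hw')).2
      nlinarith
  rw [norm_eq_sup'_normAtPlace, Finset.sup'_le_iff]
  intro w _
  rw [← Real.log_le_iff_le_exp (hp w)]
  have hm1 : (1 : ℝ) ≤ mult w := by exact_mod_cast mult_pos (w := w)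
  rcases le_or_gt 0 (Real.log (normAtPlace w x)) with h | h
  · refine le_trans ?_ (hml' w)
    nlinarith
  · have : 0 ≤ N := by positivity
    have : 0 ≤ N * (B + 2) := by positivity
    linarith

theorem hasCompactSupport_amplitude : HasCompactSupport (amplitude K) := by
  obtain ⟨R, hR⟩ := exists_norm_le_of_amplitude_ne_zero K
  refine HasCompactSupport.of_support_subset_isCompact (isCompact_closedBall 0 R) fun x hx => ?_
  rw [mem_closedBall_zero_iff]
  exact hR x hx

end IdealSum

namespace IdealSum

open NumberField NumberField.mixedEmbedding NumberField.Units NumberField.InfinitePlace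
open NumberField.Units.dirichletUnitTheorem Filter Topology nonZeroDivisors
open scoped Classical

variable (K : Type*) [Field K] [NumberField K]

/-- The oscillating cutoff `y ^ (i τ) * bump y`. -/
noncomputable def oscBump (τ y : ℝ) : ℂ :=
  Complex.exp (Complex.I * (τ * Real.log y : ℝ)) * bump y

theorem exists_basis_equiv_ideal (J : (Ideal (𝓞 K))⁰) :
    ∃ (B : Module.Basis (Fin (Module.finrank ℚ K)) ℝ (mixedSpace K))
      (e : (Fin (Module.finrank ℚ K) → ℤ) ≃ (J : Ideal (𝓞 K))),
      ∀ k, mixedEmbedding K (e k : 𝓞 K) = ∑ i, (k i : ℝ) • B i := by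
  have hc : Fintype.card (Module.Free.ChooseBasisIndex ℤ (FractionalIdeal.mk0 K J)) =
      Module.finrank ℚ K := by
    rw [← Module.finrank_eq_card_chooseBasisIndex, fractionalIdeal_rank, RingOfIntegers.rank]
  set B := (fractionalIdealLatticeBasis K (FractionalIdeal.mk0 K J)).reindex
    (Fintype.equivFinOfCardEq hc) with hB
  have hmem : ∀ x : mixedSpace K, (∃ k : Fin (Module.finrank ℚ K) → ℤ, ∑ i, (k i : ℝ) • B i = x) ↔
      ∃ a : (J : Ideal (𝓞 K)), mixedEmbedding K (a : 𝓞 K) = x := by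
    intro x
    have h1 := mem_span_fractionalIdealLatticeBasis K (FractionalIdeal.mk0 K J) (x := x)
    rw [← Module.Basis.range_reindex (e := Fintype.equivFinOfCardEq hc), ← hB,
      Submodule.mem_span_range_iff_exists_fun] at h1
    simp only [Int.cast_smul_eq_zsmul]
    rw [h1]
    constructor
    · rintro ⟨y, hy, rfl⟩
      rw [FractionalIdeal.coe_mk0] at hy
      obtain ⟨a, ha, rfl⟩ := (FractionalIdeal.mem_coeIdeal (𝓞 K)⁰).mp hy
      exact ⟨⟨a, ha⟩, rfl⟩
    · rintro ⟨a, rfl⟩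
      refine ⟨_, ?_, rfl⟩
      rw [FractionalIdeal.coe_mk0]
      exact (FractionalIdeal.mem_coeIdeal (𝓞 K)⁰).mpr ⟨a, a.2, rfl⟩
  choose g hg using fun k : Fin (Module.finrank ℚ K) → ℤ => (hmem _).mp ⟨k, rfl⟩
  refine ⟨B, Equiv.ofBijective g ⟨fun k l hkl => ?_, fun a => ?_⟩, hg⟩
  · have h2 := hg k
    rw [hkl, hg l] at h2
    rw [← B.equivFun_symm_apply, ← B.equivFun_symm_apply] at h2
    have h3 := B.equivFun.symm.injective h2
    ext i
    exact_mod_cast (congrFun h3 i).symm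
  · obtain ⟨k, hk⟩ := (hmem _).mpr ⟨a, rfl⟩
    refine ⟨k, ?_⟩
    rw [← hg k] at hk
    have := mixedEmbedding_injective K hk
    exact Subtype.ext (RingOfIntegers.ext this)

theorem exists_injective_ideal_units {C : ClassGroup (𝓞 K)} {J : (Ideal (𝓞 K))⁰}
    (hJ : ClassGroup.mk0 J = C⁻¹) :
    ∃ g : {I : (Ideal (𝓞 K))⁰ // ClassGroup.mk0 I = C} → 𝓞 K,
      (∀ I, Ideal.span {g I} = (I.1 : Ideal (𝓞 K)) * (J : Ideal (𝓞 K))) ∧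
      ∃ h : {I : (Ideal (𝓞 K))⁰ // ClassGroup.mk0 I = C} × (𝓞 K)ˣ → (J : Ideal (𝓞 K)),
        (∀ p, (h p : 𝓞 K) = p.2 * g p.1) ∧ Function.Injective h ∧
        ∀ a : (J : Ideal (𝓞 K)), (a : 𝓞 K) ≠ 0 → a ∈ Set.range h := by
  have h1 : ∀ I : {I : (Ideal (𝓞 K))⁰ // ClassGroup.mk0 I = C},
      ∃ a, (I.1 : Ideal (𝓞 K)) * (J : Ideal (𝓞 K)) = Ideal.span {a} := by
    intro I
    have : ClassGroup.mk0 (I.1 * J) = 1 := by rw [map_mul, I.2, hJ, mul_inv_cancel]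
    rw [ClassGroup.mk0_eq_one_iff (SetLike.coe_mem _)] at this
    exact this.1
  choose g hg using h1
  have hgne : ∀ I, g I ≠ 0 := by
    intro I h0
    have h2 := hg I
    rw [h0, Ideal.span_singleton_zero] at h2
    have := (I.1 * J).2
    exact nonZeroDivisors.ne_zero this h2
  refine ⟨g, fun I => (hg I).symm, fun p => ⟨p.2 * g p.1, ?_⟩, fun p => rfl, ?_, ?_⟩
  · refine Ideal.mul_mem_left _ _ ?_
    have h2 : g p.1 ∈ (p.1.1 : Ideal (𝓞 K)) * (J : Ideal (𝓞 K)) := by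
      rw [hg]
      exact Ideal.mem_span_singleton_self _
    exact (Ideal.mul_le_right : (p.1.1 : Ideal (𝓞 K)) * (J : Ideal (𝓞 K)) ≤ J) h2
  · rintro ⟨I, u⟩ ⟨I', u'⟩ hp
    simp only [Subtype.mk.injEq] at hp
    have h3 : Ideal.span {g I} = Ideal.span {g I'} := by
      rw [← Ideal.span_singleton_mul_left_unit u.isUnit, hp,
        Ideal.span_singleton_mul_left_unit u'.isUnit]
    rw [← hg, ← hg] at h3
    have h4 : I.1 = I'.1 := Subtype.ext
      (mul_right_cancel₀ (nonZeroDivisors.ne_zero J.2) h3)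
    obtain rfl : I = I' := Subtype.ext h4
    have h5 : (u : 𝓞 K) = u' := mul_right_cancel₀ (hgne I) hp
    rw [Units.ext h5]
  · rintro ⟨a, ha⟩ ha0
    have hdvd : (J : Ideal (𝓞 K)) ∣ Ideal.span {a} := by
      rw [Ideal.dvd_span_singleton]
      exact ha
    obtain ⟨I, hI⟩ := hdvd
    have ha0' : Ideal.span {a} ≠ ⊥ := by rwa [ne_eq, Ideal.span_singleton_eq_bot]
    have hI0 : I ∈ (Ideal (𝓞 K))⁰ := by
      refine mem_nonZeroDivisors_of_ne_zero ?_
      rintro rfl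
      rw [mul_zero] at hI
      exact ha0' hI
    have hIC : ClassGroup.mk0 (⟨I, hI0⟩ : (Ideal (𝓞 K))⁰) = C := by
      have h6 : ClassGroup.mk0 (J * ⟨I, hI0⟩) = 1 := by
        rw [ClassGroup.mk0_eq_one_iff (SetLike.coe_mem _)]
        exact ⟨a, hI.symm⟩
      rw [map_mul, hJ] at h6
      exact (inv_mul_eq_one.mp h6).symm
    have h7 := hg ⟨⟨I, hI0⟩, hIC⟩
    rw [mul_comm, ← hI, Ideal.span_singleton_eq_span_singleton] at h7
    obtain ⟨u, hu⟩ := h7.symm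
    refine ⟨(⟨⟨I, hI0⟩, hIC⟩, u), Subtype.ext ?_⟩
    exact (mul_comm _ _).trans hu

end IdealSum

namespace IdealSum

open NumberField NumberField.mixedEmbedding NumberField.Units NumberField.InfinitePlace
open NumberField.Units.dirichletUnitTheorem Filter Topology nonZeroDivisors
open scoped Classical

variable (K : Type*) [Field K] [NumberField K]

/-- The oscillating amplitude on the mixed space. -/
noncomputable def oscAmplitude (τ : ℝ) (x : mixedSpace K) : ℂ :=
  Complex.exp (Complex.I * (τ * phase K x : ℝ)) * amplitude K x

theorem oscAmplitude_eq (τ : ℝ) (x : mixedSpace K) :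
    oscAmplitude K τ x = oscBump τ (mixedEmbedding.norm x) * unitWeight K x := by
  rw [oscAmplitude, oscBump, amplitude, phase]
  rcases le_or_gt (mixedEmbedding.norm x) 1 with h | h
  · rw [bump_eq_zero_of_le h]
    simp
  · rw [smoothLog_eq_log h.le]
    push_cast
    ring

theorem oscBump_eq_zero {τ y : ℝ} (h : y ≤ 1 ∨ 2 ≤ y) : oscBump τ y = 0 := by
  rw [oscBump]
  rcases h with h | h
  · rw [bump_eq_zero_of_le h, Complex.ofReal_zero, mul_zero]
  · rw [bump_eq_zero_of_ge h, Complex.ofReal_zero, mul_zero]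

theorem summable_oscAmplitude_lattice {n : ℕ} (A : (Fin n → ℝ) ≃L[ℝ] mixedSpace K) (τ T : ℝ)
    (hT : 0 < T) : Summable fun k : Fin n → ℤ =>
      oscAmplitude K τ (A (T⁻¹ • fun i => (k i : ℝ))) := by
  obtain ⟨R, hR⟩ := exists_norm_le_of_amplitude_ne_zero K
  obtain ⟨N, hN⟩ := exists_nat_ge (T * (‖(A.symm : mixedSpace K →L[ℝ] (Fin n → ℝ))‖ * R))
  refine summable_of_hasFiniteSupport ((Set.finite_Icc (fun _ => -(N : ℤ)) (fun _ => (N : ℤ))).subset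
    fun k hk => ?_)
  have h1 := hR _ (Complex.ofReal_ne_zero.mp (right_ne_zero_of_mul hk))
  have h2 := (A.symm : mixedSpace K →L[ℝ] (Fin n → ℝ)).le_opNorm (A (T⁻¹ • fun i => (k i : ℝ)))
  simp only [ContinuousLinearEquiv.coe_coe, ContinuousLinearEquiv.symm_apply_apply] at h2
  rw [_root_.norm_smul, norm_inv, Real.norm_eq_abs, abs_of_pos hT, inv_mul_le_iff₀ hT] at h2
  have h3 : ∀ i, |k i| ≤ N := by
    intro i
    have h4 := norm_le_pi_norm (fun i => (k i : ℝ)) i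
    rw [Real.norm_eq_abs] at h4
    have h5 : |(k i : ℝ)| ≤ N := h4.trans (h2.trans (le_trans (by gcongr) hN))
    exact_mod_cast h5
  exact ⟨fun i => (abs_le.mp (h3 i)).1, fun i => (abs_le.mp (h3 i)).2⟩

theorem tsum_oscAmplitude_lattice {C : ClassGroup (𝓞 K)} {J : (Ideal (𝓞 K))⁰}
    (hJ : ClassGroup.mk0 J = C⁻¹) {n : ℕ} (A : (Fin n → ℝ) ≃L[ℝ] mixedSpace K)
    (e : (Fin n → ℤ) ≃ (J : Ideal (𝓞 K)))
    (he : ∀ k, mixedEmbedding K (e k : 𝓞 K) = A fun i => (k i : ℝ)) (τ T : ℝ) (hT : 0 < T) :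
    ∑' k : Fin n → ℤ, oscAmplitude K τ (A (T⁻¹ • fun i => (k i : ℝ))) =
      torsionOrder K * ∑' I : {I : (Ideal (𝓞 K))⁰ // ClassGroup.mk0 I = C},
        oscBump τ (Ideal.absNorm (I.1 : Ideal (𝓞 K)) * Ideal.absNorm (J : Ideal (𝓞 K)) /
          T ^ Module.finrank ℚ K) := by
  obtain ⟨g, hg, h, hh, hinj, hrange⟩ := exists_injective_ideal_units K hJ
  set F : ↥(J : Ideal (𝓞 K)) → ℂ := fun a =>
    oscAmplitude K τ (T⁻¹ • mixedEmbedding K (a : 𝓞 K)) with hF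
  have hFe : (fun k : Fin n → ℤ => oscAmplitude K τ (A (T⁻¹ • fun i => (k i : ℝ)))) = F ∘ e := by
    ext k
    simp only [hF, Function.comp_apply, he, map_smul]
  have hsum : Summable F := by
    rw [← e.summable_iff, ← hFe]
    exact summable_oscAmplitude_lattice K A τ T hT
  have hsupp : Function.support F ⊆ Set.range h := by
    intro a ha
    refine hrange a fun h0 => ha ?_
    simp only [hF, h0, map_zero, smul_zero, oscAmplitude_eq]
    rw [oscBump_eq_zero (Or.inl (by norm_num)), zero_mul]
  have hnorm : ∀ x : mixedSpace K, mixedEmbedding.norm (T⁻¹ • x) =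
      mixedEmbedding.norm x / T ^ Module.finrank ℚ K := by
    intro x
    rw [mixedEmbedding.norm_smul, abs_of_pos (inv_pos.mpr hT), inv_pow]
    ring
  have hgn : ∀ I, mixedEmbedding.norm (mixedEmbedding K (g I : 𝓞 K)) =
      Ideal.absNorm (I.1 : Ideal (𝓞 K)) * Ideal.absNorm (J : Ideal (𝓞 K)) := by
    intro I
    rw [← Nat.cast_mul, ← map_mul, ← hg, Ideal.absNorm_span_singleton, norm_eq_norm,
      ← Algebra.coe_norm_int]
    simp
  have hg0 : ∀ I, mixedEmbedding.norm (mixedEmbedding K (g I : 𝓞 K)) ≠ 0 := by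
    intro I
    rw [hgn]
    exact mul_ne_zero (Nat.cast_ne_zero.mpr (Ideal.absNorm_ne_zero_of_nonZeroDivisors _))
      (Nat.cast_ne_zero.mpr (Ideal.absNorm_ne_zero_of_nonZeroDivisors _))
  have hFh : ∀ p, F (h p) = oscBump τ (Ideal.absNorm (p.1.1 : Ideal (𝓞 K)) *
      Ideal.absNorm (J : Ideal (𝓞 K)) / T ^ Module.finrank ℚ K) *
      unitWeight K (p.2 • mixedEmbedding K (g p.1 : 𝓞 K)) := by
    intro p
    have h1 : mixedEmbedding K ((h p : 𝓞 K) : K) = p.2 • mixedEmbedding K (g p.1 : 𝓞 K) := by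
      rw [hh, unitSMul_smul, ← map_mul]
      rfl
    simp only [hF]
    rw [oscAmplitude_eq, hnorm, h1, norm_unit_smul, hgn]
    have h4 : unitWeight K (T⁻¹ • p.2 • mixedEmbedding K (g p.1 : 𝓞 K)) =
        unitWeight K (p.2 • mixedEmbedding K (g p.1 : 𝓞 K)) := by
      rw [unitWeight, logMap_real_smul (by rw [norm_unit_smul]; exact hg0 _) (inv_ne_zero hT.ne'), unitWeight]
    rw [h4]
  rw [hFe]
  calc ∑' k, F (e k) = ∑' a, F a := e.tsum_eq F
    _ = ∑' p, F (h p) := (hinj.tsum_eq hsupp).symm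
    _ = ∑' I, ∑' u, F (h (I, u)) :=
      ((hinj.summable_iff fun x hx => Function.notMem_support.mp fun h' =>
        hx (hsupp h')).mpr hsum).tsum_prod
    _ = _ := by
      rw [← tsum_mul_left]
      refine tsum_congr fun I => ?_
      have h5 := (hasSum_unitWeight K (hg0 I)).mapL Complex.ofRealCLM
      simp only [hFh]
      rw [tsum_mul_left, mul_comm]
      congr 1
      exact h5.tsum_eq

end IdealSum

namespace IdealSum

open NumberField NumberField.mixedEmbedding NumberField.Units NumberField.InfinitePlace
open NumberField.Units.dirichletUnitTheorem Filter Topology nonZeroDivisors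
open scoped Classical

variable (K : Type*) [Field K] [NumberField K]

theorem norm_tsum_oscBump_class_sub_le (C : ClassGroup (𝓞 K)) :
    ∃ M, 0 ≤ M ∧ ∀ τ : ℝ, ∃ c : ℂ, ‖c‖ ≤ M ∧ ∀ X : ℝ, 1 ≤ X →
      ‖(∑' I : {I : (Ideal (𝓞 K))⁰ // ClassGroup.mk0 I = C},
        oscBump τ (Ideal.absNorm (I.1 : Ideal (𝓞 K)) / X)) - c * X‖ ≤
        M * (1 + |τ|) ^ (2 * Module.finrank ℚ K) * X⁻¹ := by
  obtain ⟨J, hJ⟩ := ClassGroup.mk0_surjective C⁻¹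
  have hB := exists_basis_equiv_ideal K J
  have hn : 0 < Module.finrank ℚ K := Module.finrank_pos
  set n := Module.finrank ℚ K with hn_def
  obtain ⟨B, e, he⟩ := hB
  set A : (Fin n → ℝ) ≃L[ℝ] mixedSpace K := B.equivFun.symm.toContinuousLinearEquiv with hA
  have he' : ∀ k, mixedEmbedding K (e k : 𝓞 K) = A fun i => (k i : ℝ) := by
    intro k
    rw [he]
    simp [hA, Module.Basis.equivFun_symm_apply]
  have hχ : ContDiff ℝ (⊤ : ℕ∞) fun x => ((amplitude K (A x) : ℝ) : ℂ) :=
    Complex.ofRealCLM.contDiff.comp ((contDiff_amplitude K).comp A.contDiff)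
  have hcs : HasCompactSupport fun x => ((amplitude K (A x) : ℝ) : ℂ) :=
    ((hasCompactSupport_amplitude K).comp_homeomorph A.toHomeomorph).comp_left
      (g := fun y : ℝ => (y : ℂ)) Complex.ofReal_zero
  obtain ⟨M, hM0, hM⟩ := LatticeSum.norm_tsum_exp_mul_scaled_sub_integral_le
    (f := fun x => phase K (A x)) ((contDiff_phase K).comp A.contDiff) (r := 2 * n) (by omega)
    hχ hcs
  have hw : (1 : ℝ) ≤ torsionOrder K := by
    exact_mod_cast Nat.one_le_iff_ne_zero.mpr (torsionOrder_ne_zero K)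
  have hN : (1 : ℝ) ≤ Ideal.absNorm (J : Ideal (𝓞 K)) := by
    exact_mod_cast Nat.one_le_iff_ne_zero.mpr (Ideal.absNorm_ne_zero_of_nonZeroDivisors _)
  set w : ℝ := (torsionOrder K : ℝ) with hw_def
  set N : ℝ := (Ideal.absNorm (J : Ideal (𝓞 K)) : ℝ) with hN_def
  set D := ∫ x, ‖((amplitude K (A x) : ℝ) : ℂ)‖ with hD
  have hD0 : 0 ≤ D := MeasureTheory.integral_nonneg fun x => norm_nonneg _
  refine ⟨max M (N * D), le_max_of_le_left hM0, fun τ => ?_⟩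
  set E := ∫ x, Complex.exp (Complex.I * (τ * phase K (A x) : ℝ)) * (amplitude K (A x) : ℂ)
    with hE
  have hED : ‖E‖ ≤ D := by
    refine (MeasureTheory.norm_integral_le_integral_norm _).trans (le_of_eq ?_)
    refine MeasureTheory.integral_congr_ae (Filter.Eventually.of_forall fun x => ?_)
    simp only [norm_mul]
    rw [mul_comm Complex.I, Complex.norm_exp_ofReal_mul_I, one_mul]
  refine ⟨w⁻¹ * N * E, ?_, fun X hX => ?_⟩
  · refine le_trans ?_ (le_max_right _ _)
    rw [norm_mul, norm_mul, Complex.norm_real, Complex.norm_real, Real.norm_of_nonneg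
      (by positivity), Real.norm_of_nonneg (by positivity)]
    have : w⁻¹ ≤ 1 := inv_le_one_of_one_le₀ hw
    calc w⁻¹ * N * ‖E‖ ≤ 1 * N * D := by gcongr
      _ = N * D := by ring
  set T := (X * N) ^ ((n : ℝ)⁻¹) with hT
  have hXN : 1 ≤ X * N := one_le_mul_of_one_le_of_one_le hX hN
  have hT1 : 1 ≤ T := Real.one_le_rpow hXN (by positivity)
  have hTn : T ^ n = X * N := Real.rpow_inv_natCast_pow (by positivity) hn.ne'
  have h1 := hM τ T hT1
  have h2 := tsum_oscAmplitude_lattice K hJ A e he' τ T (by positivity)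
  rw [← hn_def, hTn] at h2
  have h3 : ∀ I : {I : (Ideal (𝓞 K))⁰ // ClassGroup.mk0 I = C},
      (Ideal.absNorm (I.1 : Ideal (𝓞 K)) : ℝ) * N / (X * N) =
        Ideal.absNorm (I.1 : Ideal (𝓞 K)) / X := by
    intro I
    rw [mul_div_mul_right _ _ (by positivity)]
  simp only [← hN_def, h3] at h2
  set S := ∑' I : {I : (Ideal (𝓞 K))⁰ // ClassGroup.mk0 I = C},
        oscBump τ (Ideal.absNorm (I.1 : Ideal (𝓞 K)) / X) with hS
  change ‖(∑' k : Fin n → ℤ, oscAmplitude K τ (A (T⁻¹ • fun i => (k i : ℝ)))) - _ * E‖ ≤ _ at h1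
  have hwc : ((torsionOrder K : ℕ) : ℂ) = (w : ℂ) := by rw [hw_def]; norm_cast
  have hTc : (T : ℂ) ^ n = (X * N : ℝ) := by rw [← hTn]; norm_cast
  rw [h2, hwc, hTc, pow_mul' T, hTn, sq (X * N), div_mul_cancel_left₀ (by positivity)] at h1
  have hw0 : (w : ℂ) ≠ 0 := by exact_mod_cast (by positivity : w ≠ 0)
  have h4 : S - w⁻¹ * N * E * X = (w : ℂ)⁻¹ * (w * S - (X * N : ℝ) * E) := by
    push_cast
    field_simp
  rw [h4, norm_mul, norm_inv, Complex.norm_real, Real.norm_of_nonneg (by positivity)]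
  calc w⁻¹ * ‖(w * S - (X * N : ℝ) * E : ℂ)‖
      ≤ 1 * (M * (1 + |τ|) ^ (2 * n) * (X * N)⁻¹) := by
        gcongr
        exact inv_le_one_of_one_le₀ hw
    _ ≤ 1 * (max M (N * D) * (1 + |τ|) ^ (2 * n) * X⁻¹) := by
        gcongr
        · exact le_max_left _ _
        · exact le_mul_of_one_le_right (by positivity) hN
    _ = _ := one_mul _

end IdealSum

namespace IdealSum

open NumberField nonZeroDivisors
open scoped Classical

variable (K : Type*) [Field K] [NumberField K]

theorem oscBump_support_finite (τ X : ℝ) (hX : 0 < X) :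
    (Function.support fun I : {I : Ideal (𝓞 K) // I ≠ ⊥} =>
      oscBump τ (Ideal.absNorm I.1 / X)).Finite := by
  refine Set.Finite.of_finite_image (f := Subtype.val)
    ((Ideal.finite_setOfPred_absNorm_le (S := 𝓞 K) ⌊2 * X⌋₊).subset ?_) Subtype.val_injective.injOn
  rintro _ ⟨I, hI, rfl⟩
  refine Nat.le_floor ?_
  by_contra! h
  exact hI (oscBump_eq_zero (Or.inr ((le_div_iff₀ hX).mpr h.le)))

/-- Smoothed, twisted counting of ideals, with polynomial dependence on the twist. -/
theorem norm_tsum_oscBump_sub_le :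
    ∃ M, 0 ≤ M ∧ ∃ r : ℕ, ∀ τ : ℝ, ∃ c : ℂ, ‖c‖ ≤ M ∧ ∀ X : ℝ, 1 ≤ X →
      ‖(∑' I : {I : Ideal (𝓞 K) // I ≠ ⊥}, oscBump τ (Ideal.absNorm I.1 / X)) - c * X‖ ≤
        M * (1 + |τ|) ^ r * X⁻¹ := by
  choose M hM0 hM using norm_tsum_oscBump_class_sub_le K
  choose c hc hS using fun τ C => hM C τ
  refine ⟨∑ C, M C, Finset.sum_nonneg fun C _ => hM0 C, 2 * Module.finrank ℚ K, fun τ =>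
    ⟨∑ C, c τ C, norm_sum_le_of_le Finset.univ fun C _ => hc τ C, fun X hX => ?_⟩⟩
  let E : (Ideal (𝓞 K))⁰ ≃ {I : Ideal (𝓞 K) // I ≠ ⊥} :=
    Equiv.subtypeEquivRight fun I => mem_nonZeroDivisors_iff_ne_zero
  have h1 : ∑' I : {I : Ideal (𝓞 K) // I ≠ ⊥}, oscBump τ (Ideal.absNorm I.1 / X) =
      ∑ C, ∑' I : {I : (Ideal (𝓞 K))⁰ // ClassGroup.mk0 I = C},
        oscBump τ (Ideal.absNorm (I.1 : Ideal (𝓞 K)) / X) := by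
    have hs := summable_of_hasFiniteSupport (L := .unconditional _) (oscBump_support_finite K τ X (by linarith))
    have hs' := ((Equiv.sigmaFiberEquiv (ClassGroup.mk0 (R := 𝓞 K))).trans E).summable_iff.mpr hs
    rw [← ((Equiv.sigmaFiberEquiv (ClassGroup.mk0 (R := 𝓞 K))).trans E).tsum_eq
      fun I : {I : Ideal (𝓞 K) // I ≠ ⊥} => oscBump τ (Ideal.absNorm I.1 / X)]
    exact hs'.tsum_sigma.trans (tsum_fintype (L := .unconditional _) _)
  rw [h1, Finset.sum_mul, ← Finset.sum_sub_distrib, Finset.sum_mul, Finset.sum_mul]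
  exact norm_sum_le_of_le Finset.univ fun C _ => hS τ C X hX

end IdealSum

namespace SmoothSum

open Filter Topology Set MeasureTheory IdealSum

theorem continuous_oscBump (τ : ℝ) : Continuous (oscBump τ) := by
  have h : oscBump τ = fun y => Complex.exp (Complex.I * (τ * smoothLog y : ℝ)) * bump y := by
    ext y
    rcases le_or_gt y 1 with h | h
    · rw [oscBump, bump_eq_zero_of_le h]
      simp
    · rw [oscBump, smoothLog_eq_log h.le]
  rw [h]
  have h1 : Continuous smoothLog := (contDiff_smoothLog (n := 0)).continuous
  have h2 : Continuous bump := (contDiff_bump (n := 0)).continuous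
  fun_prop

theorem norm_oscBump (τ y : ℝ) : ‖oscBump τ y‖ = bump y := by
  rw [oscBump, norm_mul, mul_comm Complex.I, Complex.norm_exp_ofReal_mul_I, one_mul,
    Complex.norm_real, Real.norm_of_nonneg (bump_nonneg y)]

theorem mellinConvergent_oscBump (τ : ℝ) (s : ℂ) : MellinConvergent (oscBump τ) s := by
  refine mellinConvergent_of_isBigO_rpow (a := s.re + 1) (b := s.re - 1)
    ((continuous_oscBump τ).continuousOn.locallyIntegrableOn measurableSet_Ioi) ?_ (by linarith) ?_
    (by linarith)
  · refine (Asymptotics.isBigO_zero _ _).congr' ?_ EventuallyEq.rfl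
    filter_upwards [eventually_ge_atTop 2] with y hy using (oscBump_eq_zero (Or.inr hy)).symm
  · refine (Asymptotics.isBigO_zero _ _).congr' ?_ EventuallyEq.rfl
    filter_upwards [nhdsWithin_le_nhds (eventually_le_nhds (zero_lt_one' ℝ))] with y hy
      using (oscBump_eq_zero (Or.inl hy)).symm

variable {ι : Type*} {N : ι → ℕ}

theorem countable_of_finite_le (hfin : ∀ n : ℕ, {i | N i ≤ n}.Finite) : Countable ι := by
  rw [← Set.countable_univ_iff]
  refine (countable_iUnion fun n : ℕ => (hfin n).countable).mono fun i _ => ?_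
  exact mem_iUnion.mpr ⟨N i, show N i ≤ N i from le_rfl⟩

theorem finite_le_real (hfin : ∀ n : ℕ, {i | N i ≤ n}.Finite) (R : ℝ) :
    {i | (N i : ℝ) ≤ R}.Finite := by
  refine (hfin ⌊R⌋₊).subset fun i hi => ?_
  exact Nat.le_floor hi

theorem continuousOn_tsum_oscBump (hfin : ∀ n : ℕ, {i | N i ≤ n}.Finite) (τ : ℝ) :
    ContinuousOn (fun y : ℝ => ∑' i, oscBump τ (N i * y)) (Ioi 0) := by
  intro y hy
  rw [mem_Ioi] at hy
  refine ContinuousAt.continuousWithinAt ?_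
  have h1 := finite_le_real hfin (4 / y)
  have h2 : (fun y : ℝ => ∑' i, oscBump τ (N i * y)) =ᶠ[𝓝 y]
      fun z => ∑ i ∈ h1.toFinset, oscBump τ (N i * z) := by
    filter_upwards [eventually_gt_nhds (half_lt_self hy)] with z hz
    refine tsum_eq_sum fun i hi => oscBump_eq_zero (Or.inr ?_)
    simp only [Finite.mem_toFinset, mem_ofPred_eq, not_le] at hi
    rw [div_lt_iff₀ hy] at hi
    have : (0:ℝ) ≤ N i := Nat.cast_nonneg _
    nlinarith
  refine ContinuousAt.congr ?_ h2.symm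
  have := continuous_oscBump τ
  fun_prop

theorem mellin_tsum_oscBump (hN1 : ∀ i, 1 ≤ N i) (hfin : ∀ n : ℕ, {i | N i ≤ n}.Finite) (τ : ℝ)
    {s z : ℂ} (hZ : HasSum (fun i => (N i : ℂ) ^ (-s)) z) :
    mellin (fun y : ℝ => ∑' i, oscBump τ (N i * y)) s = z * mellin (oscBump τ) s := by
  have := countable_of_finite_le hfin
  have hpos : ∀ i, (0 : ℝ) < N i := fun i => by exact_mod_cast hN1 i
  have h1 := hasSum_integral_of_summable_integral_norm (μ := volume.restrict (Ioi 0))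
    (F := fun i (t : ℝ) => (t : ℂ) ^ (s - 1) • oscBump τ (N i * t))
    (fun i => (MellinConvergent.comp_mul_left (hpos i)).mpr (mellinConvergent_oscBump τ s)) ?_
  · have h2 : ∀ i, ∫ t in Ioi (0 : ℝ), (t : ℂ) ^ (s - 1) • oscBump τ (N i * t) =
        (N i : ℂ) ^ (-s) * mellin (oscBump τ) s := by
      intro i
      have := mellin_comp_mul_left (oscBump τ) s (hpos i)
      rw [mellin, smul_eq_mul] at this
      rw [this]
      norm_cast
    simp only [h2] at h1
    have h3 := h1.unique (hZ.mul_right _)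
    rw [← h3, mellin]
    refine setIntegral_congr_fun measurableSet_Ioi fun t ht => ?_
    simp only [smul_eq_mul]
    rw [tsum_mul_left]
  · have h2 : ∀ i, ∫ t in Ioi (0 : ℝ), ‖(t : ℂ) ^ (s - 1) • oscBump τ (N i * t)‖ =
        ‖(N i : ℂ) ^ (-s)‖ * ∫ t in Ioi (0 : ℝ), t ^ (s.re - 1) * bump t := by
      intro i
      have h3 := mellin_comp_mul_left (fun t => (bump t : ℂ)) s.re (hpos i)
      have h4 : ∀ f : ℝ → ℝ, mellin (fun t => (f t : ℂ)) s.re =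
          ((∫ t in Ioi (0 : ℝ), t ^ (s.re - 1) * f t : ℝ) : ℂ) := by
        intro f
        rw [mellin, ← integral_complex_ofReal]
        refine setIntegral_congr_fun measurableSet_Ioi fun t ht => ?_
        simp only [smul_eq_mul]
        rw [Complex.ofReal_mul, Complex.ofReal_cpow (le_of_lt ht)]
        norm_cast
      rw [h4 (fun t => bump (N i * t)), h4, Complex.ofReal_natCast, smul_eq_mul] at h3
      have h5 : (N i : ℂ) ^ (-(s.re : ℂ)) = ((‖(N i : ℂ) ^ (-s)‖ : ℝ) : ℂ) := by
        rw [Complex.norm_natCast_cpow_of_pos (hN1 i), Complex.neg_re,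
          Complex.ofReal_cpow (Nat.cast_nonneg _)]
        norm_cast
      rw [h5] at h3
      have h6 : ∫ t in Ioi (0 : ℝ), t ^ (s.re - 1) * bump (N i * t) =
        ‖(N i : ℂ) ^ (-s)‖ * ∫ t in Ioi (0 : ℝ), t ^ (s.re - 1) * bump t := by
        exact_mod_cast h3
      rw [← h6]
      refine setIntegral_congr_fun measurableSet_Ioi fun t ht => ?_
      simp only [norm_smul]
      rw [norm_oscBump, Complex.norm_cpow_eq_rpow_re_of_pos ht, Complex.sub_re, Complex.one_re]
    simp only [h2]
    exact hZ.summable.norm.mul_right _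

end SmoothSum

namespace SmoothSum

open Filter Topology Set MeasureTheory IdealSum

/-- The Mellin transform of a bounded function supported in `(0, 2]`. -/
theorem norm_mellin_le {h : ℝ → ℂ} {B : ℝ}
    (hB : ∀ t, 0 < t → ‖h t‖ ≤ B) (h0 : ∀ t, 2 < t → h t = 0) {s : ℂ} (hs : 0 < s.re) :
    ‖mellin h s‖ ≤ B * (2 ^ s.re / s.re) := by
  have hi : IntervalIntegrable (fun t : ℝ => t ^ (s.re - 1)) volume 0 2 :=
    intervalIntegral.intervalIntegrable_rpow' (by linarith)
  have h1 : mellin h s = ∫ t in Ioc (0 : ℝ) 2, (t : ℂ) ^ (s - 1) • h t := by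
    rw [mellin]
    refine setIntegral_eq_of_subset_of_forall_sdiff_eq_zero measurableSet_Ioi
      (fun t ht => ht.1) fun t ht => ?_
    rw [h0 t (by by_contra! h; exact ht.2 ⟨ht.1, h⟩), smul_zero]
  have h2 : ∫ t in Ioc (0 : ℝ) 2, B * t ^ (s.re - 1) = B * (2 ^ s.re / s.re) := by
    rw [← intervalIntegral.integral_of_le zero_le_two, intervalIntegral.integral_const_mul,
      integral_rpow (Or.inl (by linarith))]
    simp [Real.zero_rpow hs.ne']
  rw [h1, ← h2]
  refine norm_integral_le_of_norm_le ?_ ?_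
  · rw [← IntegrableOn, ← intervalIntegrable_iff_integrableOn_Ioc_of_le zero_le_two]
    exact hi.const_mul B
  · refine (ae_restrict_iff' measurableSet_Ioc).mpr (Eventually.of_forall fun t ht => ?_)
    rw [norm_smul, Complex.norm_cpow_eq_rpow_re_of_pos ht.1, mul_comm]
    simp only [Complex.sub_re, Complex.one_re]
    gcongr
    · exact Real.rpow_nonneg ht.1.le _
    · exact hB t ht.1

theorem differentiableAt_mellin_of_bounded {h : ℝ → ℂ} (hl : LocallyIntegrableOn h (Ioi 0)) {B : ℝ}
    (hB : ∀ t, 0 < t → ‖h t‖ ≤ B) (h0 : ∀ t, 2 < t → h t = 0) {s : ℂ} (hs : 0 < s.re) :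
    MellinConvergent h s ∧ DifferentiableAt ℂ (mellin h) s := by
  have h1 : h =O[atTop] (· ^ (-(s.re + 1)) : ℝ → ℝ) := by
    refine (Asymptotics.isBigO_zero _ _).congr' ?_ EventuallyEq.rfl
    filter_upwards [eventually_gt_atTop 2] with y hy using (h0 y hy).symm
  have h2 : h =O[𝓝[>] 0] (· ^ (-0 : ℝ) : ℝ → ℝ) := by
    refine Asymptotics.IsBigO.of_bound B ?_
    filter_upwards [self_mem_nhdsWithin] with t ht
    simpa using hB t ht
  exact ⟨mellinConvergent_of_isBigO_rpow hl h1 (by linarith) h2 hs,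
    mellin_differentiableAt_of_isBigO_rpow hl h1 (by linarith) h2 hs⟩

theorem one_le_norm_mellin_oscBump {σ t : ℝ} (hσ : 0 < σ) :
    1 / 4 ≤ ‖mellin (oscBump (-t)) (σ + t * Complex.I)‖ := by
  have h1 : mellin (oscBump (-t)) (σ + t * Complex.I) =
      ((∫ y in Ioi (0 : ℝ), y ^ (σ - 1) * bump y : ℝ) : ℂ) := by
    rw [mellin, ← integral_complex_ofReal]
    refine setIntegral_congr_fun measurableSet_Ioi fun y hy => ?_
    rw [mem_Ioi] at hy
    have hy' : (y : ℂ) ≠ 0 := by exact_mod_cast hy.ne'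
    simp only [smul_eq_mul, oscBump]
    rw [Complex.ofReal_mul (y ^ (σ - 1)), Complex.ofReal_cpow hy.le, Complex.cpow_def_of_ne_zero hy',
      Complex.cpow_def_of_ne_zero hy', ← mul_assoc, ← Complex.exp_add, ← Complex.ofReal_log hy.le]
    congr 2
    push_cast
    ring
  have hintg : IntegrableOn (fun y : ℝ => y ^ (σ - 1) * bump y) (Ioi 0) := by
    have := (mellinConvergent_oscBump 0 σ).norm
    refine this.congr ?_
    refine (ae_restrict_iff' measurableSet_Ioi).mpr (Eventually.of_forall fun y hy => ?_)
    simp only [norm_smul]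
    rw [norm_oscBump, Complex.norm_cpow_eq_rpow_re_of_pos hy, Complex.sub_re, Complex.one_re,
      Complex.ofReal_re]
  rw [h1, Complex.norm_real]
  refine le_trans ?_ (le_abs_self _)
  calc (1 / 4 : ℝ) = ∫ y in Ioc (5 / 4 : ℝ) (7 / 4), (1 / 2 : ℝ) := by
        rw [setIntegral_const, Real.volume_real_Ioc_of_le (by norm_num)]
        norm_num
    _ ≤ ∫ y in Ioc (5 / 4 : ℝ) (7 / 4), y ^ (σ - 1) * bump y := by
        refine setIntegral_mono_on (by simp) (hintg.mono_set fun y hy => ?_) measurableSet_Ioc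
          fun y hy => ?_
        · exact mem_Ioi.mpr (by linarith [hy.1])
        · have hy0 : 0 < y := by linarith [hy.1]
          rw [bump_eq_one hy.1.le hy.2, mul_one]
          calc (1 / 2 : ℝ) ≤ y⁻¹ := by
                rw [one_div]
                exact inv_anti₀ hy0 (by linarith [hy.2])
            _ = y ^ (-1 : ℝ) := (Real.rpow_neg_one y).symm
            _ ≤ y ^ (σ - 1) := Real.rpow_le_rpow_of_exponent_le (by linarith [hy.1]) (by linarith)
    _ ≤ _ := by
        refine setIntegral_mono_set hintg ?_ ?_
        · refine (ae_restrict_iff' measurableSet_Ioi).mpr (Eventually.of_forall fun y hy => ?_)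
          exact mul_nonneg (Real.rpow_nonneg (le_of_lt hy) _) (bump_nonneg y)
        · have : Ioc (5 / 4 : ℝ) (7 / 4) ⊆ Ioi 0 := fun y hy => by
            rw [mem_Ioi]
            linarith [hy.1]
          exact this.eventuallyLE

end SmoothSum

namespace SmoothSum

open Filter Topology Set MeasureTheory IdealSum

variable {ι : Type*} {N : ι → ℕ}

theorem exists_norm_tsum_oscBump_le (hN1 : ∀ i, 1 ≤ N i)
    (hs : Summable fun i => ((N i : ℝ) ^ 2)⁻¹) :
    ∃ D, ∀ τ t : ℝ, 1 ≤ t → ‖∑' i, oscBump τ (N i * t)‖ ≤ D := by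
  refine ⟨∑' i, 4 * ((N i : ℝ) ^ 2)⁻¹, fun τ t ht => ?_⟩
  have h1 : ∀ i, ‖oscBump τ (N i * t)‖ ≤ 4 * ((N i : ℝ) ^ 2)⁻¹ := by
    intro i
    have hi : (1 : ℝ) ≤ N i := by exact_mod_cast hN1 i
    rcases le_or_gt 2 ((N i : ℝ) * t) with h | h
    · rw [oscBump_eq_zero (Or.inr h), norm_zero]
      positivity
    · rw [norm_oscBump]
      refine (bump_le_one _).trans ?_
      rw [← div_eq_mul_inv, one_le_div (by positivity)]
      nlinarith
  exact tsum_of_norm_bounded (hs.mul_left 4).hasSum h1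

theorem exists_mul_mellin_oscBump_eq (hN1 : ∀ i, 1 ≤ N i)
    (hfin : ∀ n : ℕ, {i | N i ≤ n}.Finite) {Z : ℂ → ℂ}
    (hZ : ∀ s : ℂ, 1 < s.re → HasSum (fun i => (N i : ℂ) ^ (-s)) (Z s)) {M : ℝ} {r : ℕ}
    (hM0 : 0 ≤ M)
    (hM : ∀ τ : ℝ, ∃ c : ℂ, ‖c‖ ≤ M ∧ ∀ X : ℝ, 1 ≤ X →
      ‖(∑' i, oscBump τ (N i / X)) - c * X‖ ≤ M * (1 + |τ|) ^ r * X⁻¹) :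
    ∃ B, 0 ≤ B ∧ ∀ τ : ℝ, ∃ (c : ℂ) (F : ℂ → ℂ), ‖c‖ ≤ M ∧
      (∀ s : ℂ, 0 < s.re → DifferentiableAt ℂ F s ∧
        ‖F s‖ ≤ B * (1 + |τ|) ^ r * (2 ^ s.re / s.re)) ∧
      ∀ s : ℂ, 1 < s.re → Z s * mellin (oscBump τ) s = F s + c / (s - 1) := by
  have hs : Summable fun i => ((N i : ℝ) ^ 2)⁻¹ := by
    refine (hZ 2 (by norm_num)).summable.norm.congr fun i => ?_
    rw [Complex.norm_natCast_cpow_of_pos (hN1 i)]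
    norm_num [Real.rpow_neg]
  obtain ⟨D, hD⟩ := exists_norm_tsum_oscBump_le hN1 hs
  refine ⟨max M D, le_max_of_le_left hM0, fun τ => ?_⟩
  obtain ⟨c, hc, hX⟩ := hM τ
  set g : ℝ → ℂ := fun y => ∑' i, oscBump τ (N i * y) with hg
  set e : ℝ → ℂ := indicator (Ioc 0 1) (fun t => (t : ℂ) ^ (-1 : ℂ)) with he
  have hpow : 1 ≤ (1 + |τ|) ^ r := one_le_pow₀ (by linarith [abs_nonneg τ])
  have hB : ∀ t, 0 < t → ‖g t - c * e t‖ ≤ max M D * (1 + |τ|) ^ r := by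
    intro t ht
    rcases le_or_gt t 1 with h | h
    · have h1 := hX t⁻¹ ((one_le_inv₀ ht).mpr h)
      simp only [div_inv_eq_mul, inv_inv] at h1
      rw [he, indicator_of_mem (show t ∈ Ioc 0 1 from ⟨ht, h⟩), Complex.cpow_neg_one]
      push_cast at h1
      refine h1.trans ?_
      calc M * (1 + |τ|) ^ r * t ≤ M * (1 + |τ|) ^ r * 1 := by gcongr
        _ = M * (1 + |τ|) ^ r := mul_one _
        _ ≤ _ := by gcongr; exact le_max_left _ _
    · rw [he, indicator_of_notMem fun h' => h.not_ge h'.2, mul_zero, sub_zero]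
      refine (hD τ t h.le).trans ((le_max_right M D).trans ?_)
      exact le_mul_of_one_le_right (le_max_of_le_left hM0) hpow
  have h0 : ∀ t, 2 < t → g t - c * e t = 0 := by
    intro t ht
    rw [he, indicator_of_notMem fun h' => by linarith [h'.2], mul_zero, sub_zero]
    have : ∀ i, oscBump τ (N i * t) = 0 := by
      intro i
      have hi : (1 : ℝ) ≤ N i := by exact_mod_cast hN1 i
      exact oscBump_eq_zero (Or.inr (by nlinarith))
    simp only [hg, this, tsum_zero]
  have hel : LocallyIntegrableOn e (Ioi 0) := by
    have h1 : LocallyIntegrableOn (fun t : ℝ => (t : ℂ) ^ (-1 : ℂ)) (Ioi 0) := by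
      refine ContinuousOn.locallyIntegrableOn (fun t ht => ?_) measurableSet_Ioi
      exact (Complex.continuousAt_ofReal_cpow_const t _ (Or.inr (ne_of_gt ht))).continuousWithinAt
    intro t ht
    obtain ⟨U, hU, hU'⟩ := h1 t ht
    exact ⟨U, hU, hU'.indicator measurableSet_Ioc⟩
  have hgl : LocallyIntegrableOn g (Ioi 0) :=
    (continuousOn_tsum_oscBump hfin τ).locallyIntegrableOn measurableSet_Ioi
  have hl : LocallyIntegrableOn (fun t => g t - c * e t) (Ioi 0) :=
    hgl.sub fun t ht => let ⟨U, hU, hU'⟩ := hel t ht; ⟨U, hU, hU'.const_mul c⟩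
  refine ⟨c, mellin (fun t => g t - c * e t), hc, fun s hs => ⟨?_, norm_mellin_le hB h0 hs⟩,
    fun s hs => ?_⟩
  · exact (differentiableAt_mellin_of_bounded hl hB h0 hs).2
  · have h1 := (differentiableAt_mellin_of_bounded hl hB h0 (zero_lt_one.trans hs)).1
    have h2 := hasMellin_cpow_Ioc (-1) (s := s) (by
      rw [Complex.neg_re, Complex.one_re]; linarith)
    have h3 := hasMellin_const_smul h2.1 c
    have h4 := (hasMellin_add h1 h3.1).2
    rw [h3.2, h2.2] at h4
    rw [← mellin_tsum_oscBump hN1 hfin τ (hZ s hs)]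
    rw [show c / (s - 1) = c • (1 / (s + -1)) by rw [smul_eq_mul, ← sub_eq_add_neg]; ring, ← h4]
    congr 1
    ext t
    simp [hg, he]

/-- Polynomial growth in vertical strips. -/
theorem exists_norm_le_of_smooth_sums (hN1 : ∀ i, 1 ≤ N i)
    (hfin : ∀ n : ℕ, {i | N i ≤ n}.Finite) {Z : ℂ → ℂ}
    (hZ_an : ∀ s, s ≠ 1 → DifferentiableAt ℂ Z s)
    (hZ : ∀ s : ℂ, 1 < s.re → HasSum (fun i => (N i : ℂ) ^ (-s)) (Z s)) {M : ℝ} {r : ℕ}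
    (hM0 : 0 ≤ M)
    (hM : ∀ τ : ℝ, ∃ c : ℂ, ‖c‖ ≤ M ∧ ∀ X : ℝ, 1 ≤ X →
      ‖(∑' i, oscBump τ (N i / X)) - c * X‖ ≤ M * (1 + |τ|) ^ r * X⁻¹) :
    ∃ C, 0 ≤ C ∧ ∀ σ t : ℝ, 1 / 4 ≤ σ → σ ≤ 4 → 1 ≤ |t| →
      ‖Z (σ + t * Complex.I)‖ ≤ C * |t| ^ r := by
  obtain ⟨B, hB0, hB⟩ := exists_mul_mellin_oscBump_eq hN1 hfin hZ hM0 hM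
  refine ⟨4 * (B * 2 ^ r * 64 + M), by positivity, fun σ t hσ hσ' ht => ?_⟩
  obtain ⟨c, F, hc, hF, hFZ⟩ := hB (-t)
  have key : Z (σ + t * Complex.I) * mellin (oscBump (-t)) (σ + t * Complex.I) =
      F (σ + t * Complex.I) + c / (σ + t * Complex.I - 1) := by
    set U : Set ℂ := {s | 0 < s.re} ∩ {s | 0 < t * s.im} with hU
    have hUc : Convex ℝ U := by
      refine (convex_halfSpace_re_gt 0).inter ?_
      have : {s : ℂ | 0 < t * s.im} = (t • Complex.imCLM : ℂ →L[ℝ] ℝ) ⁻¹' Ioi 0 := by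
        ext s
        simp
      rw [this]
      exact (convex_Ioi 0).linear_preimage (t • Complex.imCLM : ℂ →L[ℝ] ℝ).toLinearMap
    have hUo : IsOpen U := by
      refine (isOpen_lt continuous_const Complex.continuous_re).inter
        (isOpen_lt continuous_const (by fun_prop))
    have hU1 : ∀ s ∈ U, s ≠ 1 := by
      rintro s hs rfl
      simpa using hs.2
    have ht0 : t ≠ 0 := fun h => by simp [h] at ht; linarith
    have htt : 0 < t * t := mul_self_pos.mpr ht0
    have h2U : (2 + t * Complex.I : ℂ) ∈ U := by simp [hU, htt]
    refine AnalyticOnNhd.eqOn_of_preconnected_of_eventuallyEq (𝕜 := ℂ)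
      (f := fun s => Z s * mellin (oscBump (-t)) s) (g := fun s => F s + c / (s - 1)) (U := U)
      ?_ ?_ hUc.isPreconnected h2U ?_ (by simp [hU, htt]; linarith)
    · refine DifferentiableOn.analyticOnNhd (fun s hs => ?_) hUo
      have hm : DifferentiableAt ℂ (mellin (oscBump (-t))) s := by
        refine mellin_differentiableAt_of_isBigO_rpow (a := s.re + 1) (b := s.re - 1)
          ((continuous_oscBump _).continuousOn.locallyIntegrableOn measurableSet_Ioi) ?_
          (by linarith) ?_ (by linarith)
        · refine (Asymptotics.isBigO_zero _ _).congr' ?_ EventuallyEq.rfl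
          filter_upwards [eventually_ge_atTop 2] with y hy using (oscBump_eq_zero (Or.inr hy)).symm
        · refine (Asymptotics.isBigO_zero _ _).congr' ?_ EventuallyEq.rfl
          filter_upwards [nhdsWithin_le_nhds (eventually_le_nhds (zero_lt_one' ℝ))] with y hy
            using (oscBump_eq_zero (Or.inl hy)).symm
      exact ((hZ_an s (hU1 s hs)).mul hm).differentiableWithinAt
    · refine DifferentiableOn.analyticOnNhd (fun s hs => ?_) hUo
      have h1 : s - 1 ≠ 0 := sub_ne_zero.mpr (hU1 s hs)
      exact ((hF s hs.1).1.add (by fun_prop (disch := exact h1))).differentiableWithinAt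
    · have : {s : ℂ | 1 < s.re} ∈ 𝓝 (2 + t * Complex.I : ℂ) :=
        (isOpen_lt continuous_const Complex.continuous_re).mem_nhds (by simp)
      filter_upwards [this] with s hs using hFZ s hs
  have h1 := one_le_norm_mellin_oscBump (σ := σ) (t := t) (by linarith)
  have h2 := (hF (σ + t * Complex.I) (by simp; linarith)).2
  simp only [Complex.add_re, Complex.ofReal_re, Complex.mul_re, Complex.I_re, mul_zero,
    Complex.ofReal_im, Complex.I_im, mul_one, sub_self, add_zero, abs_neg] at h2
  have h3 : (2 : ℝ) ^ σ / σ ≤ 64 := by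
    rw [div_le_iff₀ (by linarith)]
    have : (2 : ℝ) ^ σ ≤ 2 ^ (4 : ℝ) := Real.rpow_le_rpow_of_exponent_le one_le_two hσ'
    norm_num at this
    linarith
  have h4 : (1 + |t|) ^ r ≤ 2 ^ r * |t| ^ r := by
    rw [← mul_pow]
    gcongr
    linarith
  have h5 : ‖c / (σ + t * Complex.I - 1)‖ ≤ M * |t| ^ r := by
    have h6 : 1 ≤ ‖(σ + t * Complex.I - 1 : ℂ)‖ := by
      refine ht.trans ?_
      have := Complex.abs_im_le_norm (σ + t * Complex.I - 1 : ℂ)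
      simpa using this
    rw [norm_div]
    calc ‖c‖ / ‖(σ + t * Complex.I - 1 : ℂ)‖ ≤ M / 1 := by gcongr
      _ = M * 1 := by ring
      _ ≤ _ := by gcongr; exact one_le_pow₀ ht
  have h6 : ‖F (σ + t * Complex.I)‖ ≤ B * (2 ^ r * |t| ^ r) * 64 := by
    refine h2.trans ?_
    have : 0 ≤ (2 : ℝ) ^ σ / σ := by positivity
    gcongr
  have h7 := (congrArg norm key).trans_le (norm_add_le _ _)
  rw [norm_mul] at h7
  nlinarith [norm_nonneg (Z (σ + t * Complex.I))]

end SmoothSum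

namespace IdealEuler

open IsDedekindDomain Filter Topology Set

variable {R : Type*} [CommRing R] [IsDedekindDomain R]

theorem HeightOneSpectrum.eq_of_dvd {v w : HeightOneSpectrum R} (h : v.asIdeal ∣ w.asIdeal) :
    v = w := by
  refine HeightOneSpectrum.ext ?_
  exact (w.isMaximal.eq_of_le v.isPrime.ne_top (Ideal.dvd_iff_le.mp h)).symm

theorem dvd_prod_iff {v : HeightOneSpectrum R} {T : Finset (HeightOneSpectrum R)} :
    v.asIdeal ∣ ∏ w ∈ T, w.asIdeal ↔ v ∈ T := by
  refine ⟨fun h => ?_, fun h => Finset.dvd_prod_of_mem _ h⟩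
  obtain ⟨w, hw, h'⟩ := (v.prime.dvd_finsetProd_iff _).mp h
  rwa [HeightOneSpectrum.eq_of_dvd h']

theorem prod_asIdeal_injective :
    Function.Injective fun T : Finset (HeightOneSpectrum R) => ∏ w ∈ T, w.asIdeal := by
  intro T T' h
  ext v
  rw [← dvd_prod_iff, ← dvd_prod_iff]
  exact iff_of_eq (congrArg (v.asIdeal ∣ ·) h)

open scoped Classical in
theorem hasSum_indicator_not_dvd (f : Ideal R →*₀ ℂ) {z : ℂ} (hf : HasSum f z)
    (T : Finset (HeightOneSpectrum R)) :
    HasSum (indicator {I : Ideal R | ∀ v ∈ T, ¬ v.asIdeal ∣ I} f)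
      (z * ∏ v ∈ T, (1 - f v.asIdeal)) := by
  induction T using Finset.induction_on with
  | empty => simpa using hf
  | insert v T hv ih =>
    set g := indicator {I : Ideal R | ∀ v ∈ T, ¬ v.asIdeal ∣ I} f with hg
    have hinj : Function.Injective fun I : Ideal R => v.asIdeal * I :=
      mul_right_injective₀ v.ne_bot
    have h1 : HasSum (indicator {I | v.asIdeal ∣ I} g)
        (f v.asIdeal * (z * ∏ v ∈ T, (1 - f v.asIdeal))) := by
      rw [← hinj.hasSum_iff]
      · refine (ih.mul_left (f v.asIdeal)).congr_fun fun I => ?_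
        rw [Function.comp_apply, indicator_of_mem (show v.asIdeal * I ∈ {I | v.asIdeal ∣ I} from dvd_mul_right _ _)]
        have h2 : ∀ w ∈ T, (w.asIdeal ∣ v.asIdeal * I ↔ w.asIdeal ∣ I) := by
          intro w hw
          rw [w.prime.dvd_mul, or_iff_right]
          intro h
          exact hv (HeightOneSpectrum.eq_of_dvd h ▸ hw)
        by_cases h3 : ∀ w ∈ T, ¬ w.asIdeal ∣ I
        · rw [hg, indicator_of_mem (s := {I : Ideal R | ∀ v ∈ T, ¬ v.asIdeal ∣ I}) (a := I) h3,
            indicator_of_mem, map_mul]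
          exact fun w hw h => h3 w hw ((h2 w hw).mp h)
        · rw [hg, indicator_of_notMem (s := {I : Ideal R | ∀ v ∈ T, ¬ v.asIdeal ∣ I}) (a := I) h3,
            indicator_of_notMem, mul_zero]
          exact fun h => h3 fun w hw h' => h w hw ((h2 w hw).mpr h')
      · intro I hI
        refine indicator_of_notMem ?_ _
        rintro ⟨J, rfl⟩
        exact hI ⟨J, rfl⟩
    have h2 := ih.sub h1
    rw [Finset.prod_insert hv]
    have h4 : z * ((1 - f v.asIdeal) * ∏ v ∈ T, (1 - f v.asIdeal)) =
        z * ∏ v ∈ T, (1 - f v.asIdeal) - f v.asIdeal * (z * ∏ v ∈ T, (1 - f v.asIdeal)) := by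
      ring
    rw [h4]
    refine h2.congr_fun fun I => ?_
    · symm
      by_cases h3 : v.asIdeal ∣ I
      · rw [indicator_of_mem (show I ∈ {I | v.asIdeal ∣ I} from h3), sub_self]
        refine (indicator_of_notMem (fun h => ?_) _).symm
        exact (show ∀ w ∈ insert v T, ¬ w.asIdeal ∣ I from h) v (Finset.mem_insert_self v T) h3
      · rw [indicator_of_notMem (show I ∉ {I | v.asIdeal ∣ I} from h3), sub_zero, hg]
        simp only [indicator_apply, mem_ofPred_eq, Finset.forall_mem_insert, h3, not_false_eq_true,
          true_and]

theorem tendsto_mul_prod_one_sub (f : Ideal R →*₀ ℂ) {z : ℂ} (hf : HasSum f z) :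
    Tendsto (fun T : Finset (HeightOneSpectrum R) => z * ∏ v ∈ T, (1 - f v.asIdeal)) atTop
      (𝓝 1) := by
  classical
  have h1 : Tendsto (fun T : Finset (HeightOneSpectrum R) =>
      ∑' I, indicator {I : Ideal R | ∀ v ∈ T, ¬ v.asIdeal ∣ I} f I) atTop
      (𝓝 (∑' I, if I = (1 : Ideal R) then 1 else 0)) := by
    refine tendsto_tsum_of_dominated_convergence (G := ℂ) (bound := fun I => ‖f I‖) hf.summable.norm ?_ ?_
    · intro I
      refine tendsto_const_nhds.congr' ?_
      split_ifs with h1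
      · subst h1
        filter_upwards with T
        rw [indicator_of_mem, map_one]
        intro v hv h
        exact v.prime.not_isUnit (isUnit_of_dvd_one h)
      · rcases eq_or_ne I ⊥ with rfl | h0
        · filter_upwards with T
          refine (indicator_apply_eq_zero.mpr fun _ => ?_).symm
          exact map_zero f
        · obtain ⟨M, hM, hM'⟩ := Ideal.exists_le_maximal I (by rwa [Ideal.one_eq_top] at h1)
          have hM0 : M ≠ ⊥ := fun h => h0 (by rwa [h, le_bot_iff] at hM')
          filter_upwards [eventually_ge_atTop {(⟨M, hM.isPrime, hM0⟩ : HeightOneSpectrum R)}]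
            with T hT
          refine (indicator_of_notMem (fun h => ?_) _).symm
          exact h ⟨M, hM.isPrime, hM0⟩ (hT (Finset.mem_singleton_self _)) (Ideal.dvd_iff_le.mpr hM')
    · filter_upwards with T I using norm_indicator_le_norm_self _ _
  rw [tsum_ite_eq] at h1
  exact h1.congr fun T => (hasSum_indicator_not_dvd f hf T).tsum_eq

theorem ne_zero_of_hasSum (f : Ideal R →*₀ ℂ) {z : ℂ} (hf : HasSum f z) : z ≠ 0 := by
  rintro rfl
  have := tendsto_mul_prod_one_sub f hf
  simp only [zero_mul] at this
  exact zero_ne_one (tendsto_nhds_unique tendsto_const_nhds this)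

theorem hasProd_one_sub (f : Ideal R →*₀ ℂ) {z : ℂ} (hf : HasSum f z) :
    HasProd (fun v : HeightOneSpectrum R => 1 - f v.asIdeal) z⁻¹ := by
  have h0 := ne_zero_of_hasSum f hf
  have := (tendsto_mul_prod_one_sub f hf).const_mul z⁻¹
  simpa [← mul_assoc, inv_mul_cancel₀ h0] using! this

theorem hasSum_moebius (f : Ideal R →*₀ ℂ) {z : ℂ} (hf : HasSum f z) :
    HasSum (fun T : Finset (HeightOneSpectrum R) => (-1) ^ T.card * f (∏ v ∈ T, v.asIdeal))
      z⁻¹ := by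
  have h1 : Summable fun T : Finset (HeightOneSpectrum R) =>
      (-1) ^ T.card * f (∏ v ∈ T, v.asIdeal) := by
    refine Summable.of_norm ?_
    simp only [norm_mul, norm_pow, norm_neg, norm_one, one_pow, one_mul]
    exact hf.summable.norm.comp_injective prod_asIdeal_injective
  have h2 : (fun T : Finset (HeightOneSpectrum R) => (-1) ^ T.card * f (∏ v ∈ T, v.asIdeal)) =
      fun T => ∏ v ∈ T, -f v.asIdeal := by
    ext T
    rw [Finset.prod_neg, map_prod]
  have h3 := hasProd_one_add_of_hasSum_prod (h2 ▸ h1.hasSum)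
  have h4 : z⁻¹ = ∑' T : Finset (HeightOneSpectrum R),
      (-1) ^ T.card * f (∏ v ∈ T, v.asIdeal) := by
    refine (hasProd_one_sub f hf).unique ?_
    rw [h2]
    simpa only [← sub_eq_add_neg] using! h3
  rw [h4]
  exact h1.hasSum

end IdealEuler

namespace IdealEuler

open IsDedekindDomain Filter Topology Set NumberField UniqueFactorizationMonoid
open scoped Classical

variable (K : Type*) [Field K] [NumberField K]

theorem exists_add_one_le_mul_two_rpow {ε : ℝ} (hε : 0 < ε) :
    ∃ c : ℝ, 1 ≤ c ∧ ∀ e : ℕ, (e : ℝ) + 1 ≤ c * 2 ^ (ε * e) := by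
  have hl : 0 < Real.log 2 := Real.log_pos one_lt_two
  refine ⟨1 + 1 / (ε * Real.log 2), by simp; positivity, fun e => ?_⟩
  have h1 : 1 + ε * Real.log 2 * e ≤ (2 : ℝ) ^ (ε * e) := by
    rw [Real.rpow_def_of_pos two_pos]
    linarith [Real.add_one_le_exp (Real.log 2 * (ε * e))]
  have he : (0 : ℝ) ≤ e := Nat.cast_nonneg e
  calc (e : ℝ) + 1 ≤ (1 + 1 / (ε * Real.log 2)) * (1 + ε * Real.log 2 * e) := by
        have h2 : (1 + 1 / (ε * Real.log 2)) * (1 + ε * Real.log 2 * e) =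
            1 + ε * Real.log 2 * e + 1 / (ε * Real.log 2) + e := by
          field_simp
          ring
        rw [h2]
        have : 0 ≤ ε * Real.log 2 * e := by positivity
        have : 0 ≤ 1 / (ε * Real.log 2) := by positivity
        linarith
    _ ≤ _ := by gcongr

theorem exists_card_Iic_normalizedFactors_le {ε : ℝ} (hε : 0 < ε) :
    ∃ C : ℝ, 0 ≤ C ∧ ∀ A : Ideal (𝓞 K), A ≠ ⊥ →
      ((Finset.Iic (normalizedFactors A)).card : ℝ) ≤ C * (Ideal.absNorm A : ℝ) ^ ε := by
  obtain ⟨c, hc1, hc⟩ := exists_add_one_le_mul_two_rpow hε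
  have hfin := Ideal.finite_setOfPred_absNorm_le (S := 𝓞 K) ⌊(2 : ℝ) ^ ε⁻¹⌋₊
  set B := hfin.toFinset with hB
  refine ⟨c ^ B.card, by positivity, fun A hA => ?_⟩
  set s := normalizedFactors A with hs
  have hNA : (Ideal.absNorm A : ℝ) ^ ε =
      ∏ P ∈ s.toFinset, (Ideal.absNorm P : ℝ) ^ (ε * s.count P) := by
    have h1 : Ideal.absNorm A = ∏ P ∈ s.toFinset, Ideal.absNorm P ^ s.count P := by
      conv_lhs => rw [← associated_iff_eq.mp (prod_normalizedFactors hA), ← hs]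
      rw [Finset.prod_multiset_count, map_prod]
      simp
    rw [h1]
    push_cast
    rw [← Real.finsetProd_rpow _ _ fun i _ => by positivity]
    refine Finset.prod_congr rfl fun P _ => ?_
    rw [mul_comm, Real.rpow_mul (Nat.cast_nonneg _), Real.rpow_natCast]
  have hP : ∀ P ∈ s.toFinset, ((s.count P : ℕ) : ℝ) + 1 ≤
      (if P ∈ B then c else 1) * (Ideal.absNorm P : ℝ) ^ (ε * s.count P) := by
    intro P hP
    have hprime := prime_of_normalized_factor P (Multiset.mem_toFinset.mp hP)
    have h2 : 2 ≤ Ideal.absNorm P := by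
      have h0 : Ideal.absNorm P ≠ 0 := fun h => hprime.ne_zero (Ideal.absNorm_eq_zero_iff.mp h)
      have h1 : Ideal.absNorm P ≠ 1 := fun h => hprime.not_isUnit
        (Ideal.isUnit_iff.mpr (Ideal.absNorm_eq_one_iff.mp h))
      omega
    have h2' : (2 : ℝ) ≤ Ideal.absNorm P := by exact_mod_cast h2
    split_ifs with h
    · refine (hc _).trans ?_
      gcongr
    · have h3 : (2 : ℝ) ^ ε⁻¹ < Ideal.absNorm P := by
        simp only [hB, Finite.mem_toFinset, mem_ofPred_eq, not_le] at h
        exact (Nat.floor_lt (by positivity)).mp h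
      have h4 : 2 ≤ (Ideal.absNorm P : ℝ) ^ ε := by
        rw [← Real.rpow_inv_le_iff_of_pos two_pos.le (by positivity) hε]
        exact h3.le
      rw [one_mul, Real.rpow_mul (Nat.cast_nonneg _), Real.rpow_natCast]
      have h5 : (s.count P + 1 : ℝ) ≤ 2 ^ s.count P := by
        exact_mod_cast Nat.lt_two_pow_self
      exact h5.trans (pow_le_pow_left₀ two_pos.le h4 _)
  rw [Multiset.card_Iic]
  push_cast
  calc ∏ P ∈ s.toFinset, ((s.count P : ℝ) + 1)
      ≤ ∏ P ∈ s.toFinset, (if P ∈ B then c else 1) * (Ideal.absNorm P : ℝ) ^ (ε * s.count P) :=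
        Finset.prod_le_prod (fun _ _ => by positivity) hP
    _ = c ^ (s.toFinset.filter (· ∈ B)).card * (Ideal.absNorm A : ℝ) ^ ε := by
        rw [Finset.prod_mul_distrib, hNA, Finset.prod_ite]
        simp
    _ ≤ _ := by
        refine mul_le_mul_of_nonneg_right (pow_le_pow_right₀ hc1 ?_) (by positivity)
        exact Finset.card_le_card fun P hP => (Finset.mem_filter.mp hP).2

/-- The number of ideals of norm `n` is `O(n ^ ε)`. -/
theorem exists_card_absNorm_eq_le {ε : ℝ} (hε : 0 < ε) :
    ∃ C : ℝ, 0 ≤ C ∧ ∀ n : ℕ, n ≠ 0 →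
      (Nat.card {I : Ideal (𝓞 K) // Ideal.absNorm I = n} : ℝ) ≤ C * (n : ℝ) ^ ε := by
  have hd : 0 < Module.finrank ℚ K := Module.finrank_pos
  obtain ⟨C, hC0, hC⟩ := exists_card_Iic_normalizedFactors_le K
    (ε := ε / Module.finrank ℚ K) (by positivity)
  refine ⟨C, hC0, fun n hn => ?_⟩
  have hn' : (n : 𝓞 K) ≠ 0 := Nat.cast_ne_zero.mpr hn
  have hA : Ideal.span {(n : 𝓞 K)} ≠ ⊥ := by
    rwa [Ne, Ideal.span_singleton_eq_bot]
  have h1 := hC _ hA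
  have h2 : Ideal.absNorm (Ideal.span {(n : 𝓞 K)}) = n ^ Module.finrank ℚ K := by
    rw [Ideal.absNorm_span_singleton, ← map_natCast (algebraMap ℤ (𝓞 K)), Algebra.norm_algebraMap,
      RingOfIntegers.rank]
    simp
  rw [h2, Nat.cast_pow, ← Real.rpow_natCast, ← Real.rpow_mul (Nat.cast_nonneg _),
    mul_div_cancel₀ _ (by positivity)] at h1
  refine le_trans ?_ h1
  have h3 : ∀ I : {I : Ideal (𝓞 K) // Ideal.absNorm I = n}, I.1 ≠ ⊥ := by
    rintro ⟨I, hI⟩ rfl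
    simp at hI
    exact hn hI.symm
  let g : {I : Ideal (𝓞 K) // Ideal.absNorm I = n} →
      Finset.Iic (normalizedFactors (Ideal.span {(n : 𝓞 K)})) := fun I =>
    ⟨normalizedFactors I.1, Finset.mem_Iic.mpr <|
      (dvd_iff_normalizedFactors_le_normalizedFactors (h3 I) hA).mp <| by
        rw [Ideal.dvd_span_singleton]
        have h4 := Ideal.absNorm_mem I.1
        rwa [I.2] at h4⟩
  have hg : Function.Injective g := by
    intro I J h
    have h4 : normalizedFactors I.1 = normalizedFactors J.1 := congrArg Subtype.val h
    refine Subtype.ext (associated_iff_eq.mp ?_)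
    exact (associated_iff_normalizedFactors_eq_normalizedFactors (h3 I) (h3 J)).mpr h4
  have h5 := Nat.card_le_card_of_injective g hg
  rw [Nat.card_eq_fintype_card (α := Finset.Iic _), Fintype.card_coe] at h5
  exact_mod_cast h5

end IdealEuler

namespace IdealEuler

open IsDedekindDomain Filter Topology Set NumberField
open scoped Classical

variable (K : Type*) [Field K] [NumberField K]

/-- The completely multiplicative function `I ↦ N(I) ^ (-s)`. -/
noncomputable def normCpow (s : ℂ) (hs : s ≠ 0) : Ideal (𝓞 K) →*₀ ℂ where
  toFun I := (Ideal.absNorm I : ℂ) ^ (-s)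
  map_zero' := by simp [hs]
  map_one' := by simp
  map_mul' I J := by
    rw [map_mul, Nat.cast_mul, Complex.natCast_mul_natCast_cpow]

variable {K}

theorem hasSum_normCpow {s z : ℂ} (hs : s ≠ 0)
    (h : HasSum (fun I : {I : Ideal (𝓞 K) // I ≠ ⊥} =>
      ((Ideal.absNorm I.1 : ℕ) : ℂ) ^ (-s)) z) : HasSum (normCpow K s hs) z := by
  refine (hasSum_subtype_iff_of_support_subset (s := {I : Ideal (𝓞 K) | I ≠ ⊥}) ?_).mp h
  intro I hI hI'
  subst hI'
  exact hI (map_zero (normCpow K s hs))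

/-- The coefficients of `1 / ζ_K`, as signed counts of squarefree ideals. -/
noncomputable def moebiusCoeff (K : Type*) [Field K] [NumberField K] (n : ℕ) : ℝ :=
  ∑' T : {T : Finset (HeightOneSpectrum (𝓞 K)) // Ideal.absNorm (∏ v ∈ T, v.asIdeal) = n},
    (-1 : ℝ) ^ T.1.card

theorem finite_absNorm_eq {n : ℕ} : Finite {I : Ideal (𝓞 K) // Ideal.absNorm I = n} :=
  (Ideal.finite_setOfPred_absNorm_le (S := 𝓞 K) n).subset
    (show {I : Ideal (𝓞 K) | Ideal.absNorm I = n} ⊆ _ from fun _ hI => le_of_eq hI)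

theorem abs_moebiusCoeff_le (n : ℕ) :
    |moebiusCoeff K n| ≤ Nat.card {I : Ideal (𝓞 K) // Ideal.absNorm I = n} := by
  have := finite_absNorm_eq (K := K) (n := n)
  let g : {T : Finset (HeightOneSpectrum (𝓞 K)) // Ideal.absNorm (∏ v ∈ T, v.asIdeal) = n} →
    {I : Ideal (𝓞 K) // Ideal.absNorm I = n} := fun T => ⟨∏ v ∈ T.1, v.asIdeal, T.2⟩
  have hg : Function.Injective g := fun T T' h =>
    Subtype.ext (prod_asIdeal_injective (congrArg Subtype.val h))
  have := Finite.of_injective g hg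
  have := Fintype.ofFinite
    {T : Finset (HeightOneSpectrum (𝓞 K)) // Ideal.absNorm (∏ v ∈ T, v.asIdeal) = n}
  have h1 := Nat.card_le_card_of_injective g hg
  rw [moebiusCoeff, tsum_fintype]
  refine (Finset.abs_sum_le_sum_abs _ _).trans ?_
  simp only [abs_pow, abs_neg, abs_one, one_pow, Finset.sum_const, nsmul_eq_mul, mul_one,
    Finset.card_univ]
  rw [Nat.card_eq_fintype_card] at h1
  exact_mod_cast h1

theorem hasSum_moebiusCoeff {s z : ℂ} (hs : s ≠ 0) (h : HasSum (normCpow K s hs) z) :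
    HasSum (fun n : ℕ => (moebiusCoeff K n : ℂ) * (n : ℂ) ^ (-s)) z⁻¹ := by
  have h1 := hasSum_moebius _ h
  have h2 := h1.tsum_fiberwise
    fun T : Finset (HeightOneSpectrum (𝓞 K)) => Ideal.absNorm (∏ v ∈ T, v.asIdeal)
  refine h2.congr_fun fun n => ?_
  rw [moebiusCoeff, Complex.ofReal_tsum, ← tsum_mul_right]
  refine tsum_congr fun T => ?_
  have hT : Ideal.absNorm (∏ v ∈ T.1, v.asIdeal) = n := T.2
  change _ = (-1) ^ T.1.card * ((Ideal.absNorm (∏ v ∈ T.1, v.asIdeal) : ℕ) : ℂ) ^ (-s)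
  rw [hT]
  push_cast
  rfl

theorem lSeriesHasSum_of_hasSum {b : ℕ → ℂ} {s z : ℂ} (hs : s ≠ 0)
    (h : HasSum (fun m : ℕ => b m * (m : ℂ) ^ (-s)) z) : LSeriesHasSum b s z :=
  h.congr_fun fun m => by
    rw [LSeries.term_of_ne_zero' hs, Complex.cpow_neg, div_eq_mul_inv]

theorem eq_moebiusCoeff {ζK : ℂ → ℂ} (hζ_ser : ∀ s : ℂ, 1 < s.re →
      HasSum (fun I : {I : Ideal (𝓞 K) // I ≠ ⊥} =>
        ((Ideal.absNorm I.1 : ℕ) : ℂ) ^ (-s)) (ζK s)) {b : ℕ → ℝ}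
    (hb : ∀ s : ℂ, 1 < s.re → HasSum (fun m : ℕ => (b m : ℂ) * (m : ℂ) ^ (-s)) (ζK s)⁻¹)
    {n : ℕ} (hn : n ≠ 0) : b n = moebiusCoeff K n := by
  have h0 : ∀ s : ℂ, 1 < s.re → s ≠ 0 := by
    rintro s hs rfl
    simp at hs
    linarith
  have h1 : ∀ s : ℂ, 1 < s.re → LSeriesHasSum (fun m => (b m : ℂ)) s (ζK s)⁻¹ := fun s hs =>
    lSeriesHasSum_of_hasSum (h0 s hs) (hb s hs)
  have h2 : ∀ s : ℂ, 1 < s.re → LSeriesHasSum (fun m => (moebiusCoeff K m : ℂ)) s (ζK s)⁻¹ :=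
    fun s hs => lSeriesHasSum_of_hasSum (h0 s hs)
      (hasSum_moebiusCoeff (h0 s hs) (hasSum_normCpow (h0 s hs) (hζ_ser s hs)))
  have h3 : ∀ {f : ℕ → ℂ}, (∀ s : ℂ, 1 < s.re → LSeriesHasSum f s (ζK s)⁻¹) →
      LSeries.abscissaOfAbsConv f < ⊤ := fun h =>
    (h 2 (by norm_num)).LSeriesSummable.abscissaOfAbsConv_le.trans_lt (EReal.coe_lt_top _)
  have h4 := LSeries.eq_of_LSeries_eventually_eq (h3 h1) (h3 h2) ?_ hn
  · exact_mod_cast h4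
  · filter_upwards [eventually_gt_atTop 1] with x hx
    rw [(h1 x (by simpa using hx)).LSeries_eq, (h2 x (by simpa using hx)).LSeries_eq]

theorem exists_abs_coeff_le {ζK : ℂ → ℂ} (hζ_ser : ∀ s : ℂ, 1 < s.re →
      HasSum (fun I : {I : Ideal (𝓞 K) // I ≠ ⊥} =>
        ((Ideal.absNorm I.1 : ℕ) : ℂ) ^ (-s)) (ζK s)) {b : ℕ → ℝ}
    (hb : ∀ s : ℂ, 1 < s.re → HasSum (fun m : ℕ => (b m : ℂ) * (m : ℂ) ^ (-s)) (ζK s)⁻¹)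
    {ε : ℝ} (hε : 0 < ε) : ∃ C : ℝ, 0 ≤ C ∧ ∀ n : ℕ, n ≠ 0 → |b n| ≤ C * (n : ℝ) ^ ε := by
  obtain ⟨C, hC0, hC⟩ := exists_card_absNorm_eq_le K hε
  refine ⟨C, hC0, fun n hn => ?_⟩
  rw [eq_moebiusCoeff hζ_ser hb hn]
  exact (abs_moebiusCoeff_le n).trans (hC n hn)

theorem ne_zero_of_one_lt_re {ζK : ℂ → ℂ} (hζ_ser : ∀ s : ℂ, 1 < s.re →
      HasSum (fun I : {I : Ideal (𝓞 K) // I ≠ ⊥} =>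
        ((Ideal.absNorm I.1 : ℕ) : ℂ) ^ (-s)) (ζK s)) {s : ℂ} (hs : 1 < s.re) : ζK s ≠ 0 := by
  have h0 : s ≠ 0 := by
    rintro rfl
    simp at hs
    linarith
  exact ne_zero_of_hasSum _ (hasSum_normCpow h0 (hζ_ser s hs))

end IdealEuler

namespace IdealEuler

open IsDedekindDomain Filter Topology Set NumberField Complex

theorem re_log_comb_nonneg {a : ℝ} (ha₀ : 0 ≤ a) (ha₁ : a < 1) {z : ℂ} (hz : ‖z‖ = 1) :
    0 ≤ 3 * (-log (1 - a)).re + 4 * (-log (1 - a * z)).re + (-log (1 - a * z ^ 2)).re := by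
  have hac₀ : ‖(a : ℂ)‖ < 1 := by
    simp only [Complex.norm_of_nonneg ha₀, ha₁]
  have hac₁ : ‖a * z‖ < 1 := by rwa [norm_mul, hz, mul_one]
  have hac₂ : ‖a * z ^ 2‖ < 1 := by rwa [norm_mul, norm_pow, hz, one_pow, mul_one]
  rw [← ((hasSum_re <| hasSum_taylorSeries_neg_log hac₀).mul_left 3).add
    ((hasSum_re <| hasSum_taylorSeries_neg_log hac₁).mul_left 4) |>.add
    (hasSum_re <| hasSum_taylorSeries_neg_log hac₂) |>.tsum_eq]
  refine tsum_nonneg fun n ↦ ?_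
  simp only [← ofReal_pow, div_natCast_re, ofReal_re, mul_pow, mul_re, ofReal_im, zero_mul,
    sub_zero]
  rcases n.eq_zero_or_pos with rfl | hn
  · simp
  · simp only [← mul_div_assoc, ← add_div]
    refine div_nonneg ?_ n.cast_nonneg
    rw [← pow_mul, pow_mul', sq, mul_re, ← sq, ← sq, ← sq_norm_sub_sq_re, norm_pow, hz]
    convert! (show 0 ≤ 2 * a ^ n * ((z ^ n).re + 1) ^ 2 by positivity) using 1
    ring

theorem norm_comb_le_one {a : ℝ} (ha₀ : 0 ≤ a) (ha₁ : a < 1) {z : ℂ} (hz : ‖z‖ = 1) :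
    ‖1 - (a : ℂ)‖ ^ 3 * ‖1 - a * z‖ ^ 4 * ‖1 - a * z ^ 2‖ ≤ 1 := by
  have hpos : ∀ w : ℂ, ‖w‖ = 1 → 0 < ‖1 - a * w‖ := by
    intro w hw
    rw [norm_pos_iff, sub_ne_zero]
    intro h
    have := congrArg norm h
    rw [norm_one, norm_mul, hw, mul_one, Complex.norm_of_nonneg ha₀] at this
    linarith
  have h0 : 0 < ‖1 - (a : ℂ)‖ := by simpa using hpos 1 norm_one
  have h1 := hpos z hz
  have h2 := hpos (z ^ 2) (by rw [norm_pow, hz, one_pow])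
  have h := re_log_comb_nonneg ha₀ ha₁ hz
  simp only [neg_re, log_re] at h
  rw [← Real.log_nonpos_iff (by positivity), Real.log_mul (by positivity) h2.ne',
    Real.log_mul (by positivity) (by positivity), Real.log_pow, Real.log_pow]
  push_cast
  linarith

variable {K : Type*} [Field K] [NumberField K]

theorem one_le_norm_comb {ζK : ℂ → ℂ} (hζ_ser : ∀ s : ℂ, 1 < s.re →
      HasSum (fun I : {I : Ideal (𝓞 K) // I ≠ ⊥} =>
        ((Ideal.absNorm I.1 : ℕ) : ℂ) ^ (-s)) (ζK s)) {σ : ℝ} (hσ : 1 < σ) (t : ℝ) :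
    1 ≤ ‖ζK σ‖ ^ 3 * ‖ζK (σ + t * I)‖ ^ 4 * ‖ζK (σ + 2 * t * I)‖ := by
  have hre : ∀ u : ℝ, 1 < ((σ : ℂ) + u * I).re := fun u => by simpa using hσ
  have hne : ∀ u : ℝ, (σ : ℂ) + u * I ≠ 0 := fun u h => by
    have := hre u
    rw [h] at this
    simp at this
    linarith
  have hprod : ∀ u : ℝ, Tendsto (fun T : Finset (HeightOneSpectrum (𝓞 K)) =>
      ∏ v ∈ T, ‖1 - (Ideal.absNorm v.asIdeal : ℂ) ^ (-(σ + u * I : ℂ))‖) atTop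
      (𝓝 ‖ζK (σ + u * I)‖⁻¹) := by
    intro u
    have h1 := hasProd_one_sub _ (hasSum_normCpow (hne u) (hζ_ser _ (hre u)))
    have h2 := (show Tendsto _ _ _ from h1).norm
    rw [norm_inv] at h2
    refine h2.congr fun T => ?_
    rw [norm_prod]
    rfl
  have h1 := (((hprod 0).pow 3).mul ((hprod t).pow 4)).mul (hprod (2 * t))
  have h2 := le_of_tendsto h1 (b := 1) (Eventually.of_forall fun T => ?_)
  · have hpos : ∀ u : ℝ, 0 < ‖ζK (σ + u * I)‖ := fun u =>
      norm_pos_iff.mpr (ne_zero_of_one_lt_re hζ_ser (hre u))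
    rw [inv_pow, inv_pow, ← mul_inv, ← mul_inv] at h2
    have h3 := (inv_le_one₀ (by have := hpos 0; have := hpos t; have := hpos (2 * t); positivity)).mp
      h2
    simpa using h3
  · rw [← Finset.prod_pow, ← Finset.prod_pow, ← Finset.prod_mul_distrib, ← Finset.prod_mul_distrib]
    refine Finset.prod_le_one (fun _ _ => by positivity) fun v _ => ?_
    have h2 : 1 < Ideal.absNorm v.asIdeal := by
      have h0 : Ideal.absNorm v.asIdeal ≠ 0 := fun h => v.ne_bot (Ideal.absNorm_eq_zero_iff.mp h)
      have h1 : Ideal.absNorm v.asIdeal ≠ 1 := fun h => v.isPrime.ne_top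
        (Ideal.absNorm_eq_one_iff.mp h)
      omega
    set N : ℕ := Ideal.absNorm v.asIdeal with hN
    have hN0 : (0 : ℝ) < N := by exact_mod_cast (zero_lt_one.trans h2)
    have hN0' : (N : ℂ) ≠ 0 := by exact_mod_cast hN0.ne'
    have h3 : ∀ u : ℝ, (N : ℂ) ^ (-(σ + u * I : ℂ)) =
        ((N : ℝ) ^ (-σ) : ℝ) * (N : ℂ) ^ (-(u * I : ℂ)) := by
      intro u
      rw [Complex.ofReal_cpow hN0.le, neg_add, Complex.cpow_add _ _ hN0']
      simp
    rw [h3, h3, h3]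
    have h4 : (N : ℂ) ^ (-((2 * t : ℝ) * I : ℂ)) = ((N : ℂ) ^ (-(t * I : ℂ))) ^ 2 := by
      rw [← Complex.cpow_nat_mul]
      congr 1
      push_cast
      ring
    rw [h4]
    have h5 := norm_comb_le_one (a := (N : ℝ) ^ (-σ)) (by positivity)
      (Real.rpow_lt_one_of_one_lt_of_neg (by exact_mod_cast h2) (by linarith))
      (z := (N : ℂ) ^ (-(t * I : ℂ))) (by
        rw [← Complex.ofReal_natCast, Complex.norm_cpow_eq_rpow_re_of_pos hN0]
        simp)
    simpa using h5

theorem ne_zero_of_re_eq_one {ζK : ℂ → ℂ} (hζ_an : ∀ s : ℂ, s ≠ 1 → DifferentiableAt ℂ ζK s)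
    (hζ_ser : ∀ s : ℂ, 1 < s.re →
      HasSum (fun I : {I : Ideal (𝓞 K) // I ≠ ⊥} =>
        ((Ideal.absNorm I.1 : ℕ) : ℂ) ^ (-s)) (ζK s)) {A : ℂ}
    (hA : Tendsto (fun s : ℂ => (s - 1) * ζK s) (𝓝[≠] 1) (𝓝 A)) {t : ℝ} (ht : t ≠ 0) :
    ζK (1 + t * I) ≠ 0 := by
  intro h0
  have hu : Tendsto (fun u : ℝ => (u : ℂ)) (𝓝[>] 0) (𝓝 0) :=
    (Complex.continuous_ofReal.tendsto' 0 0 (by simp)).mono_left nhdsWithin_le_nhds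
  have hu' : Tendsto (fun u : ℝ => (u : ℂ)) (𝓝[>] 0) (𝓝[≠] 0) := by
    refine tendsto_nhdsWithin_iff.mpr ⟨hu, ?_⟩
    filter_upwards [self_mem_nhdsWithin] with u hu
    simpa using (mem_Ioi.mp hu).ne'
  have h1 : Tendsto (fun u : ℝ => (u : ℂ) * ζK (1 + u)) (𝓝[>] 0) (𝓝 A) := by
    have : Tendsto (fun u : ℝ => (1 + u : ℂ)) (𝓝[>] 0) (𝓝[≠] 1) := by
      refine tendsto_nhdsWithin_iff.mpr ⟨by simpa using hu.const_add 1, ?_⟩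
      filter_upwards [self_mem_nhdsWithin] with u hu
      simpa using (mem_Ioi.mp hu).ne'
    refine (hA.comp this).congr fun u => ?_
    simp
  have hd := (hζ_an (1 + t * I) (by simpa using ht)).hasDerivAt
  have h2 : Tendsto (fun u : ℝ => (u : ℂ)⁻¹ * ζK (1 + u + t * I)) (𝓝[>] 0)
      (𝓝 (deriv ζK (1 + t * I))) := by
    refine ((hasDerivAt_iff_tendsto_slope_zero.mp hd).comp hu').congr fun u => ?_
    simp only [Function.comp_apply, h0, sub_zero, smul_eq_mul]
    ring_nf
  have h3 : Tendsto (fun u : ℝ => ζK (1 + u + 2 * t * I)) (𝓝[>] 0) (𝓝 (ζK (1 + 2 * t * I))) := by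
    have hc := (hζ_an (1 + 2 * t * I) (by simpa using ht)).continuousAt
    refine hc.tendsto.comp ?_
    simpa using! (hu.const_add 1).add_const (2 * t * I : ℂ)
  have h4 := (((h1.norm.pow 3).mul (h2.norm.pow 4)).mul h3.norm).mul hu.norm
  rw [norm_zero, mul_zero] at h4
  have h5 := ge_of_tendsto h4 (b := 1) ?_
  · linarith
  · filter_upwards [self_mem_nhdsWithin] with u hu
    have hu : 0 < u := hu
    have h6 := one_le_norm_comb hζ_ser (σ := 1 + u) (by linarith) t
    push_cast at h6
    refine h6.trans (le_of_eq ?_)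
    rw [norm_mul, norm_mul, norm_inv, Complex.norm_of_nonneg hu.le]
    field_simp

end IdealEuler

namespace LogGrowth

open Metric Filter Topology

theorem exists_eqOn_exp {f : ℂ → ℂ} {R : ℝ} (hR : 0 < R) (hf : DifferentiableOn ℂ f (ball 0 R))
    (h0 : ∀ z ∈ ball (0 : ℂ) R, f z ≠ 0) :
    ∃ g : ℂ → ℂ, DifferentiableOn ℂ g (ball 0 R) ∧ (∀ z ∈ ball (0 : ℂ) R, Complex.exp (g z) = f z) ∧
      ‖g 0‖ ≤ |Real.log ‖f 0‖| + Real.pi := by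
  have h0m : (0 : ℂ) ∈ ball (0 : ℂ) R := mem_ball_self hR
  obtain ⟨g, hg0, hg⟩ := ((hf.deriv isOpen_ball).div hf h0).isExactOn_ball.with_val_at 0
    (Complex.log (f 0))
  have hgd : DifferentiableOn ℂ g (ball 0 R) := fun z hz =>
    (hg z hz).differentiableAt.differentiableWithinAt
  refine ⟨g, hgd, fun z hz => ?_, ?_⟩
  · have h1 : ∀ w ∈ ball (0 : ℂ) R, HasDerivAt (fun w => f w * Complex.exp (-g w)) 0 w := by
      intro w hw
      have h2 := (hf.differentiableAt (isOpen_ball.mem_nhds hw)).hasDerivAt.mul (hg w hw).neg.cexp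
      refine h2.congr_deriv ?_
      have := h0 w hw
      simp only [Pi.div_apply]
      field_simp
      ring
    have h2 := isOpen_ball.is_const_of_deriv_eq_zero (convex_ball _ _).isPreconnected
      (fun w hw => (h1 w hw).differentiableAt.differentiableWithinAt)
      (fun w hw => (h1 w hw).deriv) hz h0m
    rw [hg0, Complex.exp_neg, Complex.exp_neg, Complex.exp_log (h0 0 h0m),
      mul_inv_cancel₀ (h0 0 h0m), mul_inv_eq_one₀ (Complex.exp_ne_zero _)] at h2
    exact h2.symm
  · rw [hg0]
    refine (Complex.norm_le_abs_re_add_abs_im _).trans ?_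
    rw [Complex.log_re, Complex.log_im]
    gcongr
    exact Complex.abs_arg_le_pi _

theorem norm_le_of_norm_le_sphere {f : ℂ → ℂ} {r ρ R R' A B : ℝ} (hr : 0 < r) (hrR : r < R')
    (hρ : 0 ≤ ρ) (hρR : ρ < R) (hRR : R < R') (hf : DifferentiableOn ℂ f (ball 0 R'))
    (hA : ∀ z ∈ sphere (0 : ℂ) r, ‖f z‖ ≤ A) (hB : ∀ z ∈ sphere (0 : ℂ) R, ‖f z‖ ≤ B) (n : ℕ)
    {z : ℂ} (hz : ‖z‖ ≤ ρ) :
    ‖f z‖ ≤ A * ∑ k ∈ Finset.range n, (ρ / r) ^ k + B * ((ρ / R) ^ n * (1 - ρ / R)⁻¹) := by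
  have hR : 0 < R := hρ.trans_lt hρR
  have hcl : ∀ {x : ℝ}, 0 < x → x < R' → DiffContOnCl ℂ f (ball 0 x) := fun hx hx' =>
    (hf.mono ((closure_ball (0 : ℂ) hx.ne').le.trans (closedBall_subset_ball hx'))).diffContOnCl
  have hA' : ∀ k, ‖iteratedDeriv k f 0‖ ≤ k.factorial * A / r ^ k := fun k =>
    Complex.norm_iteratedDeriv_le_of_forall_mem_sphere_norm_le k hr (hcl hr hrR) hA
  have hB' : ∀ k, ‖iteratedDeriv k f 0‖ ≤ k.factorial * B / R ^ k := fun k =>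
    Complex.norm_iteratedDeriv_le_of_forall_mem_sphere_norm_le k hR (hcl hR hRR) hB
  have hA0 : 0 ≤ A := (norm_nonneg _).trans (hA r (by simp [abs_of_pos hr]))
  have hB0 : 0 ≤ B := (norm_nonneg _).trans (hB R (by simp [abs_of_pos hR]))
  have hs := Complex.hasSum_taylorSeries_on_ball hf
    (show z ∈ ball (0 : ℂ) R' by rw [mem_ball_zero_iff]; linarith)
  set a : ℕ → ℂ := fun k => (k.factorial : ℂ)⁻¹ • (z - 0) ^ k • iteratedDeriv k f 0 with ha
  have hnorm : ∀ (k : ℕ) (x D : ℝ), 0 < x → ‖iteratedDeriv k f 0‖ ≤ k.factorial * D / x ^ k →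
      0 ≤ D → ‖a k‖ ≤ D * (ρ / x) ^ k := by
    intro k x D hx h hD
    rw [ha]
    simp only [sub_zero, smul_eq_mul, norm_mul, norm_inv, norm_pow, Complex.norm_natCast]
    calc (k.factorial : ℝ)⁻¹ * (‖z‖ ^ k * ‖iteratedDeriv k f 0‖)
        ≤ (k.factorial : ℝ)⁻¹ * (ρ ^ k * (k.factorial * D / x ^ k)) := by gcongr
      _ = D * (ρ / x) ^ k := by
        have : (k.factorial : ℝ) ≠ 0 := by positivity
        rw [div_pow]
        field_simp
  have hq : ρ / R < 1 := (div_lt_one hR).mpr hρR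
  have hgeo := (hasSum_geometric_of_lt_one (by positivity) hq).mul_left (B * (ρ / R) ^ n)
  have htail : ‖∑' k, a (k + n)‖ ≤ B * (ρ / R) ^ n * (1 - ρ / R)⁻¹ := by
    refine tsum_of_norm_bounded hgeo fun k => ?_
    refine (hnorm (k + n) R B hR (hB' _) hB0).trans (le_of_eq ?_)
    rw [pow_add]
    ring
  rw [← hs.tsum_eq, ← hs.summable.sum_add_tsum_nat_add n]
  refine (norm_add_le _ _).trans (add_le_add ?_ (htail.trans_eq (by ring)))
  rw [Finset.mul_sum]
  exact norm_sum_le_of_le _ fun k _ => hnorm k r A hr (hA' k) hA0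

/-- If `f` has no zeros on a disc, is bounded above and below near the centre and is at most
`exp M` on the disc, then `1 / f` is at most `exp (C + η * M)` on any smaller disc. -/
theorem exists_norm_inv_le {r ρ R B η : ℝ} (hr : 0 < r) (hrR : r < R) (hρ : 0 ≤ ρ) (hρR : ρ < R)
    (hB : 1 ≤ B) (hη : 0 < η) :
    ∃ C : ℝ, ∀ f : ℂ → ℂ, DifferentiableOn ℂ f (ball 0 R) → (∀ z ∈ ball (0 : ℂ) R, f z ≠ 0) →
      ‖(f 0)⁻¹‖ ≤ B → (∀ z ∈ ball (0 : ℂ) r, ‖f z‖ ≤ B) → ∀ M : ℝ, 0 ≤ M →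
      (∀ z ∈ ball (0 : ℂ) R, ‖f z‖ ≤ Real.exp M) →
      ∀ z : ℂ, ‖z‖ ≤ ρ → ‖(f z)⁻¹‖ ≤ Real.exp (C + η * M) := by
  have hR : 0 < R := hr.trans hrR
  set R₂ := (ρ + R) / 2 with hR₂
  have h1 : ρ < R₂ := by linarith
  have h2 : R₂ < R := by linarith
  have hR₂0 : 0 < R₂ := hρ.trans_lt h1
  set L := 2 * R₂ / (R - R₂) with hL
  set G := Real.log B + Real.pi with hG
  set L' := G * (R + R₂) / (R - R₂) with hL'
  have hL0 : 0 < L := div_pos (by linarith) (by linarith)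
  have hlB : 0 ≤ Real.log B := Real.log_nonneg hB
  set A := 2 * (Real.log B + 1) * (r / 2) / (r - r / 2) + G * (r + r / 2) / (r - r / 2) with hA
  have hlim : Tendsto (fun n : ℕ => L * ((ρ / R₂) ^ n * (1 - ρ / R₂)⁻¹)) atTop (𝓝 0) := by
    have := ((tendsto_pow_atTop_nhds_zero_of_lt_one (by positivity)
      ((div_lt_one hR₂0).mpr h1)).mul_const (1 - ρ / R₂)⁻¹).const_mul L
    simpa using this
  obtain ⟨n, hn⟩ := (hlim.eventually (gt_mem_nhds hη)).exists
  set q := (ρ / R₂) ^ n * (1 - ρ / R₂)⁻¹ with hq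
  refine ⟨A * ∑ k ∈ Finset.range n, (ρ / (r / 2)) ^ k + (L + L') * q,
    fun f hf hf0 hfi hfr M hM hfM z hz => ?_⟩
  obtain ⟨g, hg, hgf, hg0⟩ := exists_eqOn_exp hR hf hf0
  have hre : ∀ w ∈ ball (0 : ℂ) R, (g w).re = Real.log ‖f w‖ := fun w hw => by
    rw [← hgf w hw, Complex.norm_exp, Real.log_exp]
  have h0 : ‖g 0‖ ≤ G := by
    refine hg0.trans (add_le_add_left (abs_le.mpr ⟨?_, ?_⟩) _)
    · have := Real.log_le_log (norm_pos_iff.mpr (inv_ne_zero (hf0 0 (mem_ball_self hR)))) hfi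
      rw [norm_inv, Real.log_inv] at this
      linarith
    · exact Real.log_le_log (norm_pos_iff.mpr (hf0 0 (mem_ball_self hR)))
        (hfr 0 (mem_ball_self hr))
  have hbc : ∀ {x y D : ℝ}, 0 < x → x < y → y ≤ R → 0 < D → (∀ w ∈ ball (0 : ℂ) y, (g w).re ≤ D) →
      ∀ w ∈ sphere (0 : ℂ) x, ‖g w‖ ≤ 2 * D * x / (y - x) + G * (y + x) / (y - x) := by
    intro x y D hx hxy hyR hD hre w hw
    rw [mem_sphere_zero_iff_norm] at hw
    have := Complex.borelCaratheodory hD (hg.mono (ball_subset_ball hyR)) hre (hx.trans hxy)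
      (z := w) (by rw [mem_ball_zero_iff, hw]; exact hxy)
    rw [hw] at this
    have hyx : 0 < y - x := sub_pos.mpr hxy
    refine this.trans ?_
    have hy : 0 ≤ y := by linarith
    gcongr
  have hgA := hbc (x := r / 2) (y := r) (D := Real.log B + 1) (by linarith) (by linarith) hrR.le
    (by linarith) fun w hw => by
      have hw' := ball_subset_ball hrR.le hw
      rw [hre w hw']
      linarith [Real.log_le_log (norm_pos_iff.mpr (hf0 w hw')) (hfr w hw)]
  have hgB := hbc (x := R₂) (y := R) (D := M + 1) hR₂0 h2 le_rfl (by linarith) fun w hw => by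
      rw [hre w hw]
      have := Real.log_le_log (norm_pos_iff.mpr (hf0 w hw)) (hfM w hw)
      rw [Real.log_exp] at this
      linarith
  have hfin := norm_le_of_norm_le_sphere (by linarith) (by linarith) hρ h1 h2 hg hgA hgB n hz
  have hzR : z ∈ ball (0 : ℂ) R := by
    rw [mem_ball_zero_iff]
    linarith
  rw [← hgf z hzR, ← Complex.exp_neg, Complex.norm_exp, Complex.neg_re, Real.exp_le_exp]
  refine (neg_le_abs _).trans ((Complex.abs_re_le_norm _).trans (hfin.trans ?_))
  rw [← hA, ← hL', ← hq]
  have h3 : 2 * (M + 1) * R₂ / (R - R₂) = L * (M + 1) := by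
    rw [hL]
    ring
  rw [h3]
  have h4 : L * q * M ≤ η * M := mul_le_mul_of_nonneg_right hn.le hM
  linarith

end LogGrowth

namespace LogGrowth

open Metric Filter Topology

theorem exists_norm_le_of_hasSum {ι : Type*} {c : ι → ℂ} {n : ι → ℕ} {F : ℂ → ℂ}
    (hF : ∀ s : ℂ, 1 < s.re → HasSum (fun i => c i * (n i : ℂ) ^ (-s)) (F s)) {σ : ℝ}
    (hσ : 1 < σ) : ∃ B : ℝ, ∀ s : ℂ, σ ≤ s.re → ‖F s‖ ≤ B := by
  have h1 := (hF σ (by simpa using hσ)).summable.norm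
  refine ⟨∑' i, ‖c i * (n i : ℂ) ^ (-(σ : ℂ))‖, fun s hs => ?_⟩
  rw [← (hF s (hσ.trans_le hs)).tsum_eq]
  refine tsum_of_norm_bounded h1.hasSum fun i => ?_
  rw [norm_mul, norm_mul]
  refine mul_le_mul_of_nonneg_left ?_ (norm_nonneg _)
  rcases Nat.eq_zero_or_pos (n i) with h | h
  · have : s ≠ 0 := by
      rintro rfl
      simp at hs
      linarith
    rw [h, Nat.cast_zero, Complex.zero_cpow (neg_ne_zero.mpr this), norm_zero]
    positivity
  · rw [Complex.norm_natCast_cpow_of_pos h, Complex.norm_natCast_cpow_of_pos h]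
    refine Real.rpow_le_rpow_of_exponent_le (by exact_mod_cast h) ?_
    simpa using hs

theorem exists_norm_inv_le_rpow {Z : ℂ → ℂ} (hZ_an : ∀ s : ℂ, s ≠ 1 → DifferentiableAt ℂ Z s)
    (hZ0 : ∀ s : ℂ, 1 / 2 < s.re → s ≠ 1 → Z s ≠ 0) {r : ℕ} {C : ℝ} (hC0 : 0 ≤ C)
    (hC : ∀ σ t : ℝ, 1 / 4 ≤ σ → σ ≤ 4 → 1 ≤ |t| → ‖Z (σ + t * Complex.I)‖ ≤ C * |t| ^ r)
    {B : ℝ} (hB1 : ∀ s : ℂ, 5 / 4 ≤ s.re → ‖Z s‖ ≤ B)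
    (hB2 : ∀ s : ℂ, 5 / 4 ≤ s.re → ‖(Z s)⁻¹‖ ≤ B) {σ₀ η : ℝ} (hσ₀ : 1 / 2 < σ₀) (hσ₂ : σ₀ ≤ 2)
    (hη : 0 < η) :
    ∃ C' : ℝ, 0 ≤ C' ∧ ∀ s : ℂ, σ₀ ≤ s.re → 3 ≤ |s.im| → ‖(Z s)⁻¹‖ ≤ C' * |s.im| ^ η := by
  set B' := max B 1 with hB'
  obtain ⟨D, hD⟩ := exists_norm_inv_le (r := 3 / 4) (ρ := 2 - σ₀) (R := 3 / 2) (B := B')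
    (η := η / (r + 1)) (by norm_num) (by norm_num) (by linarith) (by linarith) (le_max_right _ _)
    (by positivity)
  set E := D + η / (r + 1) * (Real.log (C + 1) + r * Real.log 2) with hE
  refine ⟨max (Real.exp E) B', (Real.exp_pos _).le.trans (le_max_left _ _), fun s hs ht => ?_⟩
  have ht1 : 1 ≤ |s.im| := by linarith
  rcases le_total s.re 2 with h2 | h2
  · set t := s.im with ht_def
    have hmem : ∀ w ∈ ball (0 : ℂ) (3 / 2), 1 / 2 < (2 + t * Complex.I + w).re ∧
        (2 + t * Complex.I + w).re ≤ 4 ∧ 1 ≤ |(2 + t * Complex.I + w).im| ∧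
        |(2 + t * Complex.I + w).im| ≤ 2 * |t| := by
      intro w hw
      rw [mem_ball_zero_iff] at hw
      have h1 := abs_le.mp ((Complex.abs_re_le_norm w).trans hw.le)
      have h1' := abs_lt.mp ((Complex.abs_re_le_norm w).trans_lt hw)
      have h3 := (Complex.abs_im_le_norm w).trans hw.le
      have e1 : (2 + t * Complex.I + w).re = 2 + w.re := by simp
      have e2 : (2 + t * Complex.I + w).im = t + w.im := by simp
      rw [e1, e2]
      have h4 := abs_add_le t w.im
      have h5 : |t| ≤ |t + w.im| + |w.im| := by
        have := abs_sub (t + w.im) w.im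
        rwa [add_sub_cancel_right] at this
      exact ⟨by linarith, by linarith, by linarith, by linarith⟩
    have hne : ∀ w ∈ ball (0 : ℂ) (3 / 2), 2 + t * Complex.I + w ≠ 1 := by
      intro w hw h
      have := (hmem w hw).2.2.1
      rw [h] at this
      norm_num at this
    have hball : ∀ w ∈ ball (0 : ℂ) (3 / 4), 5 / 4 ≤ (2 + t * Complex.I + w).re := by
      intro w hw
      rw [mem_ball_zero_iff] at hw
      have h1 := abs_le.mp ((Complex.abs_re_le_norm w).trans hw.le)
      simp
      linarith
    have hM : 0 ≤ Real.log (C + 1) + r * Real.log (2 * |t|) := by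
      have := Real.log_nonneg (show (1 : ℝ) ≤ C + 1 by linarith)
      have := Real.log_nonneg (show (1 : ℝ) ≤ 2 * |t| by linarith)
      positivity
    have key := hD (fun w => Z (2 + t * Complex.I + w)) ?_ ?_ ?_ ?_
      (Real.log (C + 1) + r * Real.log (2 * |t|)) hM ?_ (s.re - 2) ?_
    · have h6 : 2 + t * Complex.I + (s.re - 2) = s := by
        apply Complex.ext <;> simp [ht_def]
      simp only [h6] at key
      refine key.trans ?_
      have h7 : Real.log (2 * |t|) = Real.log 2 + Real.log |t| :=
        Real.log_mul two_ne_zero (by linarith)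
      have hlt : 0 ≤ Real.log |t| := Real.log_nonneg ht1
      have h8 : η / (r + 1) * r ≤ η := by
        rw [div_mul_eq_mul_div, div_le_iff₀ (by positivity)]
        nlinarith
      calc _ ≤ Real.exp (E + η * Real.log |t|) := by
            rw [Real.exp_le_exp, hE, h7]
            have := mul_le_mul_of_nonneg_right h8 hlt
            linarith
        _ = Real.exp E * |t| ^ η := by
            rw [Real.exp_add, Real.rpow_def_of_pos (by linarith), mul_comm η]
        _ ≤ _ := by
            gcongr
            exact le_max_left _ _
    · intro w hw
      refine DifferentiableAt.differentiableWithinAt ?_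
      exact (hZ_an _ (hne w hw)).comp w (by fun_prop)
    · exact fun w hw => hZ0 _ (hmem w hw).1 (hne w hw)
    · exact (hB2 _ (hball 0 (mem_ball_self (by norm_num)))).trans (le_max_left _ _)
    · exact fun w hw => (hB1 _ (hball w hw)).trans (le_max_left _ _)
    · intro w hw
      obtain ⟨h3, h4, h5, h6⟩ := hmem w hw
      have h7 := hC _ _ (by linarith) h4 h5
      rw [Complex.re_add_im] at h7
      refine h7.trans ?_
      rw [Real.exp_add, Real.exp_log (by linarith), Real.exp_nat_mul, Real.exp_log (by linarith)]
      gcongr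
      linarith
    · rw [← Complex.ofReal_ofNat, ← Complex.ofReal_sub, Complex.norm_real, Real.norm_eq_abs,
        abs_le]
      constructor <;> linarith
  · refine (hB2 s (by linarith)).trans ((le_max_left _ _).trans ((le_max_right _ _).trans
      (le_mul_of_one_le_right ?_ (Real.one_le_rpow ht1 hη.le))))
    exact zero_le_one.trans ((le_max_right _ _).trans (le_max_right _ _))

end LogGrowth

namespace Perron

open Complex MeasureTheory Set Filter Topology

/-- The Mellin transform of `t ↦ max (1 - t) 0`. -/
theorem hasMellin_max {s : ℂ} (hs : 0 < s.re) :
    HasMellin (fun t : ℝ => ((max (1 - t) 0 : ℝ) : ℂ)) s (s * (s + 1))⁻¹ := by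
  have h1 := hasMellin_one_Ioc hs
  have h2 := hasMellin_cpow_Ioc 1 (s := s) (by simp; linarith)
  have h3 := hasMellin_sub h1.1 h2.1
  rw [h1.2, h2.2] at h3
  have hs0 : s ≠ 0 := by
    rintro rfl
    simp at hs
  have hs1 : s + 1 ≠ 0 := by
    intro h
    have := congrArg re h
    simp at this
    linarith
  have h4 : 1 / s - 1 / (s + 1) = (s * (s + 1))⁻¹ := by
    field_simp
    ring
  rw [h4] at h3
  have h5 : EqOn (fun t : ℝ => (t : ℂ) ^ (s - 1) • (indicator (Ioc 0 1) (fun _ => 1 : ℝ → ℂ) t -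
      indicator (Ioc 0 1) (fun t => (t : ℂ) ^ (1 : ℂ) : ℝ → ℂ) t))
      (fun t : ℝ => (t : ℂ) ^ (s - 1) • ((max (1 - t) 0 : ℝ) : ℂ)) (Ioi 0) := by
    intro t ht
    have ht : 0 < t := ht
    simp only
    congr 1
    rcases le_or_gt t 1 with h | h
    · rw [indicator_of_mem (show t ∈ Ioc (0 : ℝ) 1 from ⟨ht, h⟩),
        indicator_of_mem (show t ∈ Ioc (0 : ℝ) 1 from ⟨ht, h⟩), cpow_one,
        max_eq_left (by linarith)]
      simp
    · rw [indicator_of_notMem (fun h' => h.not_ge h'.2),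
        indicator_of_notMem (fun h' => h.not_ge h'.2), max_eq_right (by linarith)]
      simp
  exact ⟨IntegrableOn.congr_fun h3.1 h5 measurableSet_Ioi,
    (setIntegral_congr_fun measurableSet_Ioi h5).symm.trans h3.2⟩

theorem norm_inv_mul_add_one_le {s : ℂ} (hs : 1 / 2 ≤ s.re) :
    ‖s‖⁻¹ ≤ 4 * (1 + |s.im|)⁻¹ ∧ ‖s + 1‖⁻¹ ≤ 4 * (1 + |s.im|)⁻¹ := by
  have key : ∀ z : ℂ, 1 / 2 ≤ z.re → ‖z‖⁻¹ ≤ 4 * (1 + |z.im|)⁻¹ := by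
    intro z hz
    have h1 := (le_abs_self _).trans (abs_re_le_norm z)
    have h2 := abs_im_le_norm z
    rw [← div_eq_mul_inv, ← one_div, div_le_div_iff₀ (by linarith) (by positivity)]
    linarith
  refine ⟨key s hs, ?_⟩
  have := key (s + 1) (by simp; linarith)
  simpa using this

theorem norm_kernel_le {s : ℂ} (hs : 1 / 2 ≤ s.re) :
    ‖(s * (s + 1))⁻¹‖ ≤ 16 * (1 + |s.im|) ^ (-2 : ℝ) := by
  obtain ⟨h1, h2⟩ := norm_inv_mul_add_one_le hs
  rw [norm_inv, norm_mul, mul_inv, Real.rpow_neg (by positivity), Real.rpow_two]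
  refine (mul_le_mul h1 h2 (by positivity) (by positivity)).trans (le_of_eq ?_)
  rw [pow_two, mul_inv]
  ring

theorem kernel_ne_zero {s : ℂ} (hs : 1 / 2 ≤ s.re) : s * (s + 1) ≠ 0 := by
  refine mul_ne_zero ?_ ?_
  · rintro rfl
    simp at hs
    linarith
  · intro h
    have := congrArg re h
    simp at this
    linarith

theorem continuous_kernel {σ : ℝ} (hσ : 1 / 2 ≤ σ) :
    Continuous fun y : ℝ => (((σ : ℂ) + y * I) * (σ + y * I + 1))⁻¹ :=
  Continuous.inv₀ (by fun_prop) fun y => kernel_ne_zero (by simpa using hσ)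

theorem integrable_kernel {σ : ℝ} (hσ : 1 / 2 ≤ σ) :
    Integrable fun y : ℝ => (((σ : ℂ) + y * I) * (σ + y * I + 1))⁻¹ := by
  refine ((integrable_one_add_norm (E := ℝ) (μ := volume) (r := 2) (by simp)).const_mul 16).mono'
    (continuous_kernel hσ).aestronglyMeasurable (Eventually.of_forall fun y => ?_)
  have := norm_kernel_le (s := σ + y * I) (by simpa using hσ)
  simpa using this

theorem integral_cpow_mul_kernel {σ : ℝ} (hσ : 1 / 2 ≤ σ) {u : ℝ} (hu : 0 < u) :
    ((1 / (2 * Real.pi) : ℝ) : ℂ) * ∫ y : ℝ, (u : ℂ) ^ (-((σ : ℂ) + y * I)) *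
      (((σ : ℂ) + y * I) * (σ + y * I + 1))⁻¹ = ((max (1 - u) 0 : ℝ) : ℂ) := by
  have hm : ∀ y : ℝ, mellin (fun t : ℝ => ((max (1 - t) 0 : ℝ) : ℂ)) (σ + y * I) =
      (((σ : ℂ) + y * I) * (σ + y * I + 1))⁻¹ := fun y =>
    (hasMellin_max (by simp; linarith)).2
  have h1 := mellinInv_mellin_eq σ (fun t : ℝ => ((max (1 - t) 0 : ℝ) : ℂ)) hu
    (hasMellin_max (by simp; linarith)).1
    ((integrable_kernel hσ).congr (Eventually.of_forall fun y => (hm y).symm))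
    (by fun_prop)
  rw [← h1, mellinInv, real_smul]
  congr 1
  refine integral_congr_ae (Eventually.of_forall fun y => ?_)
  simp only [smul_eq_mul, hm]

end Perron

namespace Perron

open Complex MeasureTheory Set Filter Topology

theorem sum_eq_integral {b : ℕ → ℝ} {G : ℂ → ℂ} {σ : ℝ} (hσ : 1 < σ)
    (hG : ∀ y : ℝ, HasSum (fun m : ℕ => (b m : ℂ) * (m : ℂ) ^ (-((σ : ℂ) + y * I)))
      (G (σ + y * I))) {x : ℝ} (hx : 0 < x) :
    ((∑ m ∈ Finset.Icc 1 ⌊x⌋₊, b m * (x - m) : ℝ) : ℂ) =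
      ((1 / (2 * Real.pi) : ℝ) : ℂ) * ∫ y : ℝ, G (σ + y * I) * ((x : ℂ) ^ ((σ : ℂ) + y * I + 1) *
        (((σ : ℂ) + y * I) * (σ + y * I + 1))⁻¹) := by
  have hx0 : (x : ℂ) ≠ 0 := by exact_mod_cast hx.ne'
  have hne : ∀ y : ℝ, -((σ : ℂ) + y * I) ≠ 0 := fun y h => by
    have := congrArg re h
    simp at this
    linarith
  set k : ℝ → ℂ := fun y => (x : ℂ) ^ ((σ : ℂ) + y * I + 1) *
    (((σ : ℂ) + y * I) * (σ + y * I + 1))⁻¹ with hk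
  have hkn : ∀ y, ‖k y‖ = x ^ (σ + 1) * ‖(((σ : ℂ) + y * I) * (σ + y * I + 1))⁻¹‖ := fun y => by
    rw [hk, norm_mul, norm_cpow_eq_rpow_re_of_pos hx]
    simp
  have hkc : Continuous k := by
    refine Continuous.mul ?_ (continuous_kernel (by linarith))
    exact Continuous.const_cpow (by fun_prop) (Or.inl hx0)
  have hki : Integrable k :=
    ((integrable_kernel (by linarith : 1 / 2 ≤ σ)).norm.const_mul (x ^ (σ + 1))).mono'
      hkc.aestronglyMeasurable (Eventually.of_forall fun y => (hkn y).le)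
  have hmn : ∀ (m : ℕ) (y : ℝ), ‖(m : ℂ) ^ (-((σ : ℂ) + y * I))‖ = ‖(m : ℂ) ^ (-(σ : ℂ))‖ := by
    intro m y
    rcases Nat.eq_zero_or_pos m with rfl | hm
    · rw [Nat.cast_zero, zero_cpow (hne y), zero_cpow]
      simpa using hne 0
    · rw [norm_natCast_cpow_of_pos hm, norm_natCast_cpow_of_pos hm]
      simp
  have hmc : ∀ m : ℕ, Continuous fun y : ℝ => (m : ℂ) ^ (-((σ : ℂ) + y * I)) := fun m => by
    rcases Nat.eq_zero_or_pos m with rfl | hm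
    · simp only [Nat.cast_zero, zero_cpow (hne _)]
      exact continuous_const
    · exact Continuous.const_cpow (by fun_prop) (Or.inl (by exact_mod_cast hm.ne'))
  set F : ℕ → ℝ → ℂ := fun m y => (b m : ℂ) * (m : ℂ) ^ (-((σ : ℂ) + y * I)) * k y with hF
  have hFn : ∀ m y, ‖F m y‖ = ‖(b m : ℂ) * (m : ℂ) ^ (-(σ : ℂ))‖ * ‖k y‖ := fun m y => by
    simp only [hF]
    rw [norm_mul, norm_mul (b m : ℂ), norm_mul (b m : ℂ), hmn]
  have hFi : ∀ m, Integrable (F m) := fun m =>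
    (hki.norm.const_mul _).mono' (((hmc m).const_mul _).mul hkc).aestronglyMeasurable
      (Eventually.of_forall fun y => (hFn m y).le)
  have hsum : Summable fun m => ∫ y, ‖F m y‖ := by
    simp only [hFn, integral_const_mul]
    refine Summable.mul_right _ ?_
    simpa using (hG 0).summable.norm
  have h1 := hasSum_integral_of_summable_integral_norm hFi hsum
  have h2 : ∀ y, ∑' m, F m y = G (σ + y * I) * k y := fun y => ((hG y).mul_right _).tsum_eq
  simp only [h2] at h1
  have h3 : ∀ m, ((1 / (2 * Real.pi) : ℝ) : ℂ) * ∫ y, F m y =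
      if m = 0 then 0 else ((b m * max (x - m) 0 : ℝ) : ℂ) := by
    intro m
    split_ifs with hm
    · subst hm
      simp only [hF, Nat.cast_zero, zero_cpow (hne _), mul_zero, zero_mul, integral_zero]
    · have hm0 : (0 : ℝ) < m := by exact_mod_cast Nat.pos_of_ne_zero hm
      have hm0' : (m : ℂ) ≠ 0 := by exact_mod_cast hm
      have h4 := integral_cpow_mul_kernel (σ := σ) (by linarith) (div_pos hm0 hx)
      have h5 : ∀ y, F m y = b m * x * (((m / x : ℝ) : ℂ) ^ (-((σ : ℂ) + y * I)) *
          (((σ : ℂ) + y * I) * (σ + y * I + 1))⁻¹) := by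
        intro y
        have h6 : ((m / x : ℝ) : ℂ) ^ (-((σ : ℂ) + y * I)) =
            (m : ℂ) ^ (-((σ : ℂ) + y * I)) * (x : ℂ) ^ ((σ : ℂ) + y * I) := by
          rw [div_eq_mul_inv, ofReal_mul, mul_cpow_ofReal_nonneg hm0.le (inv_nonneg.mpr hx.le),
            ofReal_natCast, ofReal_inv, inv_cpow, ← cpow_neg, neg_neg]
          rw [arg_ofReal_of_nonneg hx.le]
          exact Real.pi_pos.ne
        rw [h6, hF, hk]
        simp only
        rw [cpow_add _ _ hx0, cpow_one]
        ring
      simp only [h5]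
      rw [integral_const_mul, mul_left_comm, h4, ← ofReal_mul, ← ofReal_mul]
      congr 1
      rw [mul_assoc, mul_max_of_nonneg _ _ hx.le]
      congr 2
      · field_simp
      · simp
  have h4 := h1.mul_left ((1 / (2 * Real.pi) : ℝ) : ℂ)
  simp only [h3] at h4
  refine (hasSum_sum_of_ne_finset_zero (s := Finset.Icc 1 ⌊x⌋₊) ?_).unique h4 |>.symm.trans ?_ |>.symm
  · intro m hm
    split_ifs with h0
    · rfl
    · have : x < m := by
        rw [← Nat.floor_lt hx.le]
        by_contra! h
        exact hm (Finset.mem_Icc.mpr ⟨by omega, h⟩)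
      rw [max_eq_right (by linarith)]
      simp
  · push_cast
    refine Finset.sum_congr rfl fun m hm => ?_
    obtain ⟨hm1, hm2⟩ := Finset.mem_Icc.mp hm
    rw [if_neg (by omega), max_eq_left]
    · push_cast
      rfl
    · rw [sub_nonneg]
      exact (Nat.le_floor_iff hx.le).mp hm2

theorem integral_vertical_eq {f : ℂ → ℂ} {a b D q : ℝ} (hab : a ≤ b) (hq : 1 < q)
    (hf : DifferentiableOn ℂ f {s | a ≤ s.re ∧ s.re ≤ b})
    (hD : ∀ s : ℂ, a ≤ s.re → s.re ≤ b → ‖f s‖ ≤ D * (1 + |s.im|) ^ (-q)) :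
    ∫ y : ℝ, f (a + y * I) = ∫ y : ℝ, f (b + y * I) := by
  have hintg : ∀ σ : ℝ, a ≤ σ → σ ≤ b → Integrable fun y : ℝ => f (σ + y * I) := by
    intro σ h1 h2
    have hc : Continuous fun y : ℝ => f (σ + y * I) := by
      refine hf.continuousOn.comp_continuous (by fun_prop) fun y => ?_
      simpa using ⟨h1, h2⟩
    refine ((integrable_one_add_norm (E := ℝ) (μ := volume) (r := q) (by simpa using hq)).const_mul
      D).mono' hc.aestronglyMeasurable (Eventually.of_forall fun y => ?_)
    simpa using hD (σ + y * I) (by simpa using h1) (by simpa using h2)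
  have hlim : ∀ σ : ℝ, a ≤ σ → σ ≤ b →
      Tendsto (fun T : ℝ => ∫ y in (-T)..T, f (σ + y * I)) atTop (𝓝 (∫ y : ℝ, f (σ + y * I))) :=
    fun σ h1 h2 => intervalIntegral_tendsto_integral (hintg σ h1 h2) tendsto_neg_atTop_atBot
      tendsto_id
  have hhor : ∀ ε : ℝ, |ε| = 1 →
      Tendsto (fun T : ℝ => ∫ x in a..b, f (x + (ε * T : ℝ) * I)) atTop (𝓝 0) := by
    intro ε hε
    have h1 : Tendsto (fun T : ℝ => D * (1 + T) ^ (-q) * |b - a|) atTop (𝓝 0) := by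
      have := (tendsto_rpow_neg_atTop (by linarith : 0 < q)).comp
        (tendsto_atTop_add_const_left atTop (1 : ℝ) tendsto_id)
      simpa using! (this.const_mul D).mul_const |b - a|
    refine squeeze_zero_norm' ?_ h1
    filter_upwards [eventually_ge_atTop 0] with T hT
    refine intervalIntegral.norm_integral_le_of_norm_le_const fun x hx => ?_
    rw [uIoc_of_le hab] at hx
    have := hD (x + (ε * T : ℝ) * I) (by simpa using hx.1.le) (by simpa using hx.2)
    have h2 : |((x : ℂ) + (ε * T : ℝ) * I).im| = T := by
      simp [abs_mul, hε, abs_of_nonneg hT]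
    rwa [h2] at this
  have hrect : ∀ T : ℝ, (∫ x in a..b, f (x + ((-1) * T : ℝ) * I)) -
      (∫ x in a..b, f (x + (1 * T : ℝ) * I)) + I * (∫ y in (-T)..T, f (b + y * I)) -
      I * (∫ y in (-T)..T, f (a + y * I)) = 0 := by
    intro T
    have := Complex.integral_boundary_rect_eq_zero_of_differentiableOn f (a + (-T : ℝ) * I)
      (b + T * I) (hf.mono ?_)
    · simpa using this
    · intro s hs
      have := (mem_reProdIm.mp hs).1
      simp [uIcc_of_le hab] at this
      exact this
  have h := (((hhor (-1) (by simp)).sub (hhor 1 (by simp))).add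
    ((hlim b hab le_rfl).const_mul I)).sub ((hlim a le_rfl hab).const_mul I)
  simp only [hrect] at h
  have h2 := tendsto_nhds_unique tendsto_const_nhds h
  rw [sub_zero, zero_add, eq_comm, sub_eq_zero] at h2
  exact (mul_left_cancel₀ I_ne_zero h2).symm

end Perron

namespace Perron

open Complex MeasureTheory Set Filter Topology

theorem differentiableOn_update_inv {Z : ℂ → ℂ} {A : ℂ} (hZ_an : ∀ s, s ≠ 1 → DifferentiableAt ℂ Z s)
    (hA0 : A ≠ 0) (hA : Tendsto (fun s => (s - 1) * Z s) (𝓝[≠] 1) (𝓝 A))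
    (hZ0 : ∀ s : ℂ, 1 / 2 < s.re → s ≠ 1 → Z s ≠ 0) :
    DifferentiableOn ℂ (Function.update (fun s => (Z s)⁻¹) 1 0) {s : ℂ | 1 / 2 < s.re} := by
  have hop : IsOpen {s : ℂ | 1 / 2 < s.re} := isOpen_lt continuous_const continuous_re
  have h1 : ∀ s : ℂ, 1 / 2 < s.re → s ≠ 1 →
      DifferentiableAt ℂ (Function.update (fun s => (Z s)⁻¹) 1 0) s := by
    intro s hs hs1
    refine ((hZ_an s hs1).inv (hZ0 s hs hs1)).congr_of_eventuallyEq ?_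
    filter_upwards [isOpen_ne.mem_nhds hs1] with z hz
    rw [Function.update_of_ne hz]
    rfl
  intro s hs
  refine DifferentiableAt.differentiableWithinAt ?_
  by_cases hs1 : s = 1
  · subst hs1
    refine (Complex.analyticAt_of_differentiable_on_punctured_nhds_of_continuousAt ?_
      ?_).differentiableAt
    · filter_upwards [self_mem_nhdsWithin, mem_nhdsWithin_of_mem_nhds (hop.mem_nhds hs)] with z hz hz2
      exact h1 z hz2 hz
    · rw [continuousAt_update_same]
      have h2 : Tendsto (fun s : ℂ => (s - 1) * ((s - 1) * Z s)⁻¹) (𝓝[≠] 1) (𝓝 ((1 - 1) * A⁻¹)) :=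
        (((continuous_id.sub continuous_const).tendsto (1 : ℂ)).mono_left nhdsWithin_le_nhds).mul
          (hA.inv₀ hA0)
      rw [sub_self, zero_mul] at h2
      refine h2.congr' ?_
      filter_upwards [self_mem_nhdsWithin] with z hz
      have : z - 1 ≠ 0 := sub_ne_zero.mpr hz
      rw [mul_inv, mul_inv_cancel_left₀ this]
  · exact h1 s hs hs1

theorem exists_norm_le_one_add_rpow {G : ℂ → ℂ} {σ C η : ℝ} (hη : 0 < η)
    (hG : ContinuousOn G {s : ℂ | σ ≤ s.re}) (hC0 : 0 ≤ C)
    (hC : ∀ s : ℂ, σ ≤ s.re → 3 ≤ |s.im| → ‖G s‖ ≤ C * |s.im| ^ η) :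
    ∃ C', 0 ≤ C' ∧ ∀ s : ℂ, σ ≤ s.re → s.re ≤ 2 → ‖G s‖ ≤ C' * (1 + |s.im|) ^ η := by
  have hK : IsCompact (Icc σ 2 ×ℂ Icc (-3) 3) := isCompact_Icc.reProdIm isCompact_Icc
  obtain ⟨B, hB⟩ := hK.exists_bound_of_continuousOn (hG.mono fun s hs => (mem_reProdIm.mp hs).1.1)
  refine ⟨max C B, le_max_of_le_left hC0, fun s h1 h2 => ?_⟩
  have h3 : (1 : ℝ) ≤ (1 + |s.im|) ^ η :=
    Real.one_le_rpow (by linarith [abs_nonneg s.im]) hη.le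
  rcases le_total 3 |s.im| with h | h
  · refine (hC s h1 h).trans ?_
    gcongr
    · exact le_max_left _ _
    · linarith
  · refine (hB s (mem_reProdIm.mpr ⟨⟨h1, h2⟩, abs_le.mp h⟩)).trans ?_
    refine (le_max_right C B).trans (le_mul_of_one_le_right (le_max_of_le_left hC0) h3)

theorem norm_cpow_sub_cpow_le {x h θ : ℝ} (hx : 0 < x) (hh : 0 < h) (hhx : h ≤ x) (hθ0 : 0 ≤ θ)
    (hθ1 : θ ≤ 1) {s : ℂ} (hs : 1 / 2 ≤ s.re) :
    ‖((x + h : ℝ) : ℂ) ^ (s + 1) - (x : ℂ) ^ (s + 1)‖ * ‖(s * (s + 1))⁻¹‖ ≤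
      16 * (2 * x) ^ s.re * h * (4 * x / h) ^ θ * (1 + |s.im|) ^ (-(1 + θ)) := by
  have hw0 : s + 1 ≠ 0 := fun h0 => by
    have := congrArg re h0
    simp at this
    linarith
  have hw : 0 < ‖s + 1‖ := norm_pos_iff.mpr hw0
  have hs0 : 0 ≤ s.re := by linarith
  have hmv : ‖((x + h : ℝ) : ℂ) ^ (s + 1) - (x : ℂ) ^ (s + 1)‖ ≤ ‖s + 1‖ * (2 * x) ^ s.re * h := by
    have := Convex.norm_image_sub_le_of_norm_hasDerivWithin_le (𝕜 := ℝ)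
      (f := fun y : ℝ => (y : ℂ) ^ (s + 1)) (f' := fun y : ℝ => (s + 1) * (y : ℂ) ^ s)
      (s := Icc x (x + h)) (x := x) (y := x + h) (C := ‖s + 1‖ * (2 * x) ^ s.re) ?_ ?_
      (convex_Icc _ _) ⟨le_rfl, by linarith⟩ ⟨by linarith, le_rfl⟩
    · simpa [abs_of_pos hh] using this
    · intro y hy
      have hy0 : y ≠ 0 := (hx.trans_le hy.1).ne'
      have h1 := hasDerivAt_ofReal_cpow_const (r := s + 1) hy0 hw0
      rw [add_sub_cancel_right] at h1
      exact h1.hasDerivWithinAt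
    · intro y hy
      have hy0 : 0 < y := hx.trans_le hy.1
      rw [norm_mul, norm_cpow_eq_rpow_re_of_pos hy0]
      gcongr
      linarith [hy.2]
  have htr : ‖((x + h : ℝ) : ℂ) ^ (s + 1) - (x : ℂ) ^ (s + 1)‖ ≤ 2 * (2 * x) ^ (s.re + 1) := by
    refine (norm_sub_le _ _).trans ?_
    rw [norm_cpow_eq_rpow_re_of_pos (by linarith), norm_cpow_eq_rpow_re_of_pos hx, two_mul]
    simp only [add_re, one_re]
    gcongr <;> linarith
  have hcomb : ‖((x + h : ℝ) : ℂ) ^ (s + 1) - (x : ℂ) ^ (s + 1)‖ ≤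
      ‖s + 1‖ * (2 * x) ^ s.re * h * (4 * x / h * ‖s + 1‖⁻¹) ^ θ := by
    have hu : 0 < 4 * x / h * ‖s + 1‖⁻¹ := by positivity
    rcases le_total 1 (4 * x / h * ‖s + 1‖⁻¹) with h1 | h1
    · exact hmv.trans (le_mul_of_one_le_right (by positivity) (Real.one_le_rpow h1 hθ0))
    · have h2 := Real.rpow_le_rpow_of_exponent_ge hu h1 hθ1
      rw [Real.rpow_one] at h2
      refine htr.trans (le_trans (le_of_eq ?_) (mul_le_mul_of_nonneg_left h2 (by positivity)))
      rw [Real.rpow_add (by positivity), Real.rpow_one]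
      field_simp
      ring
  obtain ⟨hk1, hk2⟩ := norm_inv_mul_add_one_le hs
  have hy : 0 < 1 + |s.im| := by positivity
  have h4 : (4 * x / h * ‖s + 1‖⁻¹) ^ θ ≤ (4 * x / h) ^ θ * (4 * (1 + |s.im|) ^ (-θ)) := by
    rw [Real.mul_rpow (by positivity) (by positivity)]
    gcongr
    calc (‖s + 1‖⁻¹) ^ θ ≤ (4 * (1 + |s.im|)⁻¹) ^ θ := by gcongr
      _ = 4 ^ θ * (1 + |s.im|) ^ (-θ) := by
        rw [Real.mul_rpow (by norm_num) (by positivity), Real.inv_rpow hy.le, Real.rpow_neg hy.le]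
      _ ≤ 4 * (1 + |s.im|) ^ (-θ) := by
        gcongr
        simpa using Real.rpow_le_rpow_of_exponent_le (by norm_num : (1 : ℝ) ≤ 4) hθ1
  calc ‖((x + h : ℝ) : ℂ) ^ (s + 1) - (x : ℂ) ^ (s + 1)‖ * ‖(s * (s + 1))⁻¹‖
      ≤ (‖s + 1‖ * (2 * x) ^ s.re * h * ((4 * x / h) ^ θ * (4 * (1 + |s.im|) ^ (-θ)))) *
        ‖(s * (s + 1))⁻¹‖ := by
        gcongr
        exact hcomb.trans (by gcongr)
    _ = (2 * x) ^ s.re * h * ((4 * x / h) ^ θ * (4 * (1 + |s.im|) ^ (-θ))) * ‖s‖⁻¹ := by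
        rw [norm_inv, norm_mul, mul_inv]
        field_simp
    _ ≤ (2 * x) ^ s.re * h * ((4 * x / h) ^ θ * (4 * (1 + |s.im|) ^ (-θ))) *
        (4 * (1 + |s.im|)⁻¹) := by gcongr
    _ = _ := by
        rw [neg_add, Real.rpow_add hy, Real.rpow_neg_one]
        ring

/-- Short averages of the summatory function, from a bound for the generating function on a
vertical line to the left. -/
theorem exists_abs_smoothed_sub_le {b : ℕ → ℝ} {G : ℂ → ℂ} {σ η C : ℝ} (hσ : 1 / 2 < σ)
    (hσ2 : σ ≤ 2) (hη : 0 < η) (hη4 : η ≤ 1 / 4)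
    (hG : DifferentiableOn ℂ G {s : ℂ | 1 / 2 < s.re}) (hC0 : 0 ≤ C)
    (hC : ∀ s : ℂ, σ ≤ s.re → s.re ≤ 2 → ‖G s‖ ≤ C * (1 + |s.im|) ^ η)
    (hb : ∀ s : ℂ, 1 < s.re → HasSum (fun m : ℕ => (b m : ℂ) * (m : ℂ) ^ (-s)) (G s)) :
    ∃ D, 0 ≤ D ∧ ∀ x : ℝ, 1 ≤ x →
      |∑ m ∈ Finset.Icc 1 ⌊x + √x⌋₊, b m * (x + √x - m) - ∑ m ∈ Finset.Icc 1 ⌊x⌋₊, b m * (x - m)| ≤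
        D * √x * x ^ (σ + η) := by
  have hdom : ∀ x : ℝ, 0 < x → ∀ s : ℂ, σ ≤ s.re → s.re ≤ 2 →
      ‖G s * ((x : ℂ) ^ (s + 1) * (s * (s + 1))⁻¹)‖ ≤
        (C * (max 1 x) ^ (3 : ℝ) * 16) * (1 + |s.im|) ^ (-(2 - η)) := by
    intro x hx s h1 h2
    have hy : 0 < 1 + |s.im| := by positivity
    rw [norm_mul, norm_mul, norm_cpow_eq_rpow_re_of_pos hx]
    have h3 : x ^ (s + 1).re ≤ (max 1 x) ^ (3 : ℝ) :=
      (Real.rpow_le_rpow hx.le (le_max_right 1 x) (by simp; linarith)).trans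
        (Real.rpow_le_rpow_of_exponent_le (le_max_left 1 x) (by simp; linarith))
    calc ‖G s‖ * (x ^ (s + 1).re * ‖(s * (s + 1))⁻¹‖)
        ≤ (C * (1 + |s.im|) ^ η) * ((max 1 x) ^ (3 : ℝ) * (16 * (1 + |s.im|) ^ (-2 : ℝ))) := by
          gcongr
          · exact hC s h1 h2
          · exact norm_kernel_le (by linarith)
      _ = _ := by
          rw [show -(2 - η) = η + -2 by ring, Real.rpow_add hy]
          ring
  have hdiff : ∀ x : ℝ, 0 < x → DifferentiableOn ℂ
      (fun s => G s * ((x : ℂ) ^ (s + 1) * (s * (s + 1))⁻¹)) {s : ℂ | σ ≤ s.re ∧ s.re ≤ 2} := by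
    intro x hx s hs
    have hs1 : 1 / 2 < s.re := hσ.trans_le hs.1
    have h0 : s * (s + 1) ≠ 0 := kernel_ne_zero (by linarith)
    have hx0 : (x : ℂ) ≠ 0 := by exact_mod_cast hx.ne'
    refine ((hG s hs1).mono fun z hz => hσ.trans_le hz.1).mul
      (DifferentiableAt.differentiableWithinAt ?_)
    refine DifferentiableAt.mul ?_ (DifferentiableAt.inv (by fun_prop) h0)
    exact DifferentiableAt.const_cpow (by fun_prop) (Or.inl hx0)
  have hform : ∀ x : ℝ, 0 < x → ((∑ m ∈ Finset.Icc 1 ⌊x⌋₊, b m * (x - m) : ℝ) : ℂ) =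
      ((1 / (2 * Real.pi) : ℝ) : ℂ) * ∫ y : ℝ, G (σ + y * I) * ((x : ℂ) ^ ((σ : ℂ) + y * I + 1) *
        (((σ : ℂ) + y * I) * (σ + y * I + 1))⁻¹) := by
    intro x hx
    rw [sum_eq_integral (G := G) (by norm_num : (1 : ℝ) < 2) (fun y => hb _ (by simp)) hx,
      integral_vertical_eq hσ2 (by linarith : 1 < 2 - η) (hdiff x hx) (hdom x hx)]
  have hintg : ∀ x : ℝ, 0 < x → Integrable fun y : ℝ => G (σ + y * I) *
      ((x : ℂ) ^ ((σ : ℂ) + y * I + 1) * (((σ : ℂ) + y * I) * (σ + y * I + 1))⁻¹) := by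
    intro x hx
    have hc : Continuous fun y : ℝ => G (σ + y * I) *
      ((x : ℂ) ^ ((σ : ℂ) + y * I + 1) * (((σ : ℂ) + y * I) * (σ + y * I + 1))⁻¹) := by
      refine (hdiff x hx).continuousOn.comp_continuous
        (f := fun y : ℝ => (σ : ℂ) + y * I) (by fun_prop) fun y => ?_
      simpa using hσ2
    refine ((integrable_one_add_norm (E := ℝ) (μ := volume) (r := 2 - η)
      (by simp; linarith)).const_mul
        (C * (max 1 x) ^ (3 : ℝ) * 16)).mono' hc.aestronglyMeasurable
        (Eventually.of_forall fun y => ?_)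
    simpa using hdom x hx (σ + y * I) (by simp) (by simpa using hσ2)
  have hJ : Integrable fun y : ℝ => (1 + |y|) ^ (-(1 + η)) :=
    integrable_one_add_norm (E := ℝ) (μ := volume) (r := 1 + η) (by simpa using hη)
  have hJ0 : 0 ≤ ∫ y : ℝ, (1 + |y|) ^ (-(1 + η)) := integral_nonneg fun y => by positivity
  refine ⟨256 * C * ∫ y : ℝ, (1 + |y|) ^ (-(1 + η)), by positivity, fun x hx => ?_⟩
  have hx0 : 0 < x := by linarith
  have hh : 0 < √x := Real.sqrt_pos.mpr hx0
  have hhx : √x ≤ x := Real.sqrt_le_iff.mpr ⟨hx0.le, by nlinarith⟩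
  have hpt : ∀ y : ℝ, ‖G (σ + y * I) * (((x + √x : ℝ) : ℂ) ^ ((σ : ℂ) + y * I + 1) *
        (((σ : ℂ) + y * I) * (σ + y * I + 1))⁻¹) - G (σ + y * I) * ((x : ℂ) ^ ((σ : ℂ) + y * I + 1) *
        (((σ : ℂ) + y * I) * (σ + y * I + 1))⁻¹)‖ ≤
      (256 * C * √x * x ^ (σ + η)) * (1 + |y|) ^ (-(1 + η)) := by
    intro y
    have hy : 0 < 1 + |y| := by positivity
    have h1 := norm_cpow_sub_cpow_le (θ := 2 * η) hx0 hh hhx (by linarith) (by linarith)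
      (s := σ + y * I) (by simpa using hσ.le)
    have h2 := hC (σ + y * I) (by simp) (by simpa using hσ2)
    have hre : ((σ : ℂ) + y * I).re = σ := by simp
    have him : ((σ : ℂ) + y * I).im = y := by simp
    rw [hre, him] at h1
    rw [him] at h2
    rw [← mul_sub, ← sub_mul, norm_mul, norm_mul]
    have h3 : (2 * x) ^ σ ≤ 4 * x ^ σ := by
      rw [Real.mul_rpow (by norm_num) hx0.le]
      gcongr
      have := Real.rpow_le_rpow_of_exponent_le (by norm_num : (1 : ℝ) ≤ 2) hσ2
      norm_num at this ⊢
      exact this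
    have h4 : (4 * x / √x) ^ (2 * η) ≤ 4 * x ^ η := by
      have h5 : x / √x = x ^ (1 / 2 : ℝ) := by rw [Real.div_sqrt, Real.sqrt_eq_rpow]
      rw [mul_div_assoc, h5, Real.mul_rpow (by norm_num) (by positivity), ← Real.rpow_mul hx0.le,
        show 1 / 2 * (2 * η) = η by ring]
      gcongr
      simpa using Real.rpow_le_rpow_of_exponent_le (by norm_num : (1 : ℝ) ≤ 4)
        (by linarith : 2 * η ≤ 1)
    calc _ ≤ (C * (1 + |y|) ^ η) * (16 * (4 * x ^ σ) * √x * (4 * x ^ η) *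
          (1 + |y|) ^ (-(1 + 2 * η))) := by
          refine mul_le_mul h2 (h1.trans ?_) (by positivity) (by positivity)
          gcongr
      _ = _ := by
          rw [show -(1 + η) = η + -(1 + 2 * η) by ring, Real.rpow_add hy, Real.rpow_add hx0]
          ring
  rw [← Real.norm_eq_abs, ← norm_real, ofReal_sub, hform _ (by positivity), hform _ hx0, ← mul_sub,
    ← integral_sub (hintg _ (by positivity)) (hintg _ hx0), norm_mul]
  have h1 := norm_integral_le_of_norm_le (hJ.const_mul (256 * C * √x * x ^ (σ + η)))
    (Eventually.of_forall hpt)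
  rw [integral_const_mul] at h1
  have h2 : ‖((1 / (2 * Real.pi) : ℝ) : ℂ)‖ ≤ 1 := by
    rw [norm_real, Real.norm_of_nonneg (by positivity), div_le_one (by positivity)]
    linarith [Real.pi_gt_three]
  refine (mul_le_mul h2 h1 (norm_nonneg _) zero_le_one).trans (le_of_eq ?_)
  ring

end Perron

namespace Perron

open Filter Topology

theorem abs_sum_le_of_coeff_le {b : ℕ → ℝ} {c δ : ℝ} (hδ : 0 ≤ δ) (hc0 : 0 ≤ c)
    (hc : ∀ n, n ≠ 0 → |b n| ≤ c * (n : ℝ) ^ δ) {x h : ℝ} (hx : 1 ≤ x) (hh : 1 ≤ h) (hhx : h ≤ x) :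
    |∑ m ∈ Finset.Icc 1 ⌊x + h⌋₊, b m * (x + h - m) - ∑ m ∈ Finset.Icc 1 ⌊x⌋₊, b m * (x - m) -
      h * ∑ m ∈ Finset.Icc 1 ⌊x⌋₊, b m| ≤ 2 * h * (h * (c * (2 * x) ^ δ)) := by
  have hle : ⌊x⌋₊ ≤ ⌊x + h⌋₊ := Nat.floor_le_floor (by linarith)
  have hsplit : Finset.Icc 1 ⌊x + h⌋₊ = Finset.Icc 1 ⌊x⌋₊ ∪ Finset.Ioc ⌊x⌋₊ ⌊x + h⌋₊ := by
    ext m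
    simp only [Finset.mem_union, Finset.mem_Icc, Finset.mem_Ioc]
    omega
  have hdisj : Disjoint (Finset.Icc 1 ⌊x⌋₊) (Finset.Ioc ⌊x⌋₊ ⌊x + h⌋₊) := by
    rw [Finset.disjoint_left]
    intro m hm hm'
    simp only [Finset.mem_Icc, Finset.mem_Ioc] at hm hm'
    omega
  have heq : ∑ m ∈ Finset.Icc 1 ⌊x + h⌋₊, b m * (x + h - m) -
      ∑ m ∈ Finset.Icc 1 ⌊x⌋₊, b m * (x - m) - h * ∑ m ∈ Finset.Icc 1 ⌊x⌋₊, b m =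
      ∑ m ∈ Finset.Ioc ⌊x⌋₊ ⌊x + h⌋₊, b m * (x + h - m) := by
    have : ∑ m ∈ Finset.Icc 1 ⌊x⌋₊, b m * (x + h - m) =
        ∑ m ∈ Finset.Icc 1 ⌊x⌋₊, b m * (x - m) + h * ∑ m ∈ Finset.Icc 1 ⌊x⌋₊, b m := by
      rw [Finset.mul_sum, ← Finset.sum_add_distrib]
      exact Finset.sum_congr rfl fun m _ => by ring
    rw [hsplit, Finset.sum_union hdisj, this]
    ring
  rw [heq]
  refine (Finset.abs_sum_le_sum_abs _ _).trans ?_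
  have hterm : ∀ m ∈ Finset.Ioc ⌊x⌋₊ ⌊x + h⌋₊, |b m * (x + h - m)| ≤ h * (c * (2 * x) ^ δ) := by
    intro m hm
    obtain ⟨hm1, hm2⟩ := Finset.mem_Ioc.mp hm
    have h1 : x < m := Nat.lt_of_floor_lt hm1
    have h2 : (m : ℝ) ≤ x + h := (Nat.le_floor_iff (by linarith)).mp hm2
    rw [abs_mul, mul_comm, abs_of_nonneg (by linarith : 0 ≤ x + h - m)]
    refine mul_le_mul (by linarith) ((hc m (by omega)).trans ?_) (abs_nonneg _) (by linarith)
    gcongr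
    linarith
  refine (Finset.sum_le_card_nsmul _ _ _ hterm).trans ?_
  rw [nsmul_eq_mul, Nat.card_Ioc, Nat.cast_sub hle]
  have h1 : (⌊x + h⌋₊ : ℝ) ≤ x + h := Nat.floor_le (by linarith)
  have h2 : x < ⌊x⌋₊ + 1 := Nat.lt_floor_add_one x
  refine mul_le_mul_of_nonneg_right (by linarith) (by positivity)

end Perron

open Complex NumberField Filter Topology Finset

/-- Under GRH for the Dedekind zeta function `ζK` of the number field `K`, the
summatory function `M_K(x) = ∑_{m ≤ x} b_m` of the Dirichlet coefficients of `1/ζK`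
satisfies `M_K(x) = O_ε(x^{1/2+ε})` for every `ε > 0`. -/
theorem GRH_implies_MK_bound
    (K : Type*) [Field K] [NumberField K] (ζK : ℂ → ℂ)
    (hζ_an : ∀ s : ℂ, s ≠ 1 → DifferentiableAt ℂ ζK s)
    (hζ_ser : ∀ s : ℂ, 1 < s.re →
      HasSum (fun I : {I : Ideal (𝓞 K) // I ≠ ⊥} =>
        ((Ideal.absNorm I.1 : ℕ) : ℂ) ^ (-s)) (ζK s))
    (hζ_pole : ∃ A : ℂ, A ≠ 0 ∧
      Tendsto (fun s : ℂ => (s - 1) * ζK s) (𝓝[≠] (1 : ℂ)) (𝓝 A))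
    (b : ℕ → ℝ)
    (hb : ∀ s : ℂ, 1 < s.re →
      HasSum (fun m : ℕ => (b m : ℂ) * (m : ℂ) ^ (-s)) (ζK s)⁻¹)
    (hGRH : ∀ ρ : ℂ, ζK ρ = 0 → 0 < ρ.re → ρ.re < 1 → ρ.re = 1/2) :
    ∀ ε : ℝ, 0 < ε →
      (fun x : ℝ => ∑ m ∈ Finset.Icc 1 ⌊x⌋₊, b m)
        =O[atTop] fun x : ℝ => x ^ ((1:ℝ)/2 + ε) := by

  obtain ⟨A, hA0, hA⟩ := hζ_pole
  have hZ0 : ∀ s : ℂ, 1 / 2 < s.re → s ≠ 1 → ζK s ≠ 0 := by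
    intro s hs hs1 h0
    rcases lt_trichotomy s.re 1 with h | h | h
    · linarith [hGRH s h0 (by linarith) h]
    · have h2 : s = 1 + s.im * I := by
        apply Complex.ext <;> simp [h]
      refine IdealEuler.ne_zero_of_re_eq_one hζ_an hζ_ser hA (t := s.im) (fun h3 => hs1 ?_)
        (h2 ▸ h0)
      rw [h2, h3]
      simp
    · exact IdealEuler.ne_zero_of_one_lt_re hζ_ser h h0
  have hN1 : ∀ I : {I : Ideal (𝓞 K) // I ≠ ⊥}, 1 ≤ Ideal.absNorm I.1 := fun I =>
    Nat.one_le_iff_ne_zero.mpr fun h => I.2 (Ideal.absNorm_eq_zero_iff.mp h)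
  have hfin : ∀ n : ℕ, {I : {I : Ideal (𝓞 K) // I ≠ ⊥} | Ideal.absNorm I.1 ≤ n}.Finite := fun n =>
    (Ideal.finite_setOfPred_absNorm_le n).preimage Subtype.val_injective.injOn
  obtain ⟨M, hM0, r, hM⟩ := IdealSum.norm_tsum_oscBump_sub_le K
  obtain ⟨C₁, hC₁0, hC₁⟩ := SmoothSum.exists_norm_le_of_smooth_sums hN1 hfin hζ_an hζ_ser hM0 hM
  obtain ⟨B₁, hB₁⟩ := LogGrowth.exists_norm_le_of_hasSum (c := fun _ => 1)
    (fun s hs => by simpa using hζ_ser s hs) (by norm_num : (1 : ℝ) < 5 / 4)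
  obtain ⟨B₂, hB₂⟩ := LogGrowth.exists_norm_le_of_hasSum hb (by norm_num : (1 : ℝ) < 5 / 4)
  intro ε' hε'
  obtain ⟨ε, hε, hε1, hεε'⟩ : ∃ ε : ℝ, 0 < ε ∧ ε ≤ 1 ∧ ε ≤ ε' :=
    ⟨min ε' 1, lt_min hε' one_pos, min_le_right _ _, min_le_left _ _⟩
  obtain ⟨C₂, hC₂0, hC₂⟩ := LogGrowth.exists_norm_inv_le_rpow hζ_an hZ0 hC₁0 hC₁
    (B := max B₁ B₂) (fun s hs => (hB₁ s hs).trans (le_max_left _ _))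
    (fun s hs => (hB₂ s hs).trans (le_max_right _ _))
    (by linarith : 1 / 2 < 1 / 2 + ε / 2) (by linarith) (by linarith : 0 < ε / 4)
  set G : ℂ → ℂ := Function.update (fun s => (ζK s)⁻¹) 1 0 with hGdef
  have hGd : DifferentiableOn ℂ G {s : ℂ | 1 / 2 < s.re} :=
    Perron.differentiableOn_update_inv hζ_an hA0 hA hZ0
  have hGe : ∀ s : ℂ, s ≠ 1 → G s = (ζK s)⁻¹ := fun s hs => Function.update_of_ne hs _ _
  obtain ⟨C₃, hC₃0, hC₃⟩ := Perron.exists_norm_le_one_add_rpow (G := G) (by linarith : 0 < ε / 4)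
    (hGd.continuousOn.mono fun s (hs : 1 / 2 + ε / 2 ≤ s.re) =>
      show 1 / 2 < s.re by linarith) hC₂0 (fun s hs h3 => by
        rw [hGe s (by rintro rfl; norm_num at h3)]
        exact hC₂ s hs h3)
  obtain ⟨D, hD0, hD⟩ := Perron.exists_abs_smoothed_sub_le (by linarith) (by linarith)
    (by linarith : 0 < ε / 4) (by linarith) hGd hC₃0 hC₃ (fun s hs => by
      rw [hGe s (by rintro rfl; norm_num at hs)]
      exact hb s hs)
  obtain ⟨c, hc0, hc⟩ := IdealEuler.exists_abs_coeff_le hζ_ser hb hε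
  refine Asymptotics.IsBigO.of_bound (D + 4 * c) ?_
  filter_upwards [eventually_ge_atTop 1] with x hx
  have hx0 : 0 < x := by linarith
  have hh : 1 ≤ √x := Real.one_le_sqrt.mpr hx
  have hhx : √x ≤ x := Real.sqrt_le_iff.mpr ⟨hx0.le, by nlinarith⟩
  have h1 := hD x hx
  have h2 := Perron.abs_sum_le_of_coeff_le hε.le hc0 hc hx hh hhx
  have h3 : x ^ (1 / 2 + ε / 2 + ε / 4) ≤ x ^ (1 / 2 + ε') :=
    Real.rpow_le_rpow_of_exponent_le hx (by linarith)
  have h4 : √x * (2 * x) ^ ε ≤ 2 * x ^ (1 / 2 + ε') := by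
    have h5 : (2 : ℝ) ^ ε ≤ 2 := by
      simpa using Real.rpow_le_rpow_of_exponent_le (by norm_num : (1 : ℝ) ≤ 2) hε1
    calc √x * (2 * x) ^ ε = 2 ^ ε * x ^ (1 / 2 + ε) := by
          rw [Real.mul_rpow (by norm_num) hx0.le, Real.rpow_add hx0, Real.sqrt_eq_rpow]
          ring
      _ ≤ 2 * x ^ (1 / 2 + ε') := by
          gcongr
  have h5 : √x * |∑ m ∈ Finset.Icc 1 ⌊x⌋₊, b m| ≤ √x * ((D + 4 * c) * x ^ (1 / 2 + ε')) := by
    rw [← abs_of_pos (by linarith : 0 < √x), ← abs_mul, abs_of_pos (by linarith : 0 < √x)]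
    have h6 : D * √x * x ^ (1 / 2 + ε / 2 + ε / 4) ≤ D * √x * x ^ (1 / 2 + ε') := by gcongr
    have h7 : 2 * √x * (√x * (c * (2 * x) ^ ε)) ≤ 2 * √x * (c * (2 * x ^ (1 / 2 + ε'))) := by
      rw [mul_left_comm (√x)]
      gcongr
    rw [abs_le] at h1 h2 ⊢
    constructor <;> linarith [h1.1, h1.2, h2.1, h2.2]
  rw [Real.norm_eq_abs, Real.norm_of_nonneg (by positivity)]
  exact le_of_mul_le_mul_left h5 (by linarith)
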